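/- Let n ≥ 3 and 1 ≤ i ≤ n−1, and suppose Φ_i ∈ MVal_i is a continuous translation invariant SO(n)-equivariant Minkowski valuation of degree i on convex bodies in an n-dimensional Euclidean vector space that is non-trivial, with constant r(Φ_i) > 0 satisfying W_{n−1}(Φ_i K) = r(Φ_i) W_{n−i}(K) for all K. If K ∈ K^n has non-empty interior, then W_{n−i}(K)^{i+1} ≥ (κ_n^i / r(Φ_i)^{i+1}) · W_{n−1−i}(Φ_i K). If Φ_i maps convex bodies with non-empty interior to convex bodies with non-empty interior, then equality holds if and only if Φ_i K is a Euclidean ball. -/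

import Mathlib

open scoped Pointwise NNReal
noncomputable section

abbrev En (n : ℕ) : Type := EuclideanSpace ℝ (Fin n)
abbrev Body (n : ℕ) : Type := ConvexBody (En n)

/-- The special orthogonal group `SO(n)`, as a subgroup of the orthogonal group. -/
def SOGroup (n : ℕ) : Subgroup (Matrix.orthogonalGroup (Fin n) ℝ) where
  carrier := {g | Matrix.det (g : Matrix (Fin n) (Fin n) ℝ) = 1}
  one_mem' := by simp
  mul_mem' := by
    intro a b ha hb
    simp only [Set.mem_setOf_eq] at *
    rw [Submonoid.coe_mul, Matrix.det_mul, ha, hb, mul_one]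
  inv_mem' := by
    intro a ha
    simp only [Set.mem_setOf_eq] at *
    have h : ((a * a⁻¹ : Matrix.orthogonalGroup (Fin n) ℝ) : Matrix (Fin n) (Fin n) ℝ) = 1 := by
      rw [mul_inv_cancel]; rfl
    rw [Submonoid.coe_mul] at h
    have h2 := congrArg Matrix.det h
    rw [Matrix.det_mul, ha, one_mul, Matrix.det_one] at h2
    exact h2

/-- The underlying matrix of an element of `O(n)`. -/
def OMat {n : ℕ} (g : Matrix.orthogonalGroup (Fin n) ℝ) : Matrix (Fin n) (Fin n) ℝ := g

/-- The underlying matrix of an element of `SO(n)`. -/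
def SOMat {n : ℕ} (g : SOGroup n) : Matrix (Fin n) (Fin n) ℝ := ((g : Matrix.orthogonalGroup (Fin n) ℝ) : Matrix (Fin n) (Fin n) ℝ)

def mapBody {n : ℕ} (A : Matrix (Fin n) (Fin n) ℝ) (K : Body n) : Body n where
  carrier := (Matrix.toEuclideanLin A) '' (K : Set (En n))
  convex' := K.convex.linear_image _
  isCompact' := K.isCompact.image (LinearMap.continuous_of_finiteDimensional _)
  nonempty' := K.nonempty.image _

/-- Rotation of a convex body by an element of `SO(n)`. -/
def rotBody {n : ℕ} (g : SOGroup n) (K : Body n) : Body n := mapBody (SOMat g) K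

/-- Rotation of a convex body by an element of `O(n)`. -/
def rotBodyO {n : ℕ} (g : Matrix.orthogonalGroup (Fin n) ℝ) (K : Body n) : Body n := mapBody (OMat g) K

/-- The natural action of `SO(n)` on complex-valued functions of convex bodies. -/
def actVal {n : ℕ} {M : Type*} (g : SOGroup n) (φ : Body n → M) : Body n → M :=
  fun K => φ (rotBody g⁻¹ K)

/-- Volume of a convex body. -/
def bvol {n : ℕ} (K : Body n) : ℝ := (MeasureTheory.volume (K : Set (En n))).toReal

/-- The mixed volume of an `n`-tuple of convex bodies, defined through the standard
polarization formula. -/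
def mixedVol {n : ℕ} (K : Fin n → Body n) : ℝ :=
  (n.factorial : ℝ)⁻¹ * ∑ S : Finset (Fin n),
    if S.Nonempty then (-1 : ℝ) ^ (n - S.card) * bvol (∑ i ∈ S, K i) else 0

/-- The Euclidean unit ball as a convex body. -/
def unitB (n : ℕ) : Body n where
  carrier := Metric.closedBall (0 : En n) 1
  convex' := convex_closedBall _ _
  isCompact' := isCompact_closedBall _ _
  nonempty' := ⟨0, Metric.mem_closedBall_self zero_le_one⟩

/-- The `j`-th quermassintegral `W_j(K)`: the mixed volume of `n - j` copies of `K` and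
`j` copies of the unit ball. -/
def quer {n : ℕ} (j : ℕ) (K : Body n) : ℝ :=
  mixedVol (fun l => if (l : ℕ) < n - j then K else unitB n)

/-- The mixed quermassintegral `W_j(K, L)`: the mixed volume of `n - 1 - j` copies of `K`,
`j` copies of the unit ball and one copy of `L`. -/
def querM {n : ℕ} (j : ℕ) (K L : Body n) : ℝ :=
  mixedVol (fun l => if (l : ℕ) < n - 1 - j then K else if (l : ℕ) < n - 1 then unitB n else L)

/-- The volume `κ_m` of the `m`-dimensional Euclidean unit ball. -/
def kappa (m : ℕ) : ℝ := (MeasureTheory.volume (Metric.closedBall (0 : En m) 1)).toReal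

/-- The `i`-th intrinsic volume, normalized by `κ_{n-i} V_i(K) = (n choose i) W_{n-i}(K)`. -/
def intrVol {n : ℕ} (i : ℕ) (K : Body n) : ℝ :=
  (n.choose i : ℝ) * quer (n - i) K / kappa (n - i)

/-- Two convex bodies are homothetic if one is a translate of a positive dilate of the other. -/
def Homothetic {n : ℕ} (K L : Body n) : Prop :=
  ∃ (t : ℝ) (x : En n), 0 < t ∧ (L : Set (En n)) = (fun y => x + t • y) '' (K : Set (En n))

/-- A convex body with nonempty interior. -/
def HasInterior {n : ℕ} (K : Body n) : Prop := (interior (K : Set (En n))).Nonempty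


/-- The translate of a convex body by a vector. -/
def transBody {n : ℕ} (x : En n) (K : Body n) : Body n where
  carrier := (fun y => x + y) '' (K : Set (En n))
  convex' := K.convex.translate x
  isCompact' := K.isCompact.image (continuous_const.add continuous_id)
  nonempty' := K.nonempty.image _

/-- The dilate of a convex body by a real factor. -/
def scaleBody {n : ℕ} (t : ℝ) (K : Body n) : Body n where
  carrier := t • (K : Set (En n))
  convex' := K.convex.smul t
  isCompact' := K.isCompact.smul t
  nonempty' := K.nonempty.smul_set

/-- `φ` is a valuation: additive on unions of convex bodies which are again convex bodies. -/
def IsValuation {n : ℕ} {M : Type*} [Add M] (φ : Body n → M) : Prop :=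
  ∀ K L U I : Body n,
    (U : Set (En n)) = (K : Set (En n)) ∪ (L : Set (En n)) →
    (I : Set (En n)) = (K : Set (En n)) ∩ (L : Set (En n)) →
    φ K + φ L = φ U + φ I

/-- `φ` is translation invariant. -/
def IsTransInv {n : ℕ} {M : Type*} (φ : Body n → M) : Prop :=
  ∀ (x : En n) (K : Body n), φ (transBody x K) = φ K

/-- `φ` (scalar- or vector-valued) is homogeneous of degree `i`. -/
def IsHomog {n : ℕ} {M : Type*} [SMul ℝ M] (i : ℕ) (φ : Body n → M) : Prop :=
  ∀ (t : ℝ), 0 < t → ∀ K : Body n, φ (scaleBody t K) = (t ^ i : ℝ) • φ K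

/-- `φ` is a continuous, translation invariant valuation. -/
def IsContTIVal {n : ℕ} {M : Type*} [Add M] [TopologicalSpace M] (φ : Body n → M) : Prop :=
  Continuous φ ∧ IsValuation φ ∧ IsTransInv φ

/-- `φ` is a bivaluation: a valuation in each of its two arguments. -/
def IsBival {n : ℕ} {M : Type*} [Add M] (φ : Body n → Body n → M) : Prop :=
  (∀ L : Body n, IsValuation (fun K => φ K L)) ∧ (∀ K : Body n, IsValuation (φ K))

/-- `φ` is invariant under independent translations of its two arguments. -/
def IsTransBiinv {n : ℕ} {M : Type*} (φ : Body n → Body n → M) : Prop :=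
  ∀ (x y : En n) (K L : Body n), φ (transBody x K) (transBody y L) = φ K L

/-- `φ` has bidegree `(i, j)`. -/
def IsBihomog {n : ℕ} {M : Type*} [SMul ℝ M] (i j : ℕ) (φ : Body n → Body n → M) : Prop :=
  ∀ (t s : ℝ), 0 < t → 0 < s → ∀ K L : Body n,
    φ (scaleBody t K) (scaleBody s L) = (t ^ i * s ^ j : ℝ) • φ K L

/-- `φ` is `O(n)` invariant. -/
def IsOBiinv {n : ℕ} {M : Type*} (φ : Body n → Body n → M) : Prop :=
  ∀ (g : Matrix.orthogonalGroup (Fin n) ℝ) (K L : Body n), φ (rotBodyO g K) (rotBodyO g L) = φ K L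

/-- `φ` is `SO(n)` invariant. -/
def IsSOBiinv {n : ℕ} {M : Type*} (φ : Body n → Body n → M) : Prop :=
  ∀ (g : SOGroup n) (K L : Body n), φ (rotBody g K) (rotBody g L) = φ K L

/-- `φ` is jointly continuous. -/
def ContinuousBi {n : ℕ} {M : Type*} [TopologicalSpace M] (φ : Body n → Body n → M) : Prop :=
  Continuous fun p : Body n × Body n => φ p.1 p.2

/-- A continuous translation invariant Minkowski valuation which is
homogeneous of degree `i`. -/
def IsMinkValHom {n : ℕ} (i : ℕ) (Φ : Body n → Body n) : Prop :=
  Continuous Φ ∧ IsValuation Φ ∧ IsTransInv Φ ∧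
    ∀ (t : ℝ), 0 < t → ∀ K : Body n, Φ (scaleBody t K) = scaleBody (t ^ i) (Φ K)

/-- A Minkowski valuation is `SO(n)` equivariant. -/
def IsSOEquivariant {n : ℕ} (Φ : Body n → Body n) : Prop :=
  ∀ (g : SOGroup n) (K : Body n), Φ (rotBody g K) = rotBody g (Φ K)

/-- A Minkowski valuation is `O(n)` equivariant. -/
def IsOEquivariant {n : ℕ} (Φ : Body n → Body n) : Prop :=
  ∀ (g : Matrix.orthogonalGroup (Fin n) ℝ) (K : Body n), Φ (rotBodyO g K) = rotBodyO g (Φ K)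

theorem bochner_local_to_global {ι : Type*} [Fintype ι] [DecidableEq ι] (G : ι → ι → ι → ℝ)
    (hG : ∀ i j k, 0 ≤ G i j k) (hs1 : ∀ i j k, G i j k = G j i k)
    (hs2 : ∀ i j k, G i j k = G i k j) (A : ι → ι → ℝ) (hA : ∀ j k, A j k = ∑ i, G i j k)
    (p : ι → ℝ) (hp : ∀ i, p i = ∑ j, A i j)
    (hloc : ∀ i (x : ι → ℝ), p i * (∑ j, ∑ k, G i j k * x j * x k) ≤ (∑ j, A i j * x j) ^ 2)
    (o : ι) (ho : ∀ i, p i ≠ 0 → 0 < A o i) (x : ι → ℝ) :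
    (∑ i, p i) * (∑ i, ∑ j, A i j * x i * x j) ≤ (∑ i, p i * x i) ^ 2 := by
  have hA0 : ∀ i j, 0 ≤ A i j := fun i j => by
    rw [hA]; exact Finset.sum_nonneg fun _ _ => hG _ _ _
  have hAs : ∀ i j, A i j = A j i := fun i j => by
    rw [hA, hA]; exact Finset.sum_congr rfl fun _ _ => hs2 _ _ _
  have hp0 : ∀ i, 0 ≤ p i := fun i => by
    rw [hp]; exact Finset.sum_nonneg fun _ _ => hA0 _ _
  have hpA : ∀ i j, p i = 0 → A i j = 0 := fun i j h => by
    rw [hp, Finset.sum_eq_zero_iff_of_nonneg (fun _ _ => hA0 _ _)] at h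
    exact h j (Finset.mem_univ _)
  have hpG : ∀ i j k, p i = 0 → G i j k = 0 := fun i j k h => by
    have h1 := hpA i k h
    rw [hA, Finset.sum_eq_zero_iff_of_nonneg (fun _ _ => hG _ _ _)] at h1
    rw [hs1]; exact h1 j (Finset.mem_univ _)
  set s : ι → ℝ := fun i => √(p i) with hs
  have hss : ∀ i, s i * s i = p i := fun i => Real.mul_self_sqrt (hp0 i)
  have hs0 : ∀ i, s i = 0 ↔ p i = 0 := fun i => Real.sqrt_eq_zero (hp0 i)
  let B : Matrix ι ι ℝ := Matrix.of fun i j => A i j / (s i * s j)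
  have hB : ∀ i j, s i * B i j * s j = A i j := by
    intro i j
    simp only [B, Matrix.of_apply]
    by_cases hi : s i = 0
    · rw [hpA i j ((hs0 i).1 hi)]; simp
    by_cases hj : s j = 0
    · rw [hAs, hpA j i ((hs0 j).1 hj)]; simp
    field_simp
  have hBH : B.IsHermitian := by
    ext i j
    simp [B, hAs j i, mul_comm]
  let T := Matrix.toEuclideanLin B
  have hT : T.IsSymmetric := Matrix.isSymmetric_toEuclideanLin_iff.2 hBH
  have hTa : ∀ (u : EuclideanSpace ℝ ι) i, (T u) i = ∑ j, B i j * u j := by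
    intro u i
    simp [T, Matrix.toLpLin_apply, Matrix.mulVec, dotProduct]
  -- quadratic form in terms of rescaled vectors
  have hq : ∀ (y : ι → ℝ), inner ℝ (T (WithLp.toLp 2 fun i => s i * y i))
      (WithLp.toLp 2 fun i => s i * y i) = ∑ i, ∑ j, A i j * y i * y j := by
    intro y
    rw [PiLp.inner_apply]
    refine Finset.sum_congr rfl fun i _ => ?_
    rw [hTa]
    simp only [RCLike.inner_apply, conj_trivial]
    rw [Finset.mul_sum]
    refine Finset.sum_congr rfl fun j _ => ?_
    rw [← hB i j]; ring
  have key : ∀ (l : ℝ) (u : EuclideanSpace ℝ ι), 0 < l → T u = l • u → u ≠ 0 →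
      ∃ c : ℝ, ∀ i, u i = c * s i := by
    intro l u hl hu hu0
    have hu0i : ∀ i, p i = 0 → u i = 0 := by
      intro i hi
      have := congrArg (fun w : EuclideanSpace ℝ ι => w i) hu
      simp only [hTa, PiLp.smul_apply, smul_eq_mul] at this
      have h2 : ∑ j, B i j * u j = 0 := Finset.sum_eq_zero fun j _ => by
        simp [B, hpA i j hi]
      rw [h2] at this
      rcases mul_eq_zero.1 this.symm with h | h
      · exact absurd h hl.ne'
      · exact h
    set y : ι → ℝ := fun i => u i / s i with hy
    have hsy : ∀ i, s i * y i = u i := by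
      intro i
      by_cases hi : s i = 0
      · rw [hu0i i ((hs0 i).1 hi), hi]; simp
      · simp only [hy]; field_simp
    have hAy : ∀ i, ∑ j, A i j * y j = l * p i * y i := by
      intro i
      have := congrArg (fun w : EuclideanSpace ℝ ι => w i) hu
      simp only [hTa, PiLp.smul_apply, smul_eq_mul] at this
      calc ∑ j, A i j * y j = s i * ∑ j, B i j * u j := by
            rw [Finset.mul_sum]
            refine Finset.sum_congr rfl fun j _ => ?_
            rw [← hB i j, ← hsy j]; ring
        _ = l * p i * y i := by rw [this, ← hsy, ← hss]; ring
    have hN : 0 < ∑ i, p i * y i ^ 2 := by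
      have : ∑ i, p i * y i ^ 2 = ∑ i, u i ^ 2 := Finset.sum_congr rfl fun i _ => by
        rw [← hsy, ← hss]; ring
      rw [this, ← EuclideanSpace.real_norm_sq_eq]
      exact pow_pos (norm_pos_iff.2 hu0) 2
    have hyAy : ∑ i, ∑ j, A i j * y i * y j = l * ∑ i, p i * y i ^ 2 := by
      rw [Finset.mul_sum]
      refine Finset.sum_congr rfl fun i _ => ?_
      calc ∑ j, A i j * y i * y j = y i * ∑ j, A i j * y j := by
            rw [Finset.mul_sum]; exact Finset.sum_congr rfl fun j _ => by ring
        _ = _ := by rw [hAy]; ring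
    have hl1 : 1 ≤ l := by
      have h1 : ∀ i, ∑ j, ∑ k, G i j k * y j * y k ≤ l ^ 2 * (p i * y i ^ 2) := by
        intro i
        by_cases hi : p i = 0
        · simp [hi, hpG i _ _ hi]
        · have hpi : 0 < p i := lt_of_le_of_ne (hp0 i) (Ne.symm hi)
          have := hloc i y
          rw [hAy] at this
          refine le_of_mul_le_mul_left (this.trans_eq ?_) hpi
          ring
      have h2 := Finset.sum_le_sum fun i (_ : i ∈ Finset.univ) => h1 i
      have h3 : ∑ i, ∑ j, ∑ k, G i j k * y j * y k = ∑ i, ∑ j, A i j * y i * y j := by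
        rw [Finset.sum_comm]
        refine Finset.sum_congr rfl fun j _ => ?_
        rw [Finset.sum_comm]
        refine Finset.sum_congr rfl fun k _ => ?_
        rw [hA, Finset.sum_mul, Finset.sum_mul]
      rw [h3, hyAy, ← Finset.mul_sum] at h2
      have h4 : l ≤ l ^ 2 := le_of_mul_le_mul_right h2 hN
      nlinarith
    have hlap : ∑ i, ∑ j, A i j * (y i - y j) ^ 2 = 2 * (1 - l) * ∑ i, p i * y i ^ 2 := by
      have e1 : ∑ i, ∑ j, A i j * y i ^ 2 = ∑ i, p i * y i ^ 2 :=
        Finset.sum_congr rfl fun i _ => by rw [hp, Finset.sum_mul]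
      have e2 : ∑ i, ∑ j, A i j * y j ^ 2 = ∑ i, p i * y i ^ 2 := by
        rw [Finset.sum_comm, ← e1]
        exact Finset.sum_congr rfl fun i _ => Finset.sum_congr rfl fun j _ => by rw [hAs]
      calc _ = ∑ i, ∑ j, (A i j * y i ^ 2 + A i j * y j ^ 2 - 2 * (A i j * y i * y j)) :=
            Finset.sum_congr rfl fun i _ => Finset.sum_congr rfl fun j _ => by ring
        _ = _ := by
            simp only [Finset.sum_add_distrib, Finset.sum_sub_distrib, ← Finset.mul_sum]
            rw [e1, e2, hyAy]; ring
    have hnn : ∀ i ∈ Finset.univ, 0 ≤ ∑ j, A i j * (y i - y j) ^ 2 := fun i _ =>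
      Finset.sum_nonneg fun j _ => mul_nonneg (hA0 _ _) (sq_nonneg _)
    have hz : ∑ i, ∑ j, A i j * (y i - y j) ^ 2 = 0 := by
      refine le_antisymm ?_ (Finset.sum_nonneg hnn)
      rw [hlap]; nlinarith
    rw [Finset.sum_eq_zero_iff_of_nonneg hnn] at hz
    have hzo := hz o (Finset.mem_univ _)
    rw [Finset.sum_eq_zero_iff_of_nonneg
      (fun j _ => mul_nonneg (hA0 _ _) (sq_nonneg _))] at hzo
    refine ⟨y o, fun i => ?_⟩
    by_cases hi : p i = 0
    · rw [hu0i i hi, (hs0 i).2 hi, mul_zero]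
    · have h1 := hzo i (Finset.mem_univ _)
      rcases mul_eq_zero.1 h1 with h | h
      · exact absurd h (ho i hi).ne'
      · have h2 : y o = y i := by
          have := pow_eq_zero_iff (two_ne_zero) |>.1 h
          linarith
        rw [h2, ← hsy]; ring
  have hneg : ∀ z : EuclideanSpace ℝ ι, ∑ i, s i * z i = 0 → inner ℝ (T z) z ≤ 0 := by
    intro z hz
    have hn : Module.finrank ℝ (EuclideanSpace ℝ ι) = Fintype.card ι := finrank_euclideanSpace
    let b := hT.eigenvectorBasis hn
    have h1 : inner ℝ (T z) z = ∑ a, inner ℝ (T z) (b a) * inner ℝ (b a) z :=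
      (b.sum_inner_mul_inner _ _).symm
    rw [h1]
    refine Finset.sum_nonpos fun a _ => ?_
    have h2 : T (b a) = hT.eigenvalues hn a • b a :=
      hT.apply_eigenvectorBasis hn a
    rw [hT z (b a), h2, inner_smul_right, real_inner_comm, mul_assoc]
    rcases le_or_gt (hT.eigenvalues hn a) 0 with h | h
    · exact mul_nonpos_of_nonpos_of_nonneg h (mul_self_nonneg _)
    · obtain ⟨c, hc⟩ := key _ _ h h2 (b.orthonormal.ne_zero a)
      have : inner ℝ (b a) z = 0 := by
        rw [PiLp.inner_apply]
        calc _ = ∑ i, c * (s i * z i) := Finset.sum_congr rfl fun i _ => by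
              simp only [RCLike.inner_apply, conj_trivial, hc]; ring
          _ = 0 := by rw [← Finset.mul_sum, hz, mul_zero]
      rw [this]; simp
  have hA1 : ∀ i, ∑ j, A i j = p i := fun i => (hp i).symm
  rcases (Finset.sum_nonneg fun i (_ : i ∈ Finset.univ) => hp0 i).eq_or_lt with h0 | h0
  · rw [← h0, zero_mul]; positivity
  set P := ∑ i, p i with hP
  set m := (∑ i, p i * x i) / P with hm
  have hmP : m * P = ∑ i, p i * x i := by rw [hm]; field_simp
  have h1 := hneg (WithLp.toLp 2 fun i => s i * (x i - m)) (by
    calc _ = ∑ i, (p i * x i - m * p i) := Finset.sum_congr rfl fun i _ => by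
          simp only [← hss]; ring
      _ = 0 := by rw [Finset.sum_sub_distrib, ← Finset.mul_sum, ← hmP]; ring)
  rw [hq] at h1
  have h2 : ∑ i, ∑ j, A i j * (x i - m) * (x j - m) =
      (∑ i, ∑ j, A i j * x i * x j) - 2 * m * (∑ i, p i * x i) + m ^ 2 * P := by
    have e1 : ∑ i, ∑ j, A i j * x i = ∑ i, p i * x i :=
        Finset.sum_congr rfl fun i _ => by rw [hp, Finset.sum_mul]
    have e2 : ∑ i, ∑ j, A i j * x j = ∑ i, p i * x i := by
      rw [Finset.sum_comm, ← e1]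
      exact Finset.sum_congr rfl fun i _ => Finset.sum_congr rfl fun j _ => by rw [hAs]
    have e3 : ∑ i, ∑ j, A i j = P := Finset.sum_congr rfl fun i _ => hA1 i
    calc _ = ∑ i, ∑ j, (A i j * x i * x j - m * (A i j * x i) - m * (A i j * x j)
          + m ^ 2 * A i j) :=
        Finset.sum_congr rfl fun i _ => Finset.sum_congr rfl fun j _ => by ring
      _ = _ := by
        simp only [Finset.sum_add_distrib, Finset.sum_sub_distrib, ← Finset.mul_sum]
        rw [e1, e2, e3]; ring
  rw [h2, ← hmP] at h1
  rw [← hmP]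
  nlinarith

section DirectionalDerivative
open MvPolynomial

/-- The derivative of a polynomial in direction `z`. -/
def dirD {σ : Type*} [Fintype σ] (z : σ → ℝ) : MvPolynomial σ ℝ →ₗ[ℝ] MvPolynomial σ ℝ :=
  ∑ i, z i • (pderiv i).toLinearMap

/-- A polynomial with nonnegative coefficients. -/
def NonnegCoeff {σ : Type*} (p : MvPolynomial σ ℝ) : Prop := ∀ m, 0 ≤ coeff m p

/-- The reverse Cauchy–Schwarz inequality for the Hessian of `p` on the positive orthant. -/
def HessHyp {σ : Type*} [Fintype σ] (p : MvPolynomial σ ℝ) : Prop :=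
  ∀ w : σ → ℝ, (∀ i, 0 < w i) → ∀ y : σ → ℝ,
    eval w (dirD w (dirD w p)) * eval w (dirD y (dirD y p)) ≤ eval w (dirD w (dirD y p)) ^ 2

theorem pderiv_comm {σ : Type*} (i j : σ) (p : MvPolynomial σ ℝ) :
    pderiv i (pderiv j p) = pderiv j (pderiv i p) := by
  classical
  by_cases h : i = j
  · rw [h]
  ext m
  simp only [coeff_pderiv, Finsupp.add_apply, Finsupp.single_apply, h, Ne.symm h, if_false]
  rw [add_right_comm]
  push_cast
  ring

theorem NonnegCoeff.eval_nonneg {σ : Type*} {p : MvPolynomial σ ℝ} (hp : NonnegCoeff p) {z : σ → ℝ}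
    (hz : ∀ i, 0 ≤ z i) : 0 ≤ eval z p := by
  rw [eval_eq]
  exact Finset.sum_nonneg fun m _ => mul_nonneg (hp m)
    (Finset.prod_nonneg fun i _ => pow_nonneg (hz i) _)

theorem NonnegCoeff.eq_zero {σ : Type*} {p : MvPolynomial σ ℝ} (hp : NonnegCoeff p) {w : σ → ℝ}
    (hw : ∀ i, 0 < w i) (h : eval w p = 0) : p = 0 := by
  rw [eval_eq, Finset.sum_eq_zero_iff_of_nonneg (fun m _ => mul_nonneg (hp m)
    (Finset.prod_nonneg fun i _ => pow_nonneg (hw i).le _))] at h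
  ext m
  by_contra h1
  have h2 := h m (mem_support_iff.2 (by simpa using h1))
  rcases mul_eq_zero.1 h2 with h3 | h3
  · exact h1 (by simpa using h3)
  · exact (Finset.prod_pos fun i _ => pow_pos (hw i) _).ne' h3

variable {σ : Type*} [Fintype σ]

theorem dirD_apply (z : σ → ℝ) (p : MvPolynomial σ ℝ) : dirD z p = ∑ i, z i • pderiv i p := by
  simp [dirD]

theorem dirD_add_left (y z : σ → ℝ) (p : MvPolynomial σ ℝ) :
    dirD (y + z) p = dirD y p + dirD z p := by
  simp [dirD_apply, add_smul, Finset.sum_add_distrib]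

theorem dirD_smul_left (c : ℝ) (z : σ → ℝ) (p : MvPolynomial σ ℝ) :
    dirD (c • z) p = c • dirD z p := by
  simp [dirD_apply, mul_smul, Finset.smul_sum]

theorem dirD_sum_left {τ : Type*} (s : Finset τ) (z : τ → σ → ℝ) (p : MvPolynomial σ ℝ) :
    dirD (∑ k ∈ s, z k) p = ∑ k ∈ s, dirD (z k) p := by
  classical
  induction s using Finset.induction_on with
  | empty => simp [dirD_apply]
  | insert a s ha ih => rw [Finset.sum_insert ha, Finset.sum_insert ha, dirD_add_left, ih]

theorem dirD_single [DecidableEq σ] (j : σ) (p : MvPolynomial σ ℝ) :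
    dirD (Pi.single j 1) p = pderiv j p := by
  rw [dirD_apply, Finset.sum_eq_single j] <;> simp +contextual

theorem dirD_comm (y z : σ → ℝ) (p : MvPolynomial σ ℝ) :
    dirD y (dirD z p) = dirD z (dirD y p) := by
  simp only [dirD_apply, map_sum, map_smul, Finset.smul_sum]
  rw [Finset.sum_comm]
  exact Finset.sum_congr rfl fun i _ => Finset.sum_congr rfl fun j _ => by
    rw [pderiv_comm, smul_comm]

theorem dirD_homog {d : ℕ} (z : σ → ℝ) {p : MvPolynomial σ ℝ} (hp : p.IsHomogeneous d) :
    (dirD z p).IsHomogeneous (d - 1) := by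
  rw [dirD_apply]
  refine IsHomogeneous.sum _ _ _ fun i _ => ?_
  rw [smul_eq_C_mul]
  simpa using (isHomogeneous_C σ (z i)).mul (hp.pderiv (i := i))

theorem dirD_eq_zero (z : σ → ℝ) {p : MvPolynomial σ ℝ} (hp : p.IsHomogeneous 0) :
    dirD z p = 0 := by
  rw [← totalDegree_zero_iff_isHomogeneous, totalDegree_eq_zero_iff_eq_C] at hp
  rw [hp, dirD_apply]
  simp

theorem eval_dirD_self {d : ℕ} {p : MvPolynomial σ ℝ} (hp : p.IsHomogeneous d) (w : σ → ℝ) :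
    eval w (dirD w p) = d * eval w p := by
  have := congrArg (eval w) hp.sum_X_mul_pderiv
  simp only [map_sum, map_mul, eval_X, nsmul_eq_mul, map_natCast] at this
  rw [← this, dirD_apply]
  simp [smul_eval]

theorem dirD_iter_homog {d : ℕ} (z : σ → ℝ) {p : MvPolynomial σ ℝ} (hp : p.IsHomogeneous d)
    (m : ℕ) : ((dirD z)^[m] p).IsHomogeneous (d - m) := by
  induction m with
  | zero => simpa
  | succ m ih => rw [Function.iterate_succ_apply']; exact dirD_homog z ih

theorem dirD_iter_comm (y z : σ → ℝ) (m : ℕ) (p : MvPolynomial σ ℝ) :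
    dirD y ((dirD z)^[m] p) = (dirD z)^[m] (dirD y p) := by
  induction m with
  | zero => rfl
  | succ m ih => rw [Function.iterate_succ_apply', dirD_comm, ih, Function.iterate_succ_apply']

theorem NonnegCoeff.dirD {p : MvPolynomial σ ℝ} (hp : NonnegCoeff p) {z : σ → ℝ}
    (hz : ∀ i, 0 ≤ z i) : NonnegCoeff (dirD z p) := by
  intro m
  rw [dirD_apply, coeff_sum]
  refine Finset.sum_nonneg fun i _ => ?_
  rw [coeff_smul, coeff_pderiv]
  exact mul_nonneg (hz i) (mul_nonneg (hp _) (by positivity))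

theorem NonnegCoeff.dirD_iter {p : MvPolynomial σ ℝ} (hp : NonnegCoeff p) {z : σ → ℝ}
    (hz : ∀ i, 0 ≤ z i) (m : ℕ) : NonnegCoeff ((_root_.dirD z)^[m] p) := by
  induction m with
  | zero => simpa
  | succ m ih => rw [Function.iterate_succ_apply']; exact ih.dirD hz

theorem eval_line {d : ℕ} {p : MvPolynomial σ ℝ} (hp : p.IsHomogeneous d) (w z : σ → ℝ)
    (s t : ℝ) : eval (s • w + t • z) p = ∑ m ∈ Finset.range (d + 1),
      eval w ((dirD z)^[m] p) / m.factorial * s ^ (d - m) * t ^ m := by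
  induction d generalizing p with
  | zero =>
    have h := hp
    rw [← totalDegree_zero_iff_isHomogeneous, totalDegree_eq_zero_iff_eq_C] at h
    rw [h]; simp
  | succ d ih =>
    have e := eval_dirD_self hp (s • w + t • z)
    rw [dirD_add_left, dirD_smul_left, dirD_smul_left, map_add, smul_eval, smul_eval,
      ih (dirD_homog w hp), ih (dirD_homog z hp)] at e
    have h1 : ∀ m ∈ Finset.range (d + 1), eval w ((dirD z)^[m] (dirD w p)) / m.factorial
        * s ^ (d - m) * t ^ m * s = ((d + 1 : ℕ) - (m : ℝ)) *
          (eval w ((dirD z)^[m] p) / m.factorial * s ^ (d + 1 - m) * t ^ m) := by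
      intro m hm
      have hm' : m ≤ d := Nat.lt_succ_iff.1 (Finset.mem_range.1 hm)
      rw [← dirD_iter_comm, eval_dirD_self (dirD_iter_homog z hp m), Nat.cast_sub (by omega),
        Nat.succ_sub hm', pow_succ]
      ring
    have h2 : ∀ m ∈ Finset.range (d + 1), eval w ((dirD z)^[m] (dirD z p)) / m.factorial
        * s ^ (d - m) * t ^ m * t = ((m + 1 : ℕ) : ℝ) *
          (eval w ((dirD z)^[m + 1] p) / (m + 1).factorial *
            s ^ (d + 1 - (m + 1)) * t ^ (m + 1)) := by
      intro m hm
      rw [Function.iterate_succ_apply, Nat.factorial_succ, Nat.add_sub_add_right, pow_succ]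
      push_cast
      have : ((m : ℝ) + 1) ≠ 0 := by positivity
      have : (m.factorial : ℝ) ≠ 0 := by positivity
      field_simp
    rw [mul_comm s, mul_comm t, Finset.sum_mul, Finset.sum_mul, Finset.sum_congr rfl h1,
      Finset.sum_congr rfl h2] at e
    have h3 := Finset.sum_range_succ' (fun m : ℕ => (m : ℝ) *
      (eval w ((dirD z)^[m] p) / m.factorial * s ^ (d + 1 - m) * t ^ m)) (d + 1)
    have h4 := Finset.sum_range_succ (fun m : ℕ => ((d + 1 : ℕ) - (m : ℝ)) *
      (eval w ((dirD z)^[m] p) / m.factorial * s ^ (d + 1 - m) * t ^ m)) (d + 1)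
    simp only [Nat.cast_zero, zero_mul, add_zero, sub_self] at h3 h4
    rw [← h3, ← h4, ← Finset.sum_add_distrib] at e
    have hd : ((d + 1 : ℕ) : ℝ) ≠ 0 := by positivity
    refine (mul_left_cancel₀ hd ?_).symm
    refine Eq.trans ?_ e
    rw [Finset.mul_sum]
    exact Finset.sum_congr rfl fun m _ => by ring

theorem hessHyp_of_degree_le_one {d : ℕ} {p : MvPolynomial σ ℝ} (hp : p.IsHomogeneous d)
    (hd : d ≤ 1) : HessHyp p := by
  intro w hw y
  have h : ∀ x z, dirD x (dirD z p) = 0 := fun x z =>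
    dirD_eq_zero x (by simpa [Nat.sub_eq_zero_of_le hd] using dirD_homog z hp)
  simp [h]

/-- Midpoint log-concavity of `p ^ (1/d)` implies hyperbolicity of the Hessian. -/
theorem hessHyp_of_midpoint {d : ℕ} {p : MvPolynomial σ ℝ} (hp : p.IsHomogeneous d)
    (hd : 1 ≤ d) (h0 : NonnegCoeff p)
    (hm : ∀ x y : σ → ℝ, (∀ i, 0 < x i) → (∀ i, 0 < y i) →
      4 ^ d * (eval x p * eval y p) ≤ eval (x + y) p ^ 2) : HessHyp p := by
  intro w hw y
  rcases (h0.eval_nonneg fun i => (hw i).le).eq_or_lt with hP | hP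
  · rw [h0.eq_zero hw hP.symm]; simp
  have key : ∀ y, eval w p * eval w (dirD y (dirD y p)) ≤ eval w (dirD y p) ^ 2 := by
    intro y
    set a := eval w p
    set b := eval w (dirD y p) with hb
    set c := eval w (dirD y (dirD y p)) with hc
    -- Taylor expansion with remainder
    obtain ⟨R, hRc, hR⟩ : ∃ R : ℝ → ℝ, Continuous R ∧
        ∀ t, eval (w + t • y) p = a + b * t + c / 2 * t ^ 2 + t ^ 3 * R t := by
      refine ⟨fun t => ∑ m ∈ Finset.range (d - 2),
        eval w ((dirD y)^[m + 3] p) / (m + 3).factorial * t ^ m, by fun_prop, fun t => ?_⟩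
      have := eval_line hp w y 1 t
      simp only [one_smul, one_pow, mul_one] at this
      rw [this]
      have hex : ∑ m ∈ Finset.range (d + 1), eval w ((dirD y)^[m] p) / m.factorial * t ^ m =
          ∑ m ∈ Finset.range (d - 2 + 3), eval w ((dirD y)^[m] p) / m.factorial * t ^ m := by
        refine Finset.sum_subset (by intro x; simp; omega) fun m _ hm => ?_
        have hm' : d + 1 ≤ m := by simpa using hm
        obtain ⟨k, rfl⟩ := Nat.exists_eq_add_of_le' hm'
        rw [show k + (d + 1) = (k + d) + 1 by ring, Function.iterate_succ_apply',
          dirD_eq_zero _ (by simpa using dirD_iter_homog y hp (k + d))]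
        simp
      rw [hex, Finset.sum_range_succ', Finset.sum_range_succ', Finset.sum_range_succ']
      simp only [Finset.mul_sum]
      have : ∀ m, eval w ((dirD y)^[m + 1 + 1 + 1] p) / (m + 1 + 1 + 1).factorial *
          t ^ (m + 1 + 1 + 1) =
          t ^ 3 * (eval w ((dirD y)^[m + 3] p) / (m + 3).factorial * t ^ m) := fun m => by
        rw [show m + 1 + 1 + 1 = m + 3 by ring]; ring
      simp only [this]
      simp [a, hb, hc]
      ring
    -- small `t`
    obtain ⟨δ, hδ, hδw⟩ : ∃ δ > (0 : ℝ), ∀ t : ℝ, |t| < δ → ∀ i, 0 < (w + t • y) i := by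
      have : ∀ᶠ t : ℝ in nhds 0, ∀ i, 0 < (w + t • y) i := by
        rw [Filter.eventually_all]
        intro i
        have hc : Continuous fun t : ℝ => (w + t • y) i := by
          simp only [Pi.add_apply, Pi.smul_apply]; fun_prop
        refine (hc.tendsto 0).eventually (lt_mem_nhds ?_)
        simpa using hw i
      obtain ⟨δ, hδ, h⟩ := Metric.eventually_nhds_iff.1 this
      exact ⟨δ, hδ, fun t ht => h (by simpa using ht)⟩
    have hin : ∀ t : ℝ, 0 < t → t < δ →
        (a * c - b ^ 2) + t * (a * (R t - R (-t)) + t * (c ^ 2 / 4 - b * (R t + R (-t)))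
          + t ^ 2 * (c / 2 * (R t - R (-t))) - t ^ 3 * R t * R (-t)) ≤ 0 := by
      intro t ht htd
      have h1 := hδw t (by rwa [abs_of_pos ht])
      have h2 := hδw (-t) (by rwa [abs_neg, abs_of_pos ht])
      have h3 := hm _ _ h1 h2
      have h4 : w + t • y + (w + (-t) • y) = (2 : ℝ) • w + (0 : ℝ) • w := by
        rw [neg_smul, zero_smul, two_smul]; abel
      have h5 : eval ((2 : ℝ) • w + (0 : ℝ) • w) p = 2 ^ d * a := by
        rw [eval_line hp w w 2 0, Finset.sum_range_succ', Finset.sum_eq_zero (by simp)]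
        simp [a, mul_comm]
      rw [h4, h5, hR, hR, mul_pow, ← pow_mul, mul_comm d 2, pow_mul] at h3
      rw [show (2 : ℝ) ^ 2 = 4 by norm_num] at h3
      have h6 : (a + b * t + c / 2 * t ^ 2 + t ^ 3 * R t) *
          (a + -(b * t) + c / 2 * t ^ 2 + (-t) ^ 3 * R (-t)) ≤ a ^ 2 := by
        refine le_of_mul_le_mul_left (h3.trans_eq' ?_) (by positivity : (0 : ℝ) < 4 ^ d)
        ring
      have h7 : t ^ 2 * ((a * c - b ^ 2) + t * (a * (R t - R (-t)) +
          t * (c ^ 2 / 4 - b * (R t + R (-t)))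
          + t ^ 2 * (c / 2 * (R t - R (-t))) - t ^ 3 * R t * R (-t))) ≤ 0 := by
        nlinarith
      exact nonpos_of_mul_nonpos_right h7 (by positivity)
    have hlim : Filter.Tendsto (fun t : ℝ => (a * c - b ^ 2) +
        t * (a * (R t - R (-t)) + t * (c ^ 2 / 4 - b * (R t + R (-t)))
          + t ^ 2 * (c / 2 * (R t - R (-t))) - t ^ 3 * R t * R (-t)))
          (nhdsWithin 0 (Set.Ioi 0)) (nhds (a * c - b ^ 2)) := by
      refine tendsto_nhdsWithin_of_tendsto_nhds ?_
      refine (Continuous.tendsto' ?_ 0 _ (by simp))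
      fun_prop
    have := le_of_tendsto hlim (b := 0) (by
      filter_upwards [Ioo_mem_nhdsGT hδ] with t ht using hin t ht.1 ht.2)
    linarith
  set P := eval w p
  set l := eval w (dirD y p) with hl
  have hw1 : eval w (dirD w p) = d * P := eval_dirD_self hp w
  have hwy : eval w (dirD w (dirD y p)) = (d - 1) * l := by
    rw [eval_dirD_self (dirD_homog y hp), Nat.cast_sub hd, Nat.cast_one]
  have hww : eval w (dirD w (dirD w p)) = (d - 1) * (d * P) := by
    rw [eval_dirD_self (dirD_homog w hp), Nat.cast_sub hd, Nat.cast_one, hw1]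
  set q := eval w (dirD y (dirD y p)) with hq
  have hd' : (1 : ℝ) ≤ d := by exact_mod_cast hd
  have k := key (y + (-(l / (d * P))) • w)
  simp only [dirD_add_left, dirD_smul_left, map_add, map_smul, smul_eval] at k
  rw [dirD_comm y w, hwy, hww, hw1, ← hq, ← hl] at k
  rw [hww, hwy]
  have hdP : (d : ℝ) * P ≠ 0 := by positivity
  set c := l / (d * P) with hc
  have hcl : l = c * (d * P) := by rw [hc]; field_simp
  rw [hcl] at k ⊢
  have k2 : P * q ≤ (d - 1) * d * c ^ 2 * P ^ 2 := by nlinarith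
  have : (d - 1) * (d * P) * q = ((d - 1) * d) * (P * q) := by ring
  rw [this]
  calc _ ≤ ((d - 1) * d : ℝ) * ((d - 1) * d * c ^ 2 * P ^ 2) :=
        mul_le_mul_of_nonneg_left k2 (by nlinarith)
    _ = _ := by ring

end DirectionalDerivative

section LorentzianPolynomial
open MvPolynomial

variable {σ : Type*} [Fintype σ]

/-- The reverse Cauchy–Schwarz inequality for a symmetric bilinear form does not depend on the
chosen vector. -/
theorem reverse_cauchy_transfer {V : Type*} [AddCommGroup V] [Module ℝ V]
    (Q : V →ₗ[ℝ] V →ₗ[ℝ] ℝ) (hs : ∀ x y, Q x y = Q y x) {w v : V} (hw : 0 < Q w w)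
    (h : ∀ x, Q w w * Q x x ≤ Q w x ^ 2) (hv : 0 ≤ Q v v) (x : V) :
    Q v v * Q x x ≤ Q v x ^ 2 := by
  rcases hv.eq_or_lt with h0 | h0
  · rw [← h0, zero_mul]; positivity
  have hwv : Q w v ≠ 0 := by
    intro h1
    have := h v
    rw [h1] at this
    nlinarith
  set α := Q w x / Q w v with hα
  have h1 := h (x - α • v)
  have h2 : Q w (x - α • v) = 0 := by
    simp only [map_sub, map_smul, smul_eq_mul, hα]; field_simp; ring
  rw [h2, zero_pow two_ne_zero] at h1
  have h3 : Q (x - α • v) (x - α • v) ≤ 0 := nonpos_of_mul_nonpos_right h1 hw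
  simp only [map_sub, map_smul, smul_eq_mul, LinearMap.sub_apply, LinearMap.smul_apply] at h3
  rw [hs x v] at h3
  nlinarith [mul_nonneg h0.le (neg_nonneg.2 h3), sq_nonneg (Q v x - α * Q v v)]

/-- The Hessian of `p` at `w` as a bilinear form. -/
def hessForm (p : MvPolynomial σ ℝ) (w : σ → ℝ) : (σ → ℝ) →ₗ[ℝ] (σ → ℝ) →ₗ[ℝ] ℝ :=
  LinearMap.mk₂ ℝ (fun x y => eval w (dirD x (dirD y p)))
    (fun x y z => by simp [dirD_add_left]) (fun c x y => by simp [dirD_smul_left, smul_eval])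
    (fun x y z => by simp [dirD_add_left]) (fun c x y => by simp [dirD_smul_left, smul_eval])

theorem hessForm_apply (p : MvPolynomial σ ℝ) (w x y : σ → ℝ) :
    hessForm p w x y = eval w (dirD x (dirD y p)) := rfl

theorem hessForm_comm (p : MvPolynomial σ ℝ) (w x y : σ → ℝ) :
    hessForm p w x y = hessForm p w y x := by
  rw [hessForm_apply, dirD_comm, hessForm_apply]

theorem hessForm_dirD_add (p : MvPolynomial σ ℝ) (w x y u v : σ → ℝ) :
    hessForm (dirD (u + v) p) w x y = hessForm (dirD u p) w x y + hessForm (dirD v p) w x y := by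
  simp [hessForm_apply, dirD_add_left]

theorem hessForm_dirD_smul (p : MvPolynomial σ ℝ) (w x y u : σ → ℝ) (c : ℝ) :
    hessForm (dirD (c • u) p) w x y = c * hessForm (dirD u p) w x y := by
  simp [hessForm_apply, dirD_smul_left, smul_eval]

theorem hessForm_dirD_swap (p : MvPolynomial σ ℝ) (w x y u : σ → ℝ) :
    hessForm (dirD u p) w x y = hessForm (dirD x p) w u y := by
  rw [hessForm_apply, hessForm_apply, dirD_comm y u, dirD_comm x u, dirD_comm x y]

theorem hessForm_nonneg {p : MvPolynomial σ ℝ} (hp : NonnegCoeff p) {w x y : σ → ℝ}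
    (hw : ∀ i, 0 ≤ w i) (hx : ∀ i, 0 ≤ x i) (hy : ∀ i, 0 ≤ y i) : 0 ≤ hessForm p w x y :=
  ((hp.dirD hy).dirD hx).eval_nonneg hw

theorem hessForm_self {d : ℕ} {p : MvPolynomial σ ℝ} (hp : p.IsHomogeneous d)
    (w y : σ → ℝ) : hessForm p w w y = (d - 1 : ℕ) * eval w (dirD y p) := by
  rw [hessForm_apply, eval_dirD_self (dirD_homog y hp)]

theorem HessHyp.form {d : ℕ} {p : MvPolynomial σ ℝ} (hp : p.IsHomogeneous d) (hd : 2 ≤ d)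
    (h0 : NonnegCoeff p) (h : HessHyp p) {w v : σ → ℝ} (hw : ∀ i, 0 < w i)
    (hv : ∀ i, 0 ≤ v i) (x : σ → ℝ) :
    hessForm p w v v * hessForm p w x x ≤ hessForm p w v x ^ 2 := by
  rcases (h0.eval_nonneg fun i => (hw i).le).eq_or_lt with hP | hP
  · rw [h0.eq_zero hw hP.symm]; simp [hessForm_apply]
  refine reverse_cauchy_transfer (hessForm p w) (hessForm_comm p w) (w := w) ?_ (h w hw)
    (hessForm_nonneg h0 (fun i => (hw i).le) hv hv) x
  rw [hessForm_self hp, eval_dirD_self hp]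
  have : 0 < d - 1 := by omega
  have : 0 < d := by omega
  positivity

theorem HessHyp.dirD_of_pderiv [DecidableEq σ] {d : ℕ} {f : MvPolynomial σ ℝ}
    (hf : f.IsHomogeneous d)
    (hd : 3 ≤ d) (h0 : NonnegCoeff f) (hH : HessHyp f) (o : σ)
    (hj : ∀ j, j ≠ o → HessHyp (pderiv j f)) {z : σ → ℝ} (hz : ∀ i, 0 ≤ z i) (hzo : z o = 0) :
    HessHyp (dirD z f) := by
  intro w hw y
  rcases (h0.eval_nonneg fun i => (hw i).le).eq_or_lt with hP | hP
  · rw [h0.eq_zero hw hP.symm]; simp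
  have hw0 : ∀ i, 0 ≤ w i := fun i => (hw i).le
  let b : σ → σ → ℝ := fun i => if i = o then w else Pi.single i 1
  have hb : ∀ i k, 0 ≤ b i k := by
    intro i k
    simp only [b]; split_ifs
    · exact hw0 k
    · by_cases hik : k = i
      · subst hik; simp
      · simp [hik]
  set e1 : σ → ℝ := fun i => if i = o then 0 else 1 with he1
  have hdd : (1 : ℝ) ≤ ((d - 1 - 1 : ℕ) : ℝ) := by exact_mod_cast (by omega : 1 ≤ d - 1 - 1)
  have hdd1 : (1 : ℝ) ≤ ((d - 1 : ℕ) : ℝ) := by exact_mod_cast (by omega : 1 ≤ d - 1)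
  have hTw : ∀ x y, hessForm (dirD w f) w x y = (d - 1 - 1 : ℕ) * hessForm f w x y := by
    intro x y
    rw [hessForm_dirD_swap, hessForm_self (dirD_homog x hf), hessForm_apply, dirD_comm]
  have key : ∀ ε : ℝ, 0 < ε →
      hessForm (dirD (ε • w + (z + ε • e1)) f) w w w *
        hessForm (dirD (ε • w + (z + ε • e1)) f) w y y ≤
      hessForm (dirD (ε • w + (z + ε • e1)) f) w w y ^ 2 := by
    intro ε hε
    set v : σ → ℝ := ε • w + (z + ε • e1) with hv
    have hvw : ∀ i, ε * w i ≤ v i := by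
      intro i
      simp only [hv, he1, Pi.add_apply, Pi.smul_apply, smul_eq_mul]
      have := hz i
      split_ifs <;> nlinarith
    have hv0 : ∀ i, 0 ≤ v i := fun i => (mul_nonneg hε.le (hw0 i)).trans (hvw i)
    let β : σ → ℝ := fun i => if i = o then ε else z i + ε
    have hβ : ∀ i, 0 < β i := by
      intro i; simp only [β]; split_ifs
      · exact hε
      · have := hz i; linarith
    have hsum : ∀ x : σ → ℝ, ∃ c : σ → ℝ, x = ∑ i, c i • b i := by
      intro x
      refine ⟨fun i => if i = o then x o / w o else x i - x o / w o * w i, ?_⟩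
      ext k
      rw [Finset.sum_apply, ← Finset.add_sum_erase _ _ (Finset.mem_univ o)]
      simp only [b, if_true, Pi.smul_apply, smul_eq_mul]
      have hwo := (hw o).ne'
      by_cases hk : k = o
      · rw [Finset.sum_eq_zero]
        · rw [hk]; field_simp; ring
        · intro i hi
          have : i ≠ o := Finset.ne_of_mem_erase hi
          simp [this, hk, Ne.symm this]
      · rw [Finset.sum_eq_single k]
        · simp [hk]
        · intro i hi hik
          have : i ≠ o := Finset.ne_of_mem_erase hi
          simp [this, Ne.symm hik]
        · simp [hk]
    have hvsum : v = ∑ i, β i • b i := by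
      ext k
      rw [Finset.sum_apply, ← Finset.add_sum_erase _ _ (Finset.mem_univ o)]
      simp only [b, β, if_true, Pi.smul_apply, smul_eq_mul, hv, Pi.add_apply, he1]
      congr 1
      by_cases hk : k = o
      · rw [Finset.sum_eq_zero]
        · simp [hk, hzo]
        · intro i hi
          have : i ≠ o := Finset.ne_of_mem_erase hi
          simp [this, hk, Ne.symm this]
      · rw [Finset.sum_eq_single k]
        · simp [hk]
        · intro i hi hik
          have : i ≠ o := Finset.ne_of_mem_erase hi
          simp [this, Ne.symm hik]
        · simp [hk]
    -- the trilinear form in the weighted basis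
    let T : σ → σ → σ → ℝ := fun i j k => hessForm (dirD (b i) f) w (b j) (b k)
    have hT0 : ∀ i j k, 0 ≤ T i j k := fun i j k =>
      hessForm_nonneg (h0.dirD (hb i)) hw0 (hb j) (hb k)
    have hexp : ∀ i (c c' : σ → ℝ), hessForm (dirD (b i) f) w (∑ j, c j • b j) (∑ k, c' k • b k) =
        ∑ j, ∑ k, T i j k * c j * c' k := by
      intro i c c'
      simp only [map_sum, map_smul, LinearMap.sum_apply, LinearMap.smul_apply, smul_eq_mul,
        Finset.mul_sum, T]
      rw [Finset.sum_comm]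
      exact Finset.sum_congr rfl fun j _ => Finset.sum_congr rfl fun k _ => by ring
    have hexp3 : ∀ x y : σ → ℝ, hessForm (dirD v f) w x y =
        ∑ i, β i * hessForm (dirD (b i) f) w x y := by
      intro x y
      rw [hvsum, hessForm_apply, dirD_sum_left]
      simp only [map_sum, dirD_smul_left, map_smul, smul_eval, hessForm_apply]
    let A : σ → σ → ℝ := fun j k => ∑ i, β i * β j * β k * T i j k
    let q : σ → ℝ := fun i => ∑ j, A i j
    have hTs : ∀ i j k, T i j k = T j i k := fun i j k => hessForm_dirD_swap _ _ _ _ _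
    have hTs2 : ∀ i j k, T i j k = T i k j := fun i j k => hessForm_comm _ _ _ _
    have hAv : ∀ i (c : σ → ℝ), ∑ j, A i j * c j =
        β i * hessForm (dirD (b i) f) w v (∑ j, (c j * β j) • b j) := by
      intro i c
      rw [hvsum, hexp]
      simp only [A, Finset.sum_mul, Finset.mul_sum]
      rw [Finset.sum_comm]
      refine Finset.sum_congr rfl fun j _ => Finset.sum_congr rfl fun k _ => ?_
      rw [hTs j i k]; ring
    have hq : ∀ i, q i = β i * hessForm (dirD (b i) f) w v v := by
      intro i
      have := hAv i (fun _ => 1)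
      simp only [mul_one, one_mul] at this
      rw [← hvsum] at this
      exact this
    have hAij : ∀ i j, A i j = β i * β j * hessForm (dirD (b i) f) w v (b j) := by
      intro i j
      have := hAv i (Pi.single j 1)
      rw [Finset.sum_eq_single j (by simp +contextual) (by simp),
        Finset.sum_eq_single j (by simp +contextual) (by simp)] at this
      simp only [Pi.single_eq_same, mul_one, one_mul, map_smul, smul_eq_mul] at this
      rw [this]; ring
    have hHb : ∀ i, HessHyp (dirD (b i) f) ∨ i = o := by
      intro i
      by_cases hi : i = o
      · exact Or.inr hi
      · left; simp only [b, hi, if_false]; rw [dirD_single]; exact hj i hi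
    have hloc : ∀ i (x : σ → ℝ), hessForm (dirD (b i) f) w v v * hessForm (dirD (b i) f) w x x
        ≤ hessForm (dirD (b i) f) w v x ^ 2 := by
      intro i x
      rcases hHb i with h | h
      · exact h.form (dirD_homog _ hf) (by omega) (h0.dirD (hb i)) hw hv0 x
      · have hbw : b i = w := by simp [b, h]
        rw [hbw, hTw, hTw, hTw]
        have := hH.form hf (by omega) h0 hw hv0 x
        have h2 := mul_le_mul_of_nonneg_left this
          (sq_nonneg ((d - 1 - 1 : ℕ) : ℝ))
        calc _ = ((d - 1 - 1 : ℕ) : ℝ) ^ 2 * (hessForm f w v v * hessForm f w x x) := by ring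
          _ ≤ _ := h2
          _ = _ := by ring
    have hmono : ∀ i, ε * ((d - 1 : ℕ) * eval w (dirD (b i) f)) ≤ hessForm f w v (b i) := by
      intro i
      have : v = ε • w + (v - ε • w) := by abel
      rw [this, map_add, LinearMap.add_apply, map_smul, LinearMap.smul_apply, smul_eq_mul,
        hessForm_self hf]
      have := hessForm_nonneg h0 hw0 (x := v - ε • w) (fun i => by
        simpa using hvw i) (hb i)
      linarith
    have ho : ∀ i, q i ≠ 0 → 0 < A o i := by
      intro i hi
      have hbo : b o = w := by simp [b]
      rw [hAij, hbo, hTw]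
      have h1 : 0 < eval w (dirD (b i) f) := by
        refine lt_of_le_of_ne ((h0.dirD (hb i)).eval_nonneg hw0) fun h2 => hi ?_
        rw [hq, (h0.dirD (hb i)).eq_zero hw h2.symm]; simp [hessForm_apply]
      have h3 := hmono i
      have h4 : 0 < hessForm f w v (b i) := lt_of_lt_of_le (by positivity) h3
      have := hβ o
      have := hβ i
      positivity
    have main : ∀ x : σ → ℝ, hessForm (dirD v f) w v v * hessForm (dirD v f) w x x ≤
        hessForm (dirD v f) w v x ^ 2 := by
      intro x
      obtain ⟨c, hc⟩ := hsum x
      let c' : σ → ℝ := fun i => c i / β i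
      have hc' : ∀ i, c' i * β i = c i := fun i => by
        have := (hβ i).ne'
        simp only [c']; field_simp
      have hx : x = ∑ j, (c' j * β j) • b j := by rw [hc]; simp only [hc']
      have := bochner_local_to_global (fun i j k => β i * β j * β k * T i j k)
        (fun i j k => mul_nonneg (mul_nonneg (mul_nonneg (hβ i).le (hβ j).le) (hβ k).le)
          (hT0 i j k))
        (fun i j k => by rw [hTs i j k]; ring) (fun i j k => by rw [hTs2 i j k]; ring)
        A (fun j k => rfl) q (fun i => rfl) ?_ o ho c'
      · have e1 : ∑ i, q i = hessForm (dirD v f) w v v := by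
          rw [hexp3]; exact Finset.sum_congr rfl fun i _ => hq i
        have e2 : ∑ i, q i * c' i = hessForm (dirD v f) w v x := by
          rw [hessForm_comm, hessForm_dirD_swap, hx]
          have : ∀ y, hessForm (dirD (∑ j, (c' j * β j) • b j) f) w v y =
            ∑ i, (c' i * β i) * hessForm (dirD (b i) f) w v y := by
            intro y
            rw [hessForm_apply, dirD_sum_left]
            simp only [map_sum, dirD_smul_left, map_smul, smul_eval, hessForm_apply]
          rw [this]
          exact Finset.sum_congr rfl fun i _ => by rw [hq]; ring
        have e3 : ∑ i, ∑ j, A i j * c' i * c' j = hessForm (dirD v f) w x x := by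
          have h1 : ∀ i, ∑ j, A i j * c' i * c' j =
              c' i * (β i * hessForm (dirD (b i) f) w v x) := by
            intro i
            rw [hx, ← hAv, Finset.mul_sum]
            exact Finset.sum_congr rfl fun j _ => by ring
          rw [Finset.sum_congr rfl fun i _ => h1 i, hessForm_dirD_swap]
          conv_rhs => rw [hx]
          rw [← hx, hessForm_apply, hx, dirD_sum_left, ← hx]
          simp only [map_sum, dirD_smul_left, map_smul, smul_eval]
          exact Finset.sum_congr rfl fun i _ => by
            rw [hessForm_apply, dirD_comm x (b i)]; ring
        rwa [e1, e2, e3] at this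
      · intro i x'
        have hl := hloc i (∑ j, (x' j * β j) • b j)
        rw [hAv, hq]
        have h5 : ∑ j, ∑ k, β i * β j * β k * T i j k * x' j * x' k =
            β i * hessForm (dirD (b i) f) w (∑ j, (x' j * β j) • b j)
              (∑ j, (x' j * β j) • b j) := by
          rw [hexp, Finset.mul_sum]
          refine Finset.sum_congr rfl fun j _ => ?_
          rw [Finset.mul_sum]
          exact Finset.sum_congr rfl fun k _ => by ring
        rw [h5, mul_pow]
        calc _ = β i ^ 2 * (hessForm (dirD (b i) f) w v v * hessForm (dirD (b i) f) w
              (∑ j, (x' j * β j) • b j) (∑ j, (x' j * β j) • b j)) := by ring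
          _ ≤ _ := mul_le_mul_of_nonneg_left hl (sq_nonneg _)
    have hvvv : 0 < hessForm (dirD v f) w v v := by
      have g1 : ∀ x y, (∀ i, 0 ≤ x i) → (∀ i, 0 ≤ y i) →
          ε * hessForm (dirD w f) w x y ≤ hessForm (dirD v f) w x y := by
        intro x y hx hy
        have : v = ε • w + (v - ε • w) := by abel
        rw [this, hessForm_dirD_add, hessForm_dirD_smul]
        have := hessForm_nonneg (h0.dirD (z := v - ε • w) fun i => by simpa using hvw i)
          hw0 hx hy
        linarith
      have g2 : 0 < hessForm (dirD w f) w w w := by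
        rw [hTw, hessForm_self hf, eval_dirD_self hf]
        have : 0 < d := by omega
        positivity
      have g3 := g1 v v hv0 hv0
      have g4 := g1 w v hw0 hv0
      have g5 := g1 w w hw0 hw0
      rw [hessForm_dirD_swap f w w w v, hessForm_comm] at g5
      rw [hessForm_dirD_swap f w w v v] at g4
      rw [hessForm_dirD_swap f w w v w, hessForm_comm] at g4
      nlinarith [mul_pos hε g2, mul_pos hε (mul_pos hε g2)]
    exact reverse_cauchy_transfer (hessForm (dirD v f) w) (hessForm_comm _ _) hvvv main
      (hessForm_nonneg (h0.dirD hv0) hw0 hw0 hw0) y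
  -- let `ε → 0`
  have hlin : ∀ x y (ε : ℝ), hessForm (dirD (ε • w + (z + ε • e1)) f) w x y =
      hessForm (dirD z f) w x y +
        ε * (hessForm (dirD w f) w x y + hessForm (dirD e1 f) w x y) := by
    intro x y ε
    rw [hessForm_dirD_add, hessForm_dirD_add, hessForm_dirD_smul, hessForm_dirD_smul]; ring
  have ht : ∀ x y, Filter.Tendsto
      (fun ε : ℝ => hessForm (dirD (ε • w + (z + ε • e1)) f) w x y)
      (nhdsWithin 0 (Set.Ioi 0)) (nhds (hessForm (dirD z f) w x y)) := by
    intro x y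
    simp only [hlin]
    refine tendsto_nhdsWithin_of_tendsto_nhds (Continuous.tendsto' ?_ 0 _ (by simp))
    fun_prop
  exact le_of_tendsto_of_tendsto ((ht w w).mul (ht y y)) ((ht w y).pow 2)
    (eventually_nhdsWithin_of_forall fun ε hε => key ε hε)

/-- Polynomials all of whose iterated partial derivatives in the variables other than `o`
satisfy `HessHyp`. -/
def IterHyp (o : σ) : ℕ → MvPolynomial σ ℝ → Prop
  | 0, p => p.IsHomogeneous 0 ∧ NonnegCoeff p
  | d + 1, p => p.IsHomogeneous (d + 1) ∧ NonnegCoeff p ∧ HessHyp p ∧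
      ∀ j, j ≠ o → IterHyp o d (pderiv j p)

theorem IterHyp.homog {o : σ} {d : ℕ} {p : MvPolynomial σ ℝ} (h : IterHyp o d p) :
    p.IsHomogeneous d := by
  cases d with
  | zero => exact h.1
  | succ d => exact h.1

theorem IterHyp.nonnegCoeff {o : σ} {d : ℕ} {p : MvPolynomial σ ℝ} (h : IterHyp o d p) :
    NonnegCoeff p := by
  cases d with
  | zero => exact h.2
  | succ d => exact h.2.1

theorem IterHyp.hessHyp_dirD_iter [DecidableEq σ] {o : σ} {d : ℕ} {p : MvPolynomial σ ℝ}
    (h : IterHyp o d p)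
    {z : σ → ℝ} (hz : ∀ i, 0 ≤ z i) (hzo : z o = 0) (m : ℕ) : HessHyp ((dirD z)^[m] p) := by
  induction m generalizing d p with
  | zero =>
    cases d with
    | zero => exact hessHyp_of_degree_le_one h.1 zero_le_one
    | succ d => exact h.2.2.1
  | succ m ih =>
    have hhom := dirD_iter_homog z h.homog m
    by_cases hd : d ≤ m + 2
    · rw [Function.iterate_succ_apply']
      exact hessHyp_of_degree_le_one (dirD_homog z hhom) (by omega)
    · rw [Function.iterate_succ_apply']
      refine HessHyp.dirD_of_pderiv hhom (by omega) (h.nonnegCoeff.dirD_iter hz m) (ih h) o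
        (fun j hj => ?_) hz hzo
      obtain ⟨d, rfl⟩ : ∃ k, d = k + 1 := ⟨d - 1, by omega⟩
      rw [← dirD_single, dirD_iter_comm, dirD_single]
      exact ih (h.2.2.2 j hj)

/-- Expansion of an `IterHyp` polynomial on the plane spanned by `e_o` and `z`, with log-concave
coefficients. -/
theorem IterHyp.expansion [DecidableEq σ] {o : σ} {d : ℕ} {p : MvPolynomial σ ℝ}
    (h : IterHyp o d p)
    {z : σ → ℝ} (hz : ∀ i, 0 ≤ z i) (hzo : z o = 0) : ∃ a : ℕ → ℝ,
      (∀ m, 0 ≤ a m) ∧ (∀ m, 1 ≤ m → m + 1 ≤ d → a (m - 1) * a (m + 1) ≤ a m ^ 2) ∧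
      (∀ s t : ℝ, eval (s • Pi.single o 1 + t • z) p =
        ∑ m ∈ Finset.range (d + 1), d.choose m * a m * s ^ (d - m) * t ^ m) ∧
      (d : ℝ) * a 1 = eval (Pi.single o 1) (dirD z p) := by
  set e : σ → ℝ := Pi.single o 1 with he
  have he0 : ∀ i, 0 ≤ e i := by
    intro i
    rw [he, Pi.single_apply]; split_ifs <;> simp
  let g : ℕ → ℝ := fun m => eval e ((dirD z)^[m] p)
  have hg0 : ∀ m, 0 ≤ g m := fun m => (h.nonnegCoeff.dirD_iter hz m).eval_nonneg he0
  refine ⟨fun m => g m * (d - m).factorial / d.factorial, fun m => ?_, fun m hm1 hm2 => ?_, ?_, ?_⟩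
  · have := hg0 m
    positivity
  · obtain ⟨m, rfl⟩ : ∃ k, m = k + 1 := ⟨m - 1, by omega⟩
    obtain ⟨k, hk⟩ : ∃ k, d = k + (m + 2) := ⟨d - (m + 2), by omega⟩
    have hf := dirD_iter_homog z h.homog m
    have hlim : eval e (dirD e (dirD e ((dirD z)^[m] p))) *
        eval e (dirD z (dirD z ((dirD z)^[m] p))) ≤
        eval e (dirD e (dirD z ((dirD z)^[m] p))) ^ 2 := by
      set f := (dirD z)^[m] p with hfdef
      have hH : HessHyp f := h.hessHyp_dirD_iter hz hzo m
      have key : ∀ ε : ℝ, 0 < ε →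
          hessForm f (e + ε • 1) (e + ε • 1) (e + ε • 1) * hessForm f (e + ε • 1) z z ≤
          hessForm f (e + ε • 1) (e + ε • 1) z ^ 2 := by
        intro ε hε
        refine hH _ (fun i => ?_) z
        have := he0 i
        simp only [Pi.add_apply, Pi.smul_apply, Pi.one_apply, smul_eq_mul, mul_one]
        linarith
      have hev : ∀ q : MvPolynomial σ ℝ,
          Continuous fun ε : ℝ => eval (e + ε • (1 : σ → ℝ)) q := by
        intro q
        refine (MvPolynomial.continuous_eval q).comp ?_
        fun_prop
      have hcont : ∀ x y : σ → ℝ, Continuous fun ε : ℝ => hessForm f (e + ε • 1) x y :=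
        fun x y => hev _
      have t1 : Continuous fun ε : ℝ => hessForm f (e + ε • 1) (e + ε • 1) (e + ε • 1) := by
        simp only [map_add, LinearMap.add_apply, map_smul, LinearMap.smul_apply, smul_eq_mul]
        have := hcont e e
        have := hcont e 1
        have := hcont 1 e
        have := hcont 1 1
        fun_prop
      have t2 : Continuous fun ε : ℝ => hessForm f (e + ε • 1) (e + ε • 1) z := by
        simp only [map_add, LinearMap.add_apply, map_smul, LinearMap.smul_apply, smul_eq_mul]
        have := hcont e z
        have := hcont 1 z
        fun_prop
      have l1 := ((t1.mul (hcont z z)).tendsto 0).mono_left (nhdsWithin_le_nhds (s := Set.Ioi 0))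
      have l2 := ((t2.pow 2).tendsto 0).mono_left (nhdsWithin_le_nhds (s := Set.Ioi 0))
      have := le_of_tendsto_of_tendsto l1 l2
        (eventually_nhdsWithin_of_forall fun ε hε => key ε hε)
      simpa only [Pi.mul_apply, Pi.pow_apply, zero_smul, add_zero, hessForm_apply] using this
    rw [eval_dirD_self (dirD_homog e hf), eval_dirD_self hf, eval_dirD_self (dirD_homog z hf),
      ← Function.iterate_succ_apply' (dirD z), ← Function.iterate_succ_apply' (dirD z)] at hlim
    have hlim' : ((k : ℝ) + 1) * ((k + 2) * g m) * g (m + 2) ≤ ((k + 1) * g (m + 1)) ^ 2 := by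
      have e1 : d - m - 1 = k + 1 := by omega
      have e2 : d - m = k + 2 := by omega
      rw [e1, e2] at hlim
      push_cast at hlim
      exact hlim
    have e0 : d - m = k + 2 := by omega
    have e1 : d - (m + 1) = k + 1 := by omega
    have e2 : d - (m + 1 + 1) = k := by omega
    simp only [Nat.add_sub_cancel, e0, e1, e2, Nat.factorial_succ]
    have hD : (0 : ℝ) < d.factorial := by positivity
    have hK : (0 : ℝ) < k.factorial := by positivity
    push_cast
    rw [div_mul_div_comm, div_pow, ← pow_two]
    refine div_le_div_of_nonneg_right ?_ (by positivity)
    have h2 := mul_le_mul_of_nonneg_left hlim' (by positivity : (0 : ℝ) ≤ k.factorial ^ 2)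
    calc _ = (k.factorial : ℝ) ^ 2 * (((k : ℝ) + 1) * ((k + 2) * g m) * g (m + 2)) := by ring
      _ ≤ _ := h2
      _ = _ := by ring
  · intro s t
    rw [eval_line h.homog]
    refine Finset.sum_congr rfl fun m hm => ?_
    have hm' : m ≤ d := Nat.lt_succ_iff.1 (Finset.mem_range.1 hm)
    rw [Nat.cast_choose ℝ hm']
    have hD : (d.factorial : ℝ) ≠ 0 := by positivity
    have hK : ((d - m).factorial : ℝ) ≠ 0 := by positivity
    have hM : (m.factorial : ℝ) ≠ 0 := by positivity
    simp only [g]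
    field_simp
  · cases d with
    | zero => rw [dirD_eq_zero z h.homog]; simp
    | succ d =>
      simp only [g, Nat.add_sub_cancel, Nat.factorial_succ, Function.iterate_one]
      have hD : (d.factorial : ℝ) ≠ 0 := by positivity
      push_cast
      field_simp

end LorentzianPolynomial

theorem sum_powerset_neg_one_pow_card {α : Type*} [DecidableEq α] (P : Finset α) (k : ℕ) :
    ∑ S ∈ P.powerset, (-1 : ℝ) ^ (P.card - S.card) * (S.card : ℝ) ^ k =
      (fwdDiff 1)^[P.card] (fun x : ℝ => x ^ k) 0 := by
  rw [Finset.sum_powerset_apply_card (fun c => (-1 : ℝ) ^ (P.card - c) * (c : ℝ) ^ k),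
    fwdDiff_iter_eq_sum_shift]
  refine Finset.sum_congr rfl fun c _ => ?_
  simp only [zsmul_eq_mul, nsmul_eq_mul]
  push_cast
  ring

theorem sum_powerset_neg_one_pow_card_lt {α : Type*} [DecidableEq α] (P : Finset α) (k : ℕ)
    (h : k < P.card) :
    ∑ S ∈ P.powerset, (-1 : ℝ) ^ (P.card - S.card) * (S.card : ℝ) ^ k = 0 := by
  rw [sum_powerset_neg_one_pow_card, fwdDiff_iter_pow_eq_zero_of_lt h]; rfl

theorem sum_powerset_neg_one_pow_card_self {α : Type*} [DecidableEq α] (P : Finset α) :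
    ∑ S ∈ P.powerset, (-1 : ℝ) ^ (P.card - S.card) * (S.card : ℝ) ^ P.card = P.card.factorial := by
  rw [sum_powerset_neg_one_pow_card, fwdDiff_iter_eq_factorial]; simp

/-- Polarization of a binary form with coefficients `n.choose m * a m`. -/
theorem polarization_binary {n : ℕ} (hn : 1 ≤ n) (a : ℕ → ℝ) (F : ℕ → ℕ → ℝ)
    (hF : ∀ s t : ℕ, F s t = ∑ m ∈ Finset.range (n + 1),
      n.choose m * a m * (s : ℝ) ^ (n - m) * (t : ℝ) ^ m) (j : ℕ) (hj : j ≤ n) :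
    (n.factorial : ℝ)⁻¹ * ∑ S : Finset (Fin n), (if S.Nonempty then (-1 : ℝ) ^ (n - S.card) *
      F (S.filter fun i : Fin n => (i : ℕ) < n - j).card
        (S.filter fun i : Fin n => ¬ (i : ℕ) < n - j).card
      else 0) = a j := by
  classical
  set P : Finset (Fin n) := Finset.univ.filter fun i : Fin n => (i : ℕ) < n - j with hP
  set Q : Finset (Fin n) := Finset.univ.filter fun i : Fin n => ¬ (i : ℕ) < n - j with hQ
  have hPc : P.card = n - j := by
    rw [hP, Fin.card_filter_val_lt]; simp
  have hPQ : P.card + Q.card = n := by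
    rw [hP, hQ, Finset.card_filter_add_card_filter_not]; simp
  have hQc : Q.card = j := by omega
  have h00 : F 0 0 = 0 := by
    rw [hF]
    refine Finset.sum_eq_zero fun m _ => ?_
    by_cases hm : m = 0
    · subst hm; simp; omega
    · simp [hm]
  have h1 : ∑ S : Finset (Fin n), (if S.Nonempty then (-1 : ℝ) ^ (n - S.card) *
      F (S.filter fun i : Fin n => (i : ℕ) < n - j).card
        (S.filter fun i : Fin n => ¬ (i : ℕ) < n - j).card
      else 0) = ∑ x ∈ P.powerset ×ˢ Q.powerset, (-1 : ℝ) ^ (P.card - x.1.card) *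
        (-1) ^ (Q.card - x.2.card) * F x.1.card x.2.card := by
    refine Finset.sum_nbij' (fun S => (S.filter fun i : Fin n => (i : ℕ) < n - j,
      S.filter fun i : Fin n => ¬ (i : ℕ) < n - j)) (fun x => x.1 ∪ x.2) ?_ ?_ ?_ ?_ ?_
    · intro S _
      simp only [Finset.mem_product, Finset.mem_powerset]
      exact ⟨Finset.filter_subset_filter _ (Finset.subset_univ _),
        Finset.filter_subset_filter _ (Finset.subset_univ _)⟩
    · intro _ _; simp
    · intro S _; exact Finset.filter_union_filter_not_eq _ _
    · rintro ⟨x, y⟩ hxy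
      simp only [Finset.mem_product, Finset.mem_powerset] at hxy
      ext i
      · have h1 := @hxy.1 i
        have h2 := @hxy.2 i
        simp [hP, hQ] at h1 h2 ⊢
        grind
      · have h1 := @hxy.1 i
        have h2 := @hxy.2 i
        simp [hP, hQ] at h1 h2 ⊢
        grind
    · intro S _
      dsimp only
      by_cases hS : S.Nonempty
      · rw [if_pos hS, ← pow_add]
        congr 2
        have h1 := Finset.card_filter_add_card_filter_not (s := S)
          (fun i : Fin n => (i : ℕ) < n - j)
        have h2 : (S.filter fun i : Fin n => (i : ℕ) < n - j).card ≤ P.card :=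
          Finset.card_le_card (Finset.filter_subset_filter _ (Finset.subset_univ _))
        have h3 : (S.filter fun i : Fin n => ¬ (i : ℕ) < n - j).card ≤ Q.card :=
          Finset.card_le_card (Finset.filter_subset_filter _ (Finset.subset_univ _))
        omega
      · rw [if_neg hS, Finset.not_nonempty_iff_eq_empty.1 hS]
        simp [h00]
  rw [h1]
  simp only [hF, Finset.mul_sum]
  rw [Finset.sum_comm]
  have h2 : ∀ m ∈ Finset.range (n + 1), ∑ x ∈ P.powerset ×ˢ Q.powerset,
      (-1 : ℝ) ^ (P.card - x.1.card) * (-1) ^ (Q.card - x.2.card) *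
        (n.choose m * a m * (x.1.card : ℝ) ^ (n - m) * (x.2.card : ℝ) ^ m) =
      n.choose m * a m *
        ((∑ S ∈ P.powerset, (-1 : ℝ) ^ (P.card - S.card) * (S.card : ℝ) ^ (n - m)) *
        (∑ S ∈ Q.powerset, (-1 : ℝ) ^ (Q.card - S.card) * (S.card : ℝ) ^ m)) := by
    intro m _
    rw [Finset.sum_mul_sum, ← Finset.sum_product', Finset.mul_sum]
    exact Finset.sum_congr rfl fun x _ => by ring
  simp only [← Finset.mul_sum]
  rw [Finset.sum_congr rfl h2, Finset.sum_eq_single j]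
  · have e1 := sum_powerset_neg_one_pow_card_self P
    have e2 := sum_powerset_neg_one_pow_card_self Q
    rw [hPc] at e1
    rw [hQc] at e2
    rw [hPc, hQc, e1, e2, Nat.cast_choose ℝ hj]
    have : (n.factorial : ℝ) ≠ 0 := by positivity
    have : (j.factorial : ℝ) ≠ 0 := by positivity
    have : ((n - j).factorial : ℝ) ≠ 0 := by positivity
    field_simp
  · intro m hm hmj
    have hm' : m ≤ n := Nat.lt_succ_iff.1 (Finset.mem_range.1 hm)
    rcases lt_or_gt_of_ne hmj with h | h
    · rw [sum_powerset_neg_one_pow_card_lt Q m (by omega)]; simp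
    · rw [sum_powerset_neg_one_pow_card_lt P (n - m) (by omega)]; simp
  · intro h; exact absurd (Finset.mem_range.2 (by omega)) h

section BrunnMinkowski
open MeasureTheory Set

theorem Real.volume_add_le_of_isCompact {X Y : Set ℝ} (hX : IsCompact X) (hY : IsCompact Y)
    (hX0 : X.Nonempty) (hY0 : Y.Nonempty) : volume X + volume Y ≤ volume (X + Y) := by
  have hb := hX.sSup_mem hX0
  have ha := hY.sInf_mem hY0
  set b := sSup X
  set a := sInf Y
  have h1 : volume ((fun x => x + a) '' X) = volume X := by
    rw [image_add_right]; exact measure_preimage_add_right _ _ _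
  have h2 : volume ((fun y => b + y) '' Y) = volume Y := by
    rw [image_add_left]; exact measure_preimage_add _ _ _
  have hd : AEDisjoint volume ((fun x => x + a) '' X) ((fun y => b + y) '' Y) := by
    refine measure_mono_null (t := {b + a}) ?_ (by simp)
    rintro _ ⟨⟨x, hx, rfl⟩, ⟨y, hy, hxy⟩⟩
    have h3 : x ≤ b := le_csSup hX.bddAbove hx
    have h4 : a ≤ y := csInf_le hY.bddBelow hy
    simp only [mem_singleton_iff] at *
    linarith
  rw [← h1, ← h2, ← measure_union₀ _ hd]
  · refine measure_mono (union_subset ?_ ?_)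
    · rintro _ ⟨x, hx, rfl⟩; exact add_mem_add hx ha
    · rintro _ ⟨y, hy, rfl⟩; exact add_mem_add hb hy
  · exact (hY.image (by fun_prop)).measurableSet.nullMeasurableSet

theorem Real.volume_add_le {X Y : Set ℝ} (hX : MeasurableSet X) (hY : MeasurableSet Y)
    (hX0 : X.Nonempty) (hY0 : Y.Nonempty) : volume X + volume Y ≤ volume (X + Y) := by
  obtain ⟨x, hx⟩ := hX0
  obtain ⟨y, hy⟩ := hY0
  rw [hX.measure_eq_iSup_isCompact, hY.measure_eq_iSup_isCompact]
  simp only [iSup_and']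
  have : ∀ K ⊆ X, IsCompact K → ∀ L ⊆ Y, IsCompact L → volume K + volume L ≤ volume (X + Y) := by
    intro K hK hKc L hL hLc
    calc volume K + volume L ≤ volume (insert x K) + volume (insert y L) :=
          add_le_add (measure_mono (subset_insert _ _)) (measure_mono (subset_insert _ _))
      _ ≤ volume (insert x K + insert y L) :=
          Real.volume_add_le_of_isCompact (hKc.insert x) (hLc.insert y) (insert_nonempty _ _)
            (insert_nonempty _ _)
      _ ≤ volume (X + Y) := measure_mono (add_subset_add (insert_subset hx hK)
            (insert_subset hy hL))
  exact ENNReal.biSup_add_biSup_le' ⟨∅, empty_subset _, isCompact_empty⟩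
    ⟨∅, empty_subset _, isCompact_empty⟩ fun K hK L hL => this K hK.1 hK.2 L hL.1 hL.2

theorem lintegral_add_le_of_superlevel {f g h : ℝ → ℝ} (hf : Measurable f) (hg : Measurable g)
    (hh : Measurable h) (hf0 : ∀ x, 0 ≤ f x) (hg0 : ∀ x, 0 ≤ g x) (hh0 : ∀ x, 0 ≤ h x)
    (hf1 : ∀ x, f x ≤ 1) (hg1 : ∀ x, g x ≤ 1) (hfs : ∀ l < 1, ∃ x, l < f x)
    (hgs : ∀ l < 1, ∃ x, l < g x) (hle : ∀ s t, f s * g t ≤ h (s + t) ^ 2) :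
    (∫⁻ x, ENNReal.ofReal (f x)) + (∫⁻ x, ENNReal.ofReal (g x)) ≤ ∫⁻ x, ENNReal.ofReal (h x) := by
  rw [lintegral_eq_lintegral_meas_lt _ (ae_of_all _ hf0) hf.aemeasurable,
    lintegral_eq_lintegral_meas_lt _ (ae_of_all _ hg0) hg.aemeasurable,
    lintegral_eq_lintegral_meas_lt _ (ae_of_all _ hh0) hh.aemeasurable, ← lintegral_add_left]
  · refine setLIntegral_mono' measurableSet_Ioi fun l hl => ?_
    have hl : 0 < l := hl
    rcases lt_or_ge l 1 with h1 | h1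
    · refine (Real.volume_add_le (measurableSet_lt measurable_const hf)
        (measurableSet_lt measurable_const hg) (hfs l h1) (hgs l h1)).trans (measure_mono ?_)
      rintro _ ⟨s, hs, t, ht, rfl⟩
      have hs : l < f s := hs
      have ht : l < g t := ht
      have := hle s t
      have : l ^ 2 < h (s + t) ^ 2 := by nlinarith
      exact lt_of_pow_lt_pow_left₀ 2 (hh0 _) this
    · have e1 : {x | l < f x} = ∅ := by
        ext x; simp only [mem_ofPred_eq, mem_empty_iff_false, iff_false, not_lt]
        exact (hf1 x).trans h1
      have e2 : {x | l < g x} = ∅ := by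
        ext x; simp only [mem_ofPred_eq, mem_empty_iff_false, iff_false, not_lt]
        exact (hg1 x).trans h1
      simp [e1, e2]
  · refine Antitone.measurable fun a b hab => measure_mono fun x hx => lt_of_le_of_lt hab hx

/-- One-dimensional Prékopa–Leindler inequality for the mean with weights `1/2`. -/
theorem prekopa_leindler_real {f g h : ℝ → ℝ} (hf : Measurable f) (hg : Measurable g)
    (hh : Measurable h) (hf0 : ∀ x, 0 ≤ f x) (hg0 : ∀ x, 0 ≤ g x) (hh0 : ∀ x, 0 ≤ h x)
    (hfb : BddAbove (range f)) (hgb : BddAbove (range g))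
    (hle : ∀ s t, f s * g t ≤ h (s + t) ^ 2) :
    4 * ((∫⁻ x, ENNReal.ofReal (f x)) * ∫⁻ x, ENNReal.ofReal (g x)) ≤
      (∫⁻ x, ENNReal.ofReal (h x)) ^ 2 := by
  set F := sSup (range f)
  set G := sSup (range g)
  have hfF : ∀ x, f x ≤ F := fun x => le_csSup hfb (mem_range_self x)
  have hgG : ∀ x, g x ≤ G := fun x => le_csSup hgb (mem_range_self x)
  rcases ((hf0 0).trans (hfF 0)).eq_or_lt with hF | hF
  · have : ∀ x, f x = 0 := fun x => le_antisymm (hF ▸ hfF x) (hf0 x)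
    simp [this]
  rcases ((hg0 0).trans (hgG 0)).eq_or_lt with hG | hG
  · have : ∀ x, g x = 0 := fun x => le_antisymm (hG ▸ hgG x) (hg0 x)
    simp [this]
  set H := √(F * G) with hH
  have hH2 : H ^ 2 = F * G := Real.sq_sqrt (by positivity)
  have hHp : 0 < H := Real.sqrt_pos.2 (by positivity)
  have key := lintegral_add_le_of_superlevel (f := fun x => F⁻¹ * f x) (g := fun x => G⁻¹ * g x)
    (h := fun x => H⁻¹ * h x) (hf.const_mul _) (hg.const_mul _) (hh.const_mul _)
    (fun x => mul_nonneg (inv_nonneg.2 hF.le) (hf0 x))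
    (fun x => mul_nonneg (inv_nonneg.2 hG.le) (hg0 x))
    (fun x => mul_nonneg (inv_nonneg.2 hHp.le) (hh0 x))
    (fun x => by rw [inv_mul_le_iff₀ hF, mul_one]; exact hfF x)
    (fun x => by rw [inv_mul_le_iff₀ hG, mul_one]; exact hgG x)
    (fun l hl => by
      obtain ⟨_, ⟨x, rfl⟩, hx⟩ := exists_lt_of_lt_csSup (range_nonempty f)
        (show F * l < F by nlinarith)
      exact ⟨x, by rwa [lt_inv_mul_iff₀ hF]⟩)
    (fun l hl => by
      obtain ⟨_, ⟨x, rfl⟩, hx⟩ := exists_lt_of_lt_csSup (range_nonempty g)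
        (show G * l < G by nlinarith)
      exact ⟨x, by rwa [lt_inv_mul_iff₀ hG]⟩)
    (fun s t => by
      rw [mul_pow, inv_pow, hH2, mul_inv]
      have := mul_le_mul_of_nonneg_left (hle s t) (by positivity : 0 ≤ F⁻¹ * G⁻¹)
      linarith)
  have e : ∀ (c : ℝ) (u : ℝ → ℝ), 0 < c → Measurable u → ∫⁻ x, ENNReal.ofReal (c⁻¹ * u x) =
      ENNReal.ofReal c⁻¹ * ∫⁻ x, ENNReal.ofReal (u x) := by
    intro c u hc hu
    rw [← lintegral_const_mul _ hu.ennreal_ofReal]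
    exact lintegral_congr fun x => ENNReal.ofReal_mul (inv_nonneg.2 hc.le)
  rw [e F f hF hf, e G g hG hg, e H h hHp hh] at key
  set If := ∫⁻ x, ENNReal.ofReal (f x)
  set Ig := ∫⁻ x, ENNReal.ofReal (g x)
  set Ih := ∫⁻ x, ENNReal.ofReal (h x)
  by_cases hi : Ih = ⊤
  · rw [hi]; simp
  have hlt : ENNReal.ofReal H⁻¹ * Ih ≠ ⊤ := ENNReal.mul_ne_top ENNReal.ofReal_ne_top hi
  have h1 : If ≠ ⊤ := by
    rintro h1
    rw [h1, ENNReal.mul_top (by simpa using hF)] at key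
    exact hlt (top_le_iff.1 (le_trans (by simp) key))
  have h2 : Ig ≠ ⊤ := by
    rintro h1
    rw [h1, ENNReal.mul_top (by simpa using hG)] at key
    exact hlt (top_le_iff.1 (le_trans (by simp) key))
  clear_value If Ig Ih
  lift If to ℝ≥0 using h1
  lift Ig to ℝ≥0 using h2
  lift Ih to ℝ≥0 using hi
  rw [← ENNReal.toReal_le_toReal (by finiteness) (by finiteness)] at key ⊢
  rw [ENNReal.toReal_add (by finiteness) (by finiteness)] at key
  simp only [ENNReal.toReal_mul, ENNReal.toReal_pow, ENNReal.coe_toReal, ENNReal.toReal_ofNat,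
    ENNReal.toReal_ofReal (inv_nonneg.2 hF.le), ENNReal.toReal_ofReal (inv_nonneg.2 hG.le),
    ENNReal.toReal_ofReal (inv_nonneg.2 hHp.le)] at key ⊢
  have h3 : (4 : ℝ) * ((F⁻¹ * If) * (G⁻¹ * Ig)) ≤ (H⁻¹ * Ih) ^ 2 := by
    have p1 : 0 ≤ F⁻¹ * (If : ℝ) := by positivity
    have p2 : 0 ≤ G⁻¹ * (Ig : ℝ) := by positivity
    nlinarith [sq_nonneg (F⁻¹ * (If : ℝ) - G⁻¹ * Ig)]
  rw [mul_pow, inv_pow, hH2] at h3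
  have h4 := mul_le_mul_of_nonneg_left h3 (by positivity : 0 ≤ F * G)
  have h5 : F * G * ((F * G)⁻¹ * (Ih : ℝ) ^ 2) = Ih ^ 2 := by field_simp
  have h6 : F * G * (4 * (F⁻¹ * (If : ℝ) * (G⁻¹ * Ig))) = 4 * (If * Ig) := by field_simp
  rwa [h5, h6] at h4

theorem volume_fin_succ_eq_lintegral {n : ℕ} {A : Set (Fin (n + 1) → ℝ)} (hA : MeasurableSet A) :
    volume A = ∫⁻ s : ℝ, volume {y : Fin n → ℝ | Fin.cons s y ∈ A} := by
  have h := volume_preserving_piFinSuccAbove (fun _ : Fin (n + 1) => ℝ) 0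
  have e : ∀ s : ℝ, {y : Fin n → ℝ | (Fin.cons s y : Fin (n + 1) → ℝ) ∈ A} =
      Prod.mk s ⁻¹' ((MeasurableEquiv.piFinSuccAbove (fun _ : Fin (n + 1) => ℝ) 0).symm ⁻¹' A) := by
    intro s
    ext y
    simp [MeasurableEquiv.piFinSuccAbove, Fin.consEquiv]
  rw [← h.symm.measure_preimage hA.nullMeasurableSet, Measure.volume_eq_prod,
    Measure.prod_apply ((MeasurableEquiv.measurable _) hA)]
  simp_rw [e]

theorem measurable_volume_slice {n : ℕ} {A : Set (Fin (n + 1) → ℝ)} (hA : MeasurableSet A) :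
    Measurable fun s : ℝ => volume {y : Fin n → ℝ | Fin.cons s y ∈ A} := by
  have e : ∀ s : ℝ, {y : Fin n → ℝ | (Fin.cons s y : Fin (n + 1) → ℝ) ∈ A} =
      Prod.mk s ⁻¹' ((MeasurableEquiv.piFinSuccAbove (fun _ : Fin (n + 1) => ℝ) 0).symm ⁻¹' A) := by
    intro s
    ext y
    simp [MeasurableEquiv.piFinSuccAbove, Fin.consEquiv]
  simp_rw [e]
  exact measurable_measure_prodMk_left (ν := volume) ((MeasurableEquiv.measurable
    (MeasurableEquiv.piFinSuccAbove (fun _ : Fin (n + 1) => ℝ) 0).symm) hA)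

theorem isCompact_slice {n : ℕ} {A : Set (Fin (n + 1) → ℝ)} (hA : IsCompact A) (s : ℝ) :
    IsCompact {y : Fin n → ℝ | (Fin.cons s y : Fin (n + 1) → ℝ) ∈ A} := by
  have : {y : Fin n → ℝ | (Fin.cons s y : Fin (n + 1) → ℝ) ∈ A} =
      (fun x : Fin (n + 1) → ℝ => Fin.tail x) '' (A ∩ {x | x 0 = s}) := by
    ext y
    constructor
    · intro hy
      exact ⟨Fin.cons s y, ⟨hy, by simp⟩, by simp⟩
    · rintro ⟨x, ⟨hx, hx0⟩, rfl⟩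
      have hx0 : x 0 = s := hx0
      show Fin.cons s (Fin.tail x) ∈ A
      rw [← hx0, Fin.cons_self_tail]; exact hx
  rw [this]
  refine (hA.inter_right (isClosed_eq (continuous_apply 0) continuous_const)).image ?_
  exact continuous_pi fun i => continuous_apply _

theorem brunn_minkowski_pi (n : ℕ) {A B : Set (Fin n → ℝ)} (hA : IsCompact A) (hB : IsCompact B)
    (hA0 : A.Nonempty) (hB0 : B.Nonempty) :
    4 ^ n * (volume A * volume B) ≤ volume (A + B) ^ 2 := by
  induction n with
  | zero =>
    have h1 := Subsingleton.eq_univ_of_nonempty hA0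
    have h2 := Subsingleton.eq_univ_of_nonempty hB0
    have h3 := Subsingleton.eq_univ_of_nonempty (hA0.add hB0)
    rw [h1, h2] at h3 ⊢
    rw [h3]
    simp [volume_pi]
  | succ n ih =>
    have hAB : IsCompact (A + B) := hA.add hB
    have hbd : ∀ {A : Set (Fin (n + 1) → ℝ)}, IsCompact A → ∃ M : ℝ≥0, ∀ s : ℝ,
        volume {y : Fin n → ℝ | (Fin.cons s y : Fin (n + 1) → ℝ) ∈ A} ≤ M := by
      intro A hA
      have hc : IsCompact ((fun x : Fin (n + 1) → ℝ => Fin.tail x) '' A) :=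
        hA.image (continuous_pi fun i => continuous_apply _)
      refine ⟨(volume ((fun x : Fin (n + 1) → ℝ => Fin.tail x) '' A)).toNNReal, fun s => ?_⟩
      rw [ENNReal.coe_toNNReal hc.measure_lt_top.ne]
      refine measure_mono fun y hy => ⟨Fin.cons s y, hy, by simp⟩
    obtain ⟨MA, hMA⟩ := hbd hA
    obtain ⟨MB, hMB⟩ := hbd hB
    obtain ⟨MC, hMC⟩ := hbd hAB
    set f : ℝ → ℝ := fun s =>
      (volume {y : Fin n → ℝ | (Fin.cons s y : Fin (n + 1) → ℝ) ∈ A}).toReal with hf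
    set g : ℝ → ℝ := fun s =>
      (volume {y : Fin n → ℝ | (Fin.cons s y : Fin (n + 1) → ℝ) ∈ B}).toReal with hg
    set h : ℝ → ℝ := fun s =>
      (volume {y : Fin n → ℝ | (Fin.cons s y : Fin (n + 1) → ℝ) ∈ A + B}).toReal with hh
    have bdd : ∀ {A : Set (Fin (n + 1) → ℝ)} (M : ℝ≥0), (∀ s : ℝ,
        volume {y : Fin n → ℝ | (Fin.cons s y : Fin (n + 1) → ℝ) ∈ A} ≤ M) →
        BddAbove (range fun s : ℝ =>
          (volume {y : Fin n → ℝ | (Fin.cons s y : Fin (n + 1) → ℝ) ∈ A}).toReal) := by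
      intro A M hM
      refine ⟨M, ?_⟩
      rintro _ ⟨s, rfl⟩
      exact ENNReal.toReal_le_coe_of_le_coe (hM s)
    have eint : ∀ {A : Set (Fin (n + 1) → ℝ)} (_ : IsCompact A) (M : ℝ≥0), (∀ s : ℝ,
        volume {y : Fin n → ℝ | (Fin.cons s y : Fin (n + 1) → ℝ) ∈ A} ≤ M) →
        ∫⁻ s, ENNReal.ofReal
          ((volume {y : Fin n → ℝ | (Fin.cons s y : Fin (n + 1) → ℝ) ∈ A}).toReal) = volume A := by
      intro A hA M hM
      rw [volume_fin_succ_eq_lintegral hA.measurableSet]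
      refine lintegral_congr fun s => ENNReal.ofReal_toReal ?_
      exact ((hM s).trans_lt ENNReal.coe_lt_top).ne
    have key := prekopa_leindler_real (f := f) (g := g) (h := fun s => (2 ^ n)⁻¹ * h s)
      (measurable_volume_slice hA.measurableSet).ennreal_toReal
      (measurable_volume_slice hB.measurableSet).ennreal_toReal
      ((measurable_volume_slice hAB.measurableSet).ennreal_toReal.const_mul _)
      (fun _ => ENNReal.toReal_nonneg) (fun _ => ENNReal.toReal_nonneg)
      (fun _ => mul_nonneg (by positivity) ENNReal.toReal_nonneg) (bdd MA hMA) (bdd MB hMB) ?_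
    · have e2 : ∫⁻ s, ENNReal.ofReal ((2 ^ n)⁻¹ * h s) = (2 ^ n)⁻¹ * volume (A + B) := by
        rw [← eint hAB MC hMC, ← lintegral_const_mul _
          (measurable_volume_slice hAB.measurableSet).ennreal_toReal.ennreal_ofReal]
        refine lintegral_congr fun s => ?_
        rw [ENNReal.ofReal_mul (by positivity), ENNReal.ofReal_inv_of_pos (by positivity),
          ENNReal.ofReal_pow (by norm_num)]
        simp [hh]
      rw [eint hA MA hMA, eint hB MB hMB, e2] at key
      calc 4 ^ (n + 1) * (volume A * volume B) = 4 ^ n * (4 * (volume A * volume B)) := by ring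
        _ ≤ 4 ^ n * ((2 ^ n)⁻¹ * volume (A + B)) ^ 2 := by gcongr
        _ = volume (A + B) ^ 2 := by
          rw [mul_pow, ← mul_assoc, ← ENNReal.inv_pow, ← pow_mul, mul_comm n 2, pow_mul]
          norm_num
          rw [ENNReal.mul_inv_cancel (by positivity) (by finiteness), one_mul]
    · intro s t
      by_cases hs : {y : Fin n → ℝ | (Fin.cons s y : Fin (n + 1) → ℝ) ∈ A}.Nonempty
      swap
      · rw [not_nonempty_iff_eq_empty] at hs
        simp only [hf, hs, measure_empty, ENNReal.toReal_zero, zero_mul]; positivity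
      by_cases ht : {y : Fin n → ℝ | (Fin.cons t y : Fin (n + 1) → ℝ) ∈ B}.Nonempty
      swap
      · rw [not_nonempty_iff_eq_empty] at ht
        simp only [hg, ht, measure_empty, ENNReal.toReal_zero, mul_zero]; positivity
      have h1 := ih (isCompact_slice hA s) (isCompact_slice hB t) hs ht
      have h2 : {y : Fin n → ℝ | (Fin.cons s y : Fin (n + 1) → ℝ) ∈ A} +
          {y : Fin n → ℝ | (Fin.cons t y : Fin (n + 1) → ℝ) ∈ B} ⊆
          {y : Fin n → ℝ | (Fin.cons (s + t) y : Fin (n + 1) → ℝ) ∈ A + B} := by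
        rintro _ ⟨y, hy, z, hz, rfl⟩
        refine ⟨_, hy, _, hz, ?_⟩
        ext i
        refine Fin.cases ?_ (fun i => ?_) i <;> simp
      have h3 := h1.trans (pow_le_pow_left' (measure_mono h2) 2)
      have hAt := (isCompact_slice hA s).measure_lt_top (μ := volume)
      have hBt := (isCompact_slice hB t).measure_lt_top (μ := volume)
      have hCt := (isCompact_slice hAB (s + t)).measure_lt_top (μ := volume)
      rw [← ENNReal.toReal_le_toReal (by finiteness) (by finiteness)] at h3
      simp only [ENNReal.toReal_mul, ENNReal.toReal_pow, ENNReal.toReal_ofNat] at h3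
      rw [mul_pow, inv_pow, ← pow_mul, mul_comm n 2, pow_mul]
      norm_num
      rw [le_inv_mul_iff₀ (by positivity)]
      exact h3

/-- The Brunn–Minkowski inequality for compact sets in midpoint form. -/
theorem brunn_minkowski {n : ℕ} {A B : Set (EuclideanSpace ℝ (Fin n))} (hA : IsCompact A)
    (hB : IsCompact B) (hA0 : A.Nonempty) (hB0 : B.Nonempty) :
    4 ^ n * ((volume A).toReal * (volume B).toReal) ≤ (volume (A + B)).toReal ^ 2 := by
  let e := (EuclideanSpace.equiv (Fin n) ℝ)
  have hv : ∀ {S : Set (EuclideanSpace ℝ (Fin n))}, IsCompact S → volume (e '' S) = volume S := by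
    intro S hS
    have h := EuclideanSpace.volume_preserving_symm_measurableEquiv_toLp (Fin n)
    rw [← h.measure_preimage (hS.image e.continuous).measurableSet.nullMeasurableSet]
    congr 1
    exact e.injective.preimage_image S
  have h1 := brunn_minkowski_pi n (hA.image e.continuous) (hB.image e.continuous)
    (hA0.image _) (hB0.image _)
  have h2 : e '' A + e '' B = e '' (A + B) := (image_add e).symm
  rw [h2, hv hA, hv hB, hv (hA.add hB)] at h1
  have hAt := hA.measure_lt_top (μ := volume)
  have hBt := hB.measure_lt_top (μ := volume)
  have hCt := (hA.add hB).measure_lt_top (μ := volume)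
  rw [← ENNReal.toReal_le_toReal (by finiteness) (by finiteness)] at h1
  simpa using h1

end BrunnMinkowski

section VolumeProjection
open MeasureTheory Set

/-- The real-valued volume. -/
def vol {n : ℕ} (A : Set (En n)) : ℝ := (volume A).toReal

theorem volume_fin_succ_eq_lintegral_symm {n : ℕ} {A : Set (Fin (n + 1) → ℝ)}
    (hA : MeasurableSet A) :
    volume A = ∫⁻ y : Fin n → ℝ, volume {s : ℝ | (Fin.cons s y : Fin (n + 1) → ℝ) ∈ A} := by
  have h := volume_preserving_piFinSuccAbove (fun _ : Fin (n + 1) => ℝ) 0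
  have e : ∀ y : Fin n → ℝ, {s : ℝ | (Fin.cons s y : Fin (n + 1) → ℝ) ∈ A} =
      (fun s => (s, y)) ⁻¹'
        ((MeasurableEquiv.piFinSuccAbove (fun _ : Fin (n + 1) => ℝ) 0).symm ⁻¹' A) := by
    intro y
    ext s
    simp [MeasurableEquiv.piFinSuccAbove, Fin.consEquiv]
  rw [← h.symm.measure_preimage hA.nullMeasurableSet, Measure.volume_eq_prod,
    Measure.prod_apply_symm ((MeasurableEquiv.measurable _) hA)]
  simp_rw [e]

theorem measurable_volume_fiber {n : ℕ} {A : Set (Fin (n + 1) → ℝ)} (hA : MeasurableSet A) :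
    Measurable fun y : Fin n → ℝ => volume {s : ℝ | (Fin.cons s y : Fin (n + 1) → ℝ) ∈ A} := by
  have e : ∀ y : Fin n → ℝ, {s : ℝ | (Fin.cons s y : Fin (n + 1) → ℝ) ∈ A} =
      (fun s => (s, y)) ⁻¹'
        ((MeasurableEquiv.piFinSuccAbove (fun _ : Fin (n + 1) => ℝ) 0).symm ⁻¹' A) := by
    intro y
    ext s
    simp [MeasurableEquiv.piFinSuccAbove, Fin.consEquiv]
  simp_rw [e]
  exact measurable_measure_prodMk_right (μ := volume) ((MeasurableEquiv.measurable
    (MeasurableEquiv.piFinSuccAbove (fun _ : Fin (n + 1) => ℝ) 0).symm) hA)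

theorem Real.volume_add_Icc {X : Set ℝ} (hX : IsCompact X) (hc : Convex ℝ X) (h0 : X.Nonempty)
    {l : ℝ} (hl : 0 ≤ l) : volume (X + Icc 0 l) = volume X + ENNReal.ofReal l := by
  have h := eq_Icc_of_connected_compact ⟨h0, hc.isPreconnected⟩ hX
  have h1 : sInf X ≤ sSup X := by
    rw [h, nonempty_Icc] at h0; exact h0
  generalize sInf X = a at *
  generalize sSup X = b at *
  rw [h, Icc_add_Icc h1 hl, Real.volume_Icc, Real.volume_Icc, ← ENNReal.ofReal_add (by linarith) hl]
  congr 1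
  ring

theorem volume_add_segment_pi {n : ℕ} {K : Set (Fin (n + 1) → ℝ)} (hK : IsCompact K)
    (hc : Convex ℝ K) {l : ℝ} (hl : 0 ≤ l) :
    volume (K + segment ℝ 0 (Pi.single 0 l)) =
      volume K + ENNReal.ofReal l * volume ((fun x : Fin (n + 1) → ℝ => Fin.tail x) '' K) := by
  have hseg : IsCompact (segment ℝ (0 : Fin (n + 1) → ℝ) (Pi.single 0 l)) := by
    rw [segment_eq_image]
    exact isCompact_Icc.image (by fun_prop)
  have hT : IsCompact ((fun x : Fin (n + 1) → ℝ => Fin.tail x) '' K) :=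
    hK.image (continuous_pi fun i => continuous_apply _)
  have hf : ∀ y : Fin n → ℝ,
      {s : ℝ | (Fin.cons s y : Fin (n + 1) → ℝ) ∈ K + segment ℝ 0 (Pi.single 0 l)} =
      {s : ℝ | (Fin.cons s y : Fin (n + 1) → ℝ) ∈ K} + Icc 0 l := by
    intro y
    ext s
    constructor
    · rintro ⟨x, hx, z, hz, hxz⟩
      rw [segment_eq_image] at hz
      obtain ⟨t, ht, rfl⟩ := hz
      refine ⟨s - t * l, ?_, t * l, ⟨by have := ht.1; positivity, by nlinarith [ht.2]⟩, by ring⟩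
      have : x = Fin.cons (s - t * l) y := by
        ext i
        have := congrFun hxz i
        refine Fin.cases ?_ (fun i => ?_) i
        · have := congrFun hxz 0
          simp at this ⊢
          linarith
        · have := congrFun hxz i.succ
          simpa using this
      rw [mem_ofPred_eq, ← this]
      exact hx
    · rintro ⟨a, ha, b, hb, rfl⟩
      refine ⟨_, ha, Pi.single 0 b, ?_, ?_⟩
      · rw [segment_eq_image]
        rcases hl.eq_or_lt with h | h
        · have : b = 0 := le_antisymm (by rw [h]; exact hb.2) hb.1
          exact ⟨0, by simp, by simp [this]⟩
        · refine ⟨b / l, ⟨div_nonneg hb.1 hl, (div_le_one h).2 hb.2⟩, ?_⟩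
          ext i
          refine Fin.cases ?_ (fun i => ?_) i <;> simp [h.ne']
      · ext i
        refine Fin.cases ?_ (fun i => ?_) i <;> simp
  have hcs : ∀ y : Fin n → ℝ, IsCompact {s : ℝ | (Fin.cons s y : Fin (n + 1) → ℝ) ∈ K} := by
    intro y
    have : {s : ℝ | (Fin.cons s y : Fin (n + 1) → ℝ) ∈ K} =
        (fun x : Fin (n + 1) → ℝ => x 0) '' (K ∩ {x | Fin.tail x = y}) := by
      ext s
      constructor
      · intro hs
        exact ⟨_, ⟨hs, by simp⟩, by simp⟩
      · rintro ⟨x, ⟨hx, rfl⟩, rfl⟩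
        show Fin.cons (x 0) (Fin.tail x) ∈ K
        rw [Fin.cons_self_tail]; exact hx
    rw [this]
    refine (hK.inter_right (isClosed_eq ?_ continuous_const)).image (continuous_apply 0)
    exact continuous_pi fun i => continuous_apply _
  have hcv : ∀ y : Fin n → ℝ, Convex ℝ {s : ℝ | (Fin.cons s y : Fin (n + 1) → ℝ) ∈ K} := by
    intro y s hs t ht a b ha hb hab
    have := hc hs ht ha hb hab
    show _ ∈ K
    convert this
    ext i
    refine Fin.cases ?_ (fun i => ?_) i
    · simp
    · simp [← add_mul, hab]
  rw [volume_fin_succ_eq_lintegral_symm (hK.add hseg).measurableSet,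
    volume_fin_succ_eq_lintegral_symm hK.measurableSet,
    ← lintegral_indicator_const hT.measurableSet, ← lintegral_add_left
      (measurable_volume_fiber hK.measurableSet)]
  refine lintegral_congr fun y => ?_
  rw [hf]
  by_cases hy : y ∈ (fun x : Fin (n + 1) → ℝ => Fin.tail x) '' K
  · rw [indicator_of_mem hy, Real.volume_add_Icc (hcs y) (hcv y) _ hl]
    obtain ⟨x, hx, rfl⟩ := hy
    exact ⟨x 0, by show Fin.cons (x 0) (Fin.tail x) ∈ K; rw [Fin.cons_self_tail]; exact hx⟩
  · rw [indicator_of_notMem hy]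
    have : {s : ℝ | (Fin.cons s y : Fin (n + 1) → ℝ) ∈ K} = ∅ := by
      ext s
      simp only [mem_ofPred_eq, mem_empty_iff_false, iff_false]
      intro hs
      exact hy ⟨_, hs, by simp⟩
    simp [this]

theorem vol_nonneg {n : ℕ} (A : Set (En n)) : 0 ≤ vol A := ENNReal.toReal_nonneg

theorem vol_mono {n : ℕ} {A B : Set (En n)} (h : A ⊆ B) (hB : IsCompact B) : vol A ≤ vol B :=
  ENNReal.toReal_mono hB.measure_lt_top.ne (measure_mono h)

theorem vol_smul {n : ℕ} {t : ℝ} (ht : 0 ≤ t) (A : Set (En n)) : vol (t • A) = t ^ n * vol A := by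
  rw [vol, vol, Measure.addHaar_smul, ENNReal.toReal_mul, ENNReal.toReal_ofReal (abs_nonneg _)]
  simp [abs_of_nonneg ht]

theorem vol_image_isometry {n : ℕ} (e : En n ≃ₗᵢ[ℝ] En n) (A : Set (En n)) :
    vol (e '' A) = vol A := by
  have := e.symm.measurePreserving.measure_preimage_emb
    e.symm.toHomeomorph.measurableEmbedding A
  rw [vol, vol, ← this]
  congr 2
  exact e.toEquiv.image_eq_preimage_symm A

/-- A reflection mapping `v` to a multiple of the first basis vector. -/
def alignE {n : ℕ} (v : En (n + 1)) : En (n + 1) ≃ₗᵢ[ℝ] En (n + 1) :=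
  (Submodule.span ℝ {v - EuclideanSpace.single 0 ‖v‖})ᗮ.reflection

theorem alignE_self {n : ℕ} (v : En (n + 1)) : alignE v v = EuclideanSpace.single 0 ‖v‖ :=
  Submodule.reflection_sub (by simp)

/-- Forgetting the first coordinate. -/
def tailE (n : ℕ) : En (n + 1) →L[ℝ] En n :=
  LinearMap.toContinuousLinearMap
    { toFun := fun x => WithLp.toLp 2 fun i => x i.succ
      map_add' := fun _ _ => rfl
      map_smul' := fun _ _ => rfl }

@[simp] theorem tailE_apply {n : ℕ} (x : En (n + 1)) (i : Fin n) : tailE n x i = x i.succ := rfl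

/-- The orthogonal projection along `v`, with values in a fixed Euclidean space. -/
def projE {n : ℕ} (v : En (n + 1)) : En (n + 1) →L[ℝ] En n :=
  (tailE n).comp (alignE v).toContinuousLinearEquiv.toContinuousLinearMap

theorem projE_apply {n : ℕ} (v x : En (n + 1)) : projE v x = tailE n (alignE v x) := rfl

theorem inner_eq_tailE {n : ℕ} (x y : En (n + 1)) :
    inner ℝ x y = x 0 * y 0 + inner ℝ (tailE n x) (tailE n y) := by
  simp only [PiLp.inner_apply, Fin.sum_univ_succ, tailE_apply]
  simp [mul_comm]

theorem inner_projE {n : ℕ} {v x : En (n + 1)} (hv : v ≠ 0) (hx : inner ℝ x v = 0)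
    (y : En (n + 1)) : inner ℝ (projE v x) (projE v y) = inner ℝ x y := by
  have h1 : alignE v x 0 = 0 := by
    have h := (alignE v).inner_map_map x v
    rw [alignE_self, hx] at h
    simpa [EuclideanSpace.inner_single_right, hv] using h
  have h2 := inner_eq_tailE (alignE v x) (alignE v y)
  rw [(alignE v).inner_map_map, h1] at h2
  rw [projE_apply, projE_apply, h2]
  simp

theorem projE_image_closedBall {n : ℕ} (v : En (n + 1)) :
    projE v '' Metric.closedBall 0 1 = Metric.closedBall 0 1 := by
  ext y
  constructor
  · rintro ⟨x, hx, rfl⟩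
    have h1 := inner_eq_tailE (alignE v x) (alignE v x)
    rw [(alignE v).inner_map_map, real_inner_self_eq_norm_sq, ← projE_apply,
      real_inner_self_eq_norm_sq] at h1
    rw [mem_closedBall_zero_iff] at hx ⊢
    nlinarith [norm_nonneg x, norm_nonneg (projE v x), mul_self_nonneg (alignE v x 0)]
  · intro hy
    set z : En (n + 1) := WithLp.toLp 2 (Fin.cons 0 y.ofLp) with hz
    have hzt : tailE n z = y := by ext i; simp [hz]
    refine ⟨(alignE v).symm z, ?_, by rw [projE_apply, LinearIsometryEquiv.apply_symm_apply, hzt]⟩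
    have h1 := inner_eq_tailE z z
    rw [hzt, real_inner_self_eq_norm_sq, real_inner_self_eq_norm_sq] at h1
    have h0 : z 0 = 0 := by simp [hz]
    rw [h0] at h1
    rw [mem_closedBall_zero_iff] at hy ⊢
    rw [LinearIsometryEquiv.norm_map]
    nlinarith [norm_nonneg z, norm_nonneg y]

theorem projE_surjective {n : ℕ} (v : En (n + 1)) : Function.Surjective (projE v) := by
  intro y
  refine ⟨(alignE v).symm (WithLp.toLp 2 (Fin.cons 0 y.ofLp)), ?_⟩
  rw [projE_apply, LinearIsometryEquiv.apply_symm_apply]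
  ext i; simp

theorem vol_eq_pi {n : ℕ} {A : Set (En n)} (hA : IsCompact A) :
    vol A = (volume (EuclideanSpace.equiv (Fin n) ℝ '' A)).toReal := by
  have h := EuclideanSpace.volume_preserving_symm_measurableEquiv_toLp (Fin n)
  rw [vol, ← h.measure_preimage (hA.image
    (EuclideanSpace.equiv (Fin n) ℝ).continuous).measurableSet.nullMeasurableSet]
  congr 2
  exact ((EuclideanSpace.equiv (Fin n) ℝ).injective.preimage_image A).symm

/-- Adding a segment to a convex body. -/
theorem vol_add_segment {n : ℕ} {K : Set (En (n + 1))} (hK : IsCompact K) (hc : Convex ℝ K)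
    (v : En (n + 1)) :
    vol (K + segment ℝ 0 v) = vol K + ‖v‖ * vol (projE v '' K) := by
  set e := EuclideanSpace.equiv (Fin (n + 1)) ℝ
  have hseg : IsCompact (segment ℝ 0 v) := by
    rw [segment_eq_image]
    exact isCompact_Icc.image (by fun_prop)
  have ha : Continuous (alignE v) := (alignE v).continuous
  have hi : alignE v '' (K + segment ℝ 0 v) =
      alignE v '' K + segment ℝ 0 (EuclideanSpace.single 0 ‖v‖) := by
    rw [image_add]
    congr 1
    have := image_segment ℝ (alignE v).toLinearEquiv.toLinearMap.toAffineMap 0 v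
    simpa [alignE_self] using this
  have hi2 : e '' (alignE v '' K + segment ℝ 0 (EuclideanSpace.single 0 ‖v‖)) =
      e '' (alignE v '' K) + segment ℝ 0 (Pi.single 0 ‖v‖) := by
    rw [image_add]
    congr 1
    have := image_segment ℝ e.toLinearEquiv.toLinearMap.toAffineMap 0
      (EuclideanSpace.single 0 ‖v‖)
    have h1 : e (EuclideanSpace.single 0 ‖v‖) = Pi.single 0 ‖v‖ := rfl
    simpa [h1] using this
  have hc' : Convex ℝ (e '' (alignE v '' K)) :=
    (hc.linear_image (alignE v).toLinearEquiv.toLinearMap).linear_image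
      e.toLinearEquiv.toLinearMap
  have hk' : IsCompact (e '' (alignE v '' K)) := (hK.image ha).image e.continuous
  rw [← vol_image_isometry (alignE v), vol_eq_pi ((hK.add hseg).image ha), hi, hi2,
    volume_add_segment_pi hk' hc' (norm_nonneg v),
    ENNReal.toReal_add hk'.measure_lt_top.ne, ENNReal.toReal_mul,
    ENNReal.toReal_ofReal (norm_nonneg v), ← vol_eq_pi (hK.image ha), vol_image_isometry,
    vol_eq_pi (hK.image (projE v).continuous)]
  · congr 4
    ext x
    simp only [mem_image, exists_exists_and_eq_and]
    rfl
  · refine ENNReal.mul_ne_top ENNReal.ofReal_ne_top (IsCompact.measure_lt_top ?_).ne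
    exact hk'.image (continuous_pi fun i => continuous_apply _)

end VolumeProjection

section VolPoly
open MvPolynomial

/-- The underlying sets of convex bodies. -/
structure IsBody {n : ℕ} (A : Set (En n)) : Prop where
  isCompact : IsCompact A
  convex : Convex ℝ A
  nonempty : A.Nonempty

namespace IsBody
variable {n : ℕ} {A B : Set (En n)}

theorem add (hA : IsBody A) (hB : IsBody B) : IsBody (A + B) :=
  ⟨hA.1.add hB.1, hA.2.add hB.2, hA.3.add hB.3⟩

theorem smul (hA : IsBody A) (t : ℝ) : IsBody (t • A) :=
  ⟨hA.1.smul t, hA.2.smul t, hA.3.smul_set⟩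

theorem segment (v w : En n) : IsBody (segment ℝ v w) :=
  ⟨by rw [segment_eq_image]; exact isCompact_Icc.image (by fun_prop), convex_segment _ _,
    ⟨v, left_mem_segment _ _ _⟩⟩

theorem zero : IsBody (0 : Set (En n)) :=
  ⟨isCompact_singleton, convex_singleton _, Set.singleton_nonempty _⟩

theorem closedBall (x : En n) {r : ℝ} (hr : 0 ≤ r) : IsBody (Metric.closedBall x r) :=
  ⟨isCompact_closedBall _ _, convex_closedBall _ _, ⟨x, Metric.mem_closedBall_self hr⟩⟩

theorem sum {ι : Type*} {s : Finset ι} {t : ι → Set (En n)} (h : ∀ i ∈ s, IsBody (t i)) :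
    IsBody (∑ i ∈ s, t i) :=
  Finset.sum_induction _ IsBody (fun _ _ => add) zero h

theorem image {m : ℕ} (hA : IsBody A) (f : En n →L[ℝ] En m) : IsBody (f '' A) :=
  ⟨hA.1.image f.continuous, hA.2.linear_image f.toLinearMap, hA.3.image _⟩

end IsBody

/-- The increase of volume when a segment is added; for bodies this is `‖v‖` times the volume
of the projection along `v`. -/
def segVol {n : ℕ} (K : Set (En n)) (v : En n) : ℝ := vol (K + segment ℝ 0 v) - vol K

theorem segVol_succ {n : ℕ} {K : Set (En (n + 1))} (hK : IsBody K) (v : En (n + 1)) :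
    segVol K v = ‖v‖ * vol (projE v '' K) := by
  rw [segVol, vol_add_segment hK.1 hK.2]; ring

theorem smul_segment_zero {n : ℕ} (t : ℝ) (v : En n) :
    t • segment ℝ 0 v = segment ℝ 0 (t • v) := by
  have := image_segment ℝ (LinearMap.lsmul ℝ (En n) t).toAffineMap 0 v
  have h1 : (⇑(LinearMap.lsmul ℝ (En n) t).toAffineMap : En n → En n) = fun x => t • x := rfl
  rw [h1, Set.image_smul] at this
  rw [this]
  simp

theorem projE_smul {n : ℕ} {t : ℝ} (ht : 0 < t) (v : En (n + 1)) : projE (t • v) = projE v := by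
  have : alignE (t • v) = alignE v := by
    unfold alignE
    have h : t • v - EuclideanSpace.single 0 ‖t • v‖ = t • (v - EuclideanSpace.single 0 ‖v‖) := by
      rw [smul_sub, norm_smul, Real.norm_of_nonneg ht.le]
      congr 1
      ext i
      simp
    simp only [h, Submodule.span_singleton_smul_eq (IsUnit.mk0 t ht.ne')]
  unfold projE
  rw [this]

theorem vol_add_smul_segment {n : ℕ} {K : Set (En (n + 1))} (hK : IsBody K) (v : En (n + 1))
    {t : ℝ} (ht : 0 ≤ t) :
    vol (K + t • segment ℝ 0 v) = vol K + t * (‖v‖ * vol (projE v '' K)) := by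
  rw [smul_segment_zero, vol_add_segment hK.1 hK.2]
  rcases ht.eq_or_lt with rfl | h
  · simp
  · rw [projE_smul h, norm_smul, Real.norm_of_nonneg ht]; ring

theorem image_add_sum_segment {n m : ℕ} {σ : Type*} (f : En n →L[ℝ] En m) (s : Finset σ)
    (a : ℝ) (L : Set (En n)) (x : σ → ℝ) (v : σ → En n) :
    f '' (a • L + ∑ j ∈ s, x j • segment ℝ 0 (v j)) =
      a • (f '' L) + ∑ j ∈ s, x j • segment ℝ 0 (f (v j)) := by
  have h1 : f '' (∑ j ∈ s, x j • segment ℝ 0 (v j)) = ∑ j ∈ s, x j • segment ℝ 0 (f (v j)) := by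
    classical
    induction s using Finset.induction_on with
    | empty => simp; rfl
    | insert j s hj ih =>
      rw [Finset.sum_insert hj, Finset.sum_insert hj, Set.image_add, ih, image_smul_set]
      congr 2
      have := image_segment ℝ f.toLinearMap.toAffineMap 0 (v j)
      simpa using this
  rw [Set.image_add, h1, image_smul_set]

section
variable {σ : Type*} [Fintype σ]

theorem dirD_C_mul (c : ℝ) (z : σ → ℝ) (p : MvPolynomial σ ℝ) :
    dirD z (C c * p) = C c * dirD z p := by
  rw [← smul_eq_C_mul, ← smul_eq_C_mul, map_smul]

theorem IterHyp.C_mul {o : σ} {d : ℕ} {p : MvPolynomial σ ℝ} (h : IterHyp o d p) {c : ℝ}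
    (hc : 0 ≤ c) : IterHyp o d (C c * p) := by
  have hh : ∀ {d : ℕ} {p : MvPolynomial σ ℝ}, p.IsHomogeneous d →
      (C c * p).IsHomogeneous d := fun h => by simpa using (isHomogeneous_C σ c).mul h
  have hn : ∀ {p : MvPolynomial σ ℝ}, NonnegCoeff p → NonnegCoeff (C c * p) := fun h m => by
    rw [coeff_C_mul]; exact mul_nonneg hc (h m)
  induction d generalizing p with
  | zero => exact ⟨hh h.1, hn h.2⟩
  | succ d ih =>
    refine ⟨hh h.1, hn h.2.1, fun w hw y => ?_, fun j hj => ?_⟩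
    · have := mul_le_mul_of_nonneg_left (h.2.2.1 w hw y) (sq_nonneg c)
      simp only [dirD_C_mul, eval_mul, eval_C]
      linarith
    · rw [pderiv_C_mul]
      exact ih (h.2.2.2 j hj)

theorem eval_pderiv_of_line [DecidableEq σ] {d : ℕ} {p : MvPolynomial σ ℝ}
    (hp : p.IsHomogeneous (d + 1)) (w : σ → ℝ) (j : σ) {a b : ℝ}
    (h : ∀ t : ℝ, 0 ≤ t → eval (w + t • Pi.single j 1) p = a + t * b) :
    eval w (pderiv j p) = b := by
  have h1 : ∀ t : ℝ, 0 ≤ t → Polynomial.eval t (∑ m ∈ Finset.range (d + 2),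
      Polynomial.C (eval w ((dirD (Pi.single j 1))^[m] p) / m.factorial) * Polynomial.X ^ m) =
      Polynomial.eval t (Polynomial.C a + Polynomial.C b * Polynomial.X) := by
    intro t ht
    have h2 := eval_line hp w (Pi.single j 1) 1 t
    rw [one_smul, h t ht] at h2
    simp only [Polynomial.eval_finsetSum, Polynomial.eval_add, Polynomial.eval_mul,
      Polynomial.eval_C, Polynomial.eval_pow, Polynomial.eval_X]
    rw [mul_comm b t, h2]
    simp
  have h3 := Polynomial.eq_of_infinite_eval_eq _ _
    ((Set.Ici_infinite (0 : ℝ)).mono fun t ht => h1 t ht)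
  have h4 := congrArg (fun q => Polynomial.coeff q 1) h3
  simp only [Polynomial.finsetSum_coeff, Polynomial.coeff_C_mul, Polynomial.coeff_X_pow,
    Polynomial.coeff_add] at h4
  rw [Finset.sum_eq_single 1 (by intro m _ hm; simp [hm.symm]) (by simp)] at h4
  simpa [dirD_single, Polynomial.coeff_C] using h4

end

/-- The volume of `x o • L + ∑ x j • [0, v j]` is a polynomial in `x`. -/
theorem exists_volume_polynomial {σ : Type*} [Fintype σ] [DecidableEq σ] (o : σ) (n : ℕ)
    {L : Set (En n)} (hL : IsBody L) (v : σ → En n) :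
    ∃ p : MvPolynomial σ ℝ, IterHyp o n p ∧ ∀ x : σ → ℝ, (∀ i, 0 ≤ x i) →
      eval x p = vol (x o • L + ∑ j ∈ Finset.univ.erase o, x j • segment ℝ 0 (v j)) := by
  induction n with
  | zero =>
    refine ⟨C (vol (Set.univ : Set (En 0))), ⟨isHomogeneous_C _ _, fun m => ?_⟩, fun x hx => ?_⟩
    · classical
      rw [coeff_C]; split_ifs
      exacts [vol_nonneg _, le_rfl]
    · rw [eval_C]
      congr 1
      symm
      apply Subsingleton.eq_univ_of_nonempty
      exact ((hL.smul _).add (IsBody.sum fun j _ => (IsBody.segment _ _).smul _)).nonempty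
  | succ n ih =>
    choose P hP hPe using fun j => ih (hL.image (projE (v j))) (fun i => projE (v j) (v i))
    have hbody : ∀ (x : σ → ℝ) (s : Finset σ),
        IsBody (x o • L + ∑ j ∈ s, x j • segment ℝ 0 (v j)) := fun x s =>
      (hL.smul _).add (IsBody.sum fun j _ => (IsBody.segment _ _).smul _)
    have key : ∀ s : Finset σ, o ∉ s → ∃ p : MvPolynomial σ ℝ, p.IsHomogeneous (n + 1) ∧
        NonnegCoeff p ∧ ∀ x : σ → ℝ, (∀ i, 0 ≤ x i) →
          eval x p = vol (x o • L + ∑ j ∈ s, x j • segment ℝ 0 (v j)) := by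
      intro s
      induction s using Finset.induction_on with
      | empty =>
        intro _
        refine ⟨C (vol L) * X o ^ (n + 1), ?_, fun m => ?_, fun x hx => ?_⟩
        · simpa using (isHomogeneous_C σ (vol L)).mul (isHomogeneous_X_pow o (n + 1))
        · rw [coeff_C_mul, coeff_X_pow]
          refine mul_nonneg (vol_nonneg _) ?_
          split_ifs <;> simp
        · simp [vol_smul (hx o), mul_comm]
      | insert j s hj ihs =>
        intro ho
        rw [Finset.mem_insert, not_or] at ho
        obtain ⟨p, hp, hp0, hpe⟩ := ihs ho.2
        obtain ⟨q, hq, hqe⟩ := ih (hL.image (projE (v j)))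
          (fun i => if i ∈ s then projE (v j) (v i) else 0)
        refine ⟨p + C ‖v j‖ * (X j * q), hp.add ?_, fun m => ?_, fun x hx => ?_⟩
        · have := (isHomogeneous_C σ ‖v j‖).mul ((isHomogeneous_X ℝ j).mul hq.homog)
          simpa [add_comm] using this
        · rw [coeff_add, coeff_C_mul, coeff_X_mul']
          refine add_nonneg (hp0 m) (mul_nonneg (norm_nonneg _) ?_)
          split_ifs
          exacts [hq.nonnegCoeff _, le_rfl]
        · rw [eval_add, eval_mul, eval_mul, eval_C, eval_X, hpe x hx, hqe x hx,
            Finset.sum_insert hj, add_comm (x j • _), ← add_assoc,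
            vol_add_smul_segment (hbody x s) (v j) (hx j), image_add_sum_segment]
          have : ∑ i ∈ Finset.univ.erase o,
              x i • segment ℝ 0 (if i ∈ s then projE (v j) (v i) else 0) =
              ∑ i ∈ s, x i • segment ℝ 0 (projE (v j) (v i)) := by
            rw [← Finset.sum_subset (s₁ := s)]
            · exact Finset.sum_congr rfl fun i hi => by rw [if_pos hi]
            · intro i hi
              exact Finset.mem_erase.2 ⟨fun h => ho.2 (h ▸ hi), Finset.mem_univ _⟩
            · intro i _ hi
              rw [if_neg hi, segment_same]
              simp
              rfl
          rw [this]
          ring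
    obtain ⟨p, hp, hp0, hpe⟩ := key (Finset.univ.erase o) (by simp)
    refine ⟨p, ⟨hp, hp0, ?_, fun j hj => ?_⟩, hpe⟩
    · refine hessHyp_of_midpoint hp (by omega) hp0 fun x y hx hy => ?_
      rw [hpe x fun i => (hx i).le, hpe y fun i => (hy i).le,
        hpe (x + y) fun i => (add_pos (hx i) (hy i)).le]
      have : (x + y) o • L + ∑ j ∈ Finset.univ.erase o, (x + y) j • segment ℝ 0 (v j) =
          (x o • L + ∑ j ∈ Finset.univ.erase o, x j • segment ℝ 0 (v j)) +
          (y o • L + ∑ j ∈ Finset.univ.erase o, y j • segment ℝ 0 (v j)) := by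
        rw [add_add_add_comm, ← Finset.sum_add_distrib, Pi.add_apply,
          hL.convex.add_smul (hx o).le (hy o).le]
        congr 1
        refine Finset.sum_congr rfl fun j _ => ?_
        rw [Pi.add_apply, (convex_segment _ _).add_smul (hx j).le (hy j).le]
      rw [this]
      exact brunn_minkowski (hbody x _).1 (hbody y _).1 (hbody x _).3 (hbody y _).3
    · have : pderiv j p = C ‖v j‖ * P j := by
        refine MvPolynomial.funext_set (fun _ => Set.Ici (0 : ℝ)) (fun _ => Set.Ici_infinite 0)
          fun x hx => ?_
        have hx : ∀ i, 0 ≤ x i := fun i => hx i (Set.mem_univ i)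
        rw [eval_mul, eval_C]
        refine eval_pderiv_of_line (a := eval x p) hp x j fun t ht => ?_
        have hxt : ∀ i, 0 ≤ (x + t • Pi.single j 1 : σ → ℝ) i := by
          intro i
          have : 0 ≤ (Pi.single j (1 : ℝ) : σ → ℝ) i := by
            rw [Pi.single_apply]; split_ifs <;> simp
          have := hx i
          simp only [Pi.add_apply, Pi.smul_apply, smul_eq_mul]
          positivity
        rw [hpe _ hxt, hpe _ hx, hPe j x hx, ← image_add_sum_segment,
          ← vol_add_smul_segment (hbody x _) (v j) ht]
        congr 1
        have h1 : ∑ i ∈ Finset.univ.erase o, (x + t • Pi.single j 1 : σ → ℝ) i • segment ℝ 0 (v i) =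
            ∑ i ∈ Finset.univ.erase o, x i • segment ℝ 0 (v i) + t • segment ℝ 0 (v j) := by
          have hjm : j ∈ Finset.univ.erase o := by simp [hj]
          rw [← Finset.add_sum_erase _ _ hjm, ← Finset.add_sum_erase _ _ hjm]
          have : (x + t • Pi.single j 1 : σ → ℝ) j = x j + t := by simp
          rw [this, (convex_segment _ _).add_smul (hx j) ht, add_right_comm]
          congr 2
          refine Finset.sum_congr rfl fun i hi => ?_
          have : i ≠ j := (Finset.mem_erase.1 hi).1
          simp [this]
        rw [h1, ← add_assoc]
        congr 3
        simp [hj.symm]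
      rw [this]
      exact (hP j).C_mul (norm_nonneg _)

theorem volume_expansion {n : ℕ} {L : Set (En n)} (hL : IsBody L) {τ : Type*} [Fintype τ]
    (v : τ → En n) : ∃ a : ℕ → ℝ, (∀ m, 0 ≤ a m) ∧
      (∀ m, 1 ≤ m → m + 1 ≤ n → a (m - 1) * a (m + 1) ≤ a m ^ 2) ∧
      (∀ s t : ℝ, 0 ≤ s → 0 ≤ t → vol (s • L + t • ∑ j, segment ℝ 0 (v j)) =
        ∑ m ∈ Finset.range (n + 1), n.choose m * a m * s ^ (n - m) * t ^ m) ∧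
      (n : ℝ) * a 1 = ∑ j, segVol L (v j) := by
  classical
  obtain ⟨p, hp, hpe⟩ := exists_volume_polynomial (none : Option τ) n hL
    (fun i => i.elim 0 v)
  have herase : Finset.univ.erase (none : Option τ) = Finset.univ.map Function.Embedding.some := by
    ext i; cases i <;> simp
  set z : Option τ → ℝ := fun i => i.elim 0 fun _ => 1 with hz
  have hz0 : ∀ i, 0 ≤ z i := by rintro (_ | i) <;> simp [hz]
  obtain ⟨a, ha0, ha1, ha2, ha3⟩ := hp.expansion hz0 rfl
  refine ⟨a, ha0, ha1, fun s t hs ht => ?_, ?_⟩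
  · rw [← ha2, hpe, herase, Finset.sum_map]
    · have : t • ∑ j, segment ℝ 0 (v j) = ∑ j, t • segment ℝ 0 (v j) := by
        rw [Finset.smul_sum]
      rw [this]
      simp [hz]
    · rintro (_ | i) <;> simp [hz, hs, ht]
  · rw [ha3, dirD_apply, map_sum, Fintype.sum_option]
    simp only [hz, Option.elim, zero_smul, map_zero, zero_add, one_smul]
    refine Finset.sum_congr rfl fun j _ => ?_
    have he0 : ∀ t : ℝ, 0 ≤ t → ∀ i, 0 ≤ (Pi.single none 1 + t • Pi.single (some j) 1 :
        Option τ → ℝ) i := by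
      rintro t ht (_ | i)
      · simp
      · simp only [Pi.add_apply, Pi.smul_apply, smul_eq_mul, Pi.single_apply]
        split_ifs <;> simp [ht] <;> linarith
    have hev : ∀ t : ℝ, 0 ≤ t → eval (Pi.single none 1 + t • Pi.single (some j) 1) p =
        vol (L + t • segment ℝ 0 (v j)) := by
      intro t ht
      rw [hpe _ (he0 t ht), herase, Finset.sum_map, Finset.sum_eq_single j]
      · simp
      · intro i _ hi
        have h0 : ∀ S : Set (En n), S.Nonempty → (0 : ℝ) • S = 0 := fun S hS => Set.zero_smul_set hS
        simp [hi, h0 _ (IsBody.segment 0 (v i)).nonempty]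
      · simp
    cases n with
    | zero =>
      have h1 : segVol L (v j) = 0 := by
        rw [segVol, sub_eq_zero]
        congr 1
        rw [Subsingleton.eq_univ_of_nonempty hL.nonempty,
          Subsingleton.eq_univ_of_nonempty
            ((Set.univ_nonempty).add (IsBody.segment 0 (v j)).nonempty)]
      have h2 : pderiv (some j) p = 0 := by
        have := dirD_eq_zero (Pi.single (some j) 1) hp.homog
        rwa [dirD_single] at this
      rw [h1, h2, map_zero]
    | succ n =>
      rw [segVol_succ hL]
      refine eval_pderiv_of_line (a := vol L) hp.homog _ _ fun t ht => ?_
      rw [hev t ht, vol_add_smul_segment hL _ ht]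
end VolPoly

section Support
open Set

/-- The support function of a set. -/
def supp {n : ℕ} (A : Set (En n)) (u : En n) : ℝ := sSup ((fun x => inner ℝ u x) '' A)

variable {n : ℕ} {A B : Set (En n)}

theorem IsBody.bddAbove (hA : IsBody A) (u : En n) :
    BddAbove ((fun x => inner ℝ u x) '' A) :=
  (hA.1.image (by fun_prop)).bddAbove

theorem le_supp (hA : IsBody A) (u : En n) {x : En n} (hx : x ∈ A) : inner ℝ u x ≤ supp A u :=
  le_csSup (hA.bddAbove u) (mem_image_of_mem _ hx)

theorem supp_le (hA : IsBody A) {u : En n} {c : ℝ} (h : ∀ x ∈ A, inner ℝ u x ≤ c) :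
    supp A u ≤ c :=
  csSup_le (hA.3.image _) (by rintro _ ⟨x, hx, rfl⟩; exact h x hx)

theorem exists_eq_supp (hA : IsBody A) (u : En n) : ∃ x ∈ A, inner ℝ u x = supp A u :=
  (hA.1.image (by fun_prop)).sSup_mem (hA.3.image _)

theorem supp_add (hA : IsBody A) (hB : IsBody B) (u : En n) :
    supp (A + B) u = supp A u + supp B u := by
  apply le_antisymm
  · refine supp_le (hA.add hB) ?_
    rintro _ ⟨x, hx, y, hy, rfl⟩
    simp only [inner_add_right]
    exact add_le_add (le_supp hA u hx) (le_supp hB u hy)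
  · obtain ⟨x, hx, hxe⟩ := exists_eq_supp hA u
    obtain ⟨y, hy, hye⟩ := exists_eq_supp hB u
    rw [← hxe, ← hye, ← inner_add_right]
    exact le_supp (hA.add hB) u (add_mem_add hx hy)

theorem supp_singleton (x u : En n) : supp {x} u = inner ℝ u x := by simp [supp]

theorem supp_sum {ι : Type*} (s : Finset ι) {t : ι → Set (En n)} (h : ∀ i ∈ s, IsBody (t i))
    (u : En n) : supp (∑ i ∈ s, t i) u = ∑ i ∈ s, supp (t i) u := by
  classical
  induction s using Finset.induction_on with
  | empty =>
    have : (0 : Set (En n)) = {0} := rfl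
    simp [this, supp_singleton]
  | insert j s hj ih =>
    rw [Finset.sum_insert hj, Finset.sum_insert hj, supp_add (h j (Finset.mem_insert_self _ _))
      (IsBody.sum fun i hi => h i (Finset.mem_insert_of_mem hi)),
      ih fun i hi => h i (Finset.mem_insert_of_mem hi)]

theorem supp_segment (v u : En n) : supp (segment ℝ 0 v) u = (|inner ℝ u v| + inner ℝ u v) / 2 := by
  apply le_antisymm
  · refine supp_le (IsBody.segment _ _) fun x hx => ?_
    rw [segment_eq_image] at hx
    obtain ⟨t, ht, rfl⟩ := hx
    simp only [smul_zero, zero_add, inner_smul_right]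
    rcases le_total 0 (inner ℝ u v) with h | h
    · rw [abs_of_nonneg h]; nlinarith [ht.2]
    · rw [abs_of_nonpos h]; nlinarith [ht.1]
  · rcases le_total 0 (inner ℝ u v) with h | h
    · rw [abs_of_nonneg h]
      linarith [le_supp (IsBody.segment 0 v) u (right_mem_segment ℝ 0 v)]
    · rw [abs_of_nonpos h]
      have := le_supp (IsBody.segment 0 v) u (left_mem_segment ℝ 0 v)
      rw [inner_zero_right] at this
      linarith

theorem supp_closedBall (u : En n) {r : ℝ} (hr : 0 ≤ r) :
    supp (Metric.closedBall 0 r) u = r * ‖u‖ := by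
  apply le_antisymm
  · refine supp_le (IsBody.closedBall 0 hr) fun x hx => ?_
    rw [mem_closedBall_zero_iff] at hx
    have := real_inner_le_norm u x
    nlinarith [norm_nonneg u]
  · rcases eq_or_ne u 0 with rfl | hu
    · have := le_supp (IsBody.closedBall (0 : En n) hr) 0 (Metric.mem_closedBall_self hr)
      simpa using this
    · have hu' : 0 < ‖u‖ := norm_pos_iff.2 hu
      have h1 : (r / ‖u‖) • u ∈ Metric.closedBall (0 : En n) r := by
        rw [mem_closedBall_zero_iff, norm_smul, Real.norm_of_nonneg (by positivity)]
        rw [div_mul_cancel₀ _ hu'.ne']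
      have := le_supp (IsBody.closedBall 0 hr) u h1
      rw [inner_smul_right, real_inner_self_eq_norm_sq] at this
      have h2 : r / ‖u‖ * ‖u‖ ^ 2 = r * ‖u‖ := by
        field_simp
      rwa [h2] at this

theorem subset_of_supp_le (hA : IsBody A) (hB : IsBody B) (h : ∀ u, supp A u ≤ supp B u) :
    A ⊆ B := by
  intro x hx
  by_contra hxB
  obtain ⟨f, c, hf, hc⟩ := geometric_hahn_banach_closed_point hB.convex hB.isCompact.isClosed hxB
  set u := (InnerProductSpace.toDual ℝ (En n)).symm f
  have hu : ∀ y, inner ℝ u y = f y := fun y => InnerProductSpace.toDual_symm_apply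
  have h1 : supp B u ≤ c := supp_le hB fun y hy => by rw [hu]; exact (hf y hy).le
  have h2 := le_supp hA u hx
  rw [hu] at h2
  linarith [h u]

theorem eq_of_supp_eq (hA : IsBody A) (hB : IsBody B) (h : ∀ u, supp A u = supp B u) : A = B :=
  (subset_of_supp_le hA hB fun u => (h u).le).antisymm
    (subset_of_supp_le hB hA fun u => (h u).ge)

theorem supp_projE {A : Set (En (n + 1))} {v x : En (n + 1)} (hv : v ≠ 0)
    (hx : inner ℝ x v = 0) : supp (projE v '' A) (projE v x) = supp A x := by
  unfold supp
  congr 1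
  ext c
  simp only [mem_image, exists_exists_and_eq_and, inner_projE hv hx]

end Support

section BallApprox
open MeasureTheory Set Filter Topology

/-- Simple functions approximating the identity. -/
def idApprox (n N : ℕ) : SimpleFunc (En n) (En n) :=
  SimpleFunc.approxOn id measurable_id univ 0 (mem_univ _) N

theorem tendsto_idApprox {n : ℕ} (x : En n) :
    Tendsto (fun N => idApprox n N x) atTop (𝓝 x) :=
  SimpleFunc.tendsto_approxOn measurable_id (mem_univ _) (by simp)

theorem norm_idApprox_le {n : ℕ} (N : ℕ) (x : En n) : ‖idApprox n N x‖ ≤ 2 * ‖x‖ := by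
  have := SimpleFunc.norm_approxOn_zero_le (measurable_id (α := En n)) (mem_univ (0 : En n)) x N
  simp only [id] at this
  rw [two_mul]; exact this

theorem norm_idApprox_sub_le {n : ℕ} (N : ℕ) (x : En n) : ‖idApprox n N x - x‖ ≤ ‖x‖ := by
  have := SimpleFunc.nnnorm_approxOn_le (measurable_id (α := En n)) (mem_univ (0 : En n)) x N
  simp only [id, sub_zero] at this
  exact this

/-- Lebesgue measure on the unit ball. -/
def ballMeas (n : ℕ) : Measure (En n) := volume.restrict (Metric.closedBall 0 1)

instance (n : ℕ) : IsFiniteMeasure (ballMeas n) :=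
  ⟨by rw [ballMeas, Measure.restrict_apply_univ]; exact (isCompact_closedBall _ _).measure_lt_top⟩

theorem ae_ballMeas {n : ℕ} : ∀ᵐ x ∂ballMeas n, ‖x‖ ≤ 1 := by
  rw [ballMeas]
  filter_upwards [ae_restrict_mem Metric.isClosed_closedBall.measurableSet] with x hx
  simpa using hx

theorem Continuous.integrable_ballMeas {n : ℕ} {g : En n → ℝ} (hg : Continuous g) :
    Integrable g (ballMeas n) :=
  hg.continuousOn.integrableOn_compact (isCompact_closedBall _ _)

theorem sum_idApprox {n N : ℕ} (g : En n → ℝ) :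
    ∑ y ∈ (idApprox n N).range, (ballMeas n).real (idApprox n N ⁻¹' {y}) * g y =
      ∫ x, g (idApprox n N x) ∂ballMeas n := by
  have h1 : ∀ g : En n → ℝ, g 0 = 0 →
      ∑ y ∈ (idApprox n N).range, (ballMeas n).real (idApprox n N ⁻¹' {y}) * g y =
      ∫ x, g (idApprox n N x) ∂ballMeas n := by
    intro g hg
    simp only [← smul_eq_mul]
    rw [← (SimpleFunc.map_integral (idApprox n N) g
      (SimpleFunc.integrable_of_isFiniteMeasure _) hg),
      SimpleFunc.integral_eq_integral _ (SimpleFunc.integrable_of_isFiniteMeasure _)]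
    rfl
  have h2 := h1 (fun y => g y - g 0) (sub_self _)
  have hi : Integrable (fun x => g (idApprox n N x)) (ballMeas n) :=
    SimpleFunc.integrable_of_isFiniteMeasure ((idApprox n N).map g)
  rw [integral_sub hi (integrable_const _)] at h2
  simp only [mul_sub, Finset.sum_sub_distrib, ← Finset.sum_mul] at h2
  have h3 : ∑ y ∈ (idApprox n N).range, (ballMeas n).real (idApprox n N ⁻¹' {y}) =
      (ballMeas n).real univ := by
    rw [measureReal_def, ← SimpleFunc.sum_range_measure_preimage_singleton (idApprox n N),
      ENNReal.toReal_sum fun _ _ => measure_ne_top _ _]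
    rfl
  rw [h3] at h2
  simp at h2
  linarith

theorem tendsto_sum_idApprox {n : ℕ} {g : En n → ℝ} (hg : Continuous g) :
    Tendsto (fun N => ∑ y ∈ (idApprox n N).range,
      (ballMeas n).real (idApprox n N ⁻¹' {y}) * g y) atTop (𝓝 (∫ x, g x ∂ballMeas n)) := by
  simp_rw [sum_idApprox]
  obtain ⟨M, hM⟩ := (isCompact_closedBall (0 : En n) 2).exists_bound_of_continuousOn hg.continuousOn
  refine tendsto_integral_of_dominated_convergence (fun _ => M) (fun N => ?_) (integrable_const _)
    (fun N => ?_) ?_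
  · exact (SimpleFunc.integrable_of_isFiniteMeasure ((idApprox n N).map g)).aestronglyMeasurable
  · filter_upwards [ae_ballMeas] with x hx
    refine hM _ ?_
    rw [mem_closedBall_zero_iff]
    linarith [norm_idApprox_le N x]
  · exact ae_of_all _ fun x => (hg.tendsto x).comp (tendsto_idApprox x)

/-- The mean of `|⟪u, x⟫|` over the ball, for unit `u`. -/
def ballConst (n : ℕ) : ℝ := ∫ x, |x 0| ∂ballMeas (n + 1)

theorem ballConst_pos (n : ℕ) : 0 < ballConst n := by
  unfold ballConst ballMeas
  have hc : Continuous fun x : En (n + 1) => |x 0| := by fun_prop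
  rw [setIntegral_pos_iff_support_of_nonneg_ae (ae_of_all _ fun x => abs_nonneg _)
    (hc.integrable_ballMeas)]
  have ho : IsOpen ({x : En (n + 1) | x 0 ≠ 0} ∩ Metric.ball 0 1) :=
    (isOpen_ne_fun (by fun_prop) continuous_const).inter Metric.isOpen_ball
  refine (ho.measure_pos volume ⟨EuclideanSpace.single 0 (1 / 2), ?_, ?_⟩).trans_le
    (measure_mono ?_)
  · simp
  · simp only [Metric.mem_ball, dist_zero_right, PiLp.norm_single]; norm_num
  · rintro x ⟨hx, hx2⟩
    exact ⟨by simpa using hx, Metric.ball_subset_closedBall hx2⟩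

theorem integral_abs_inner {n : ℕ} (u : En (n + 1)) :
    ∫ x, |inner ℝ u x| ∂ballMeas (n + 1) = ‖u‖ * ballConst n := by
  have h1 : ∀ x, |inner ℝ u x| = ‖u‖ * |alignE u x 0| := by
    intro x
    rw [← (alignE u).inner_map_map, alignE_self, EuclideanSpace.inner_single_left]
    simp [abs_mul]
  simp_rw [h1]
  rw [integral_const_mul]
  congr 1
  have := (alignE u).measurePreserving.setIntegral_preimage_emb
    (alignE u).toHomeomorph.measurableEmbedding (fun x => |x 0|) (Metric.closedBall 0 1)
  rw [LinearIsometryEquiv.preimage_closedBall, map_zero] at this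
  exact this

/-- The zonotopes approximating the unit ball. -/
def ballZon (n N : ℕ) : Set (En (n + 1)) :=
  ∑ y : (idApprox (n + 1) N).range, segment ℝ 0
    ((2 / ballConst n * (ballMeas (n + 1)).real (idApprox (n + 1) N ⁻¹' {y.1})) • y.1)

theorem exists_ballZon_bounds (n : ℕ) {η : ℝ} (hη : 0 < η) (hη1 : η < 1) :
    ∀ᶠ N in atTop, ∃ x : En (n + 1), Metric.closedBall 0 (1 - η) ⊆ {x} + ballZon n N ∧
      {x} + ballZon n N ⊆ Metric.closedBall 0 (1 + η) := by
  have hc := ballConst_pos n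
  have hlim : Tendsto (fun N => ∫ x, ‖idApprox (n + 1) N x - x‖ ∂ballMeas (n + 1)) atTop (𝓝 0) := by
    rw [show (0 : ℝ) = ∫ x, ‖x - x‖ ∂ballMeas (n + 1) by simp]
    refine tendsto_integral_of_dominated_convergence (fun _ => 1) (fun N => ?_)
      (integrable_const _) (fun N => ?_) ?_
    · have h := (idApprox (n + 1) N).measurable
      exact ((h.sub measurable_id).norm).aestronglyMeasurable
    · filter_upwards [ae_ballMeas] with x hx
      rw [norm_norm]
      exact (norm_idApprox_sub_le N x).trans hx
    · exact ae_of_all _ fun x => ((tendsto_idApprox x).sub_const x).norm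
  filter_upwards [hlim.eventually_lt_const (mul_pos hη hc)] with N hN
  set w : En (n + 1) → ℝ := fun y => (ballMeas (n + 1)).real (idApprox (n + 1) N ⁻¹' {y}) with hw
  have hw0 : ∀ y, 0 ≤ w y := fun y => measureReal_nonneg
  set x : En (n + 1) := -∑ y : (idApprox (n + 1) N).range, (1 / ballConst n * w y.1) • y.1 with hx
  have hZ : IsBody (ballZon n N) := IsBody.sum fun _ _ => IsBody.segment _ _
  have hX : IsBody ({x} : Set (En (n + 1))) :=
    ⟨isCompact_singleton, convex_singleton _, singleton_nonempty _⟩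
  have hs : ∀ u, supp ({x} + ballZon n N) u =
      (ballConst n)⁻¹ * ∫ z, |inner ℝ u (idApprox (n + 1) N z)| ∂ballMeas (n + 1) := by
    intro u
    rw [supp_add hX hZ, supp_singleton, ballZon, supp_sum _ fun _ _ => IsBody.segment _ _,
      ← sum_idApprox fun z => |inner ℝ u z|, hx, inner_neg_right, inner_sum, Finset.mul_sum,
      ← Finset.sum_coe_sort (idApprox (n + 1) N).range, ← Finset.sum_neg_distrib,
      ← Finset.sum_add_distrib]
    refine Finset.sum_congr rfl fun y _ => ?_
    have h2 : 0 ≤ 2 / ballConst n * w y.1 := mul_nonneg (by positivity) (hw0 _)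
    rw [supp_segment, inner_smul_right, inner_smul_right, abs_mul, abs_of_nonneg h2]
    field_simp
    ring
  have hb : ∀ u : En (n + 1), |∫ z, |inner ℝ u (idApprox (n + 1) N z)| ∂ballMeas (n + 1) -
      ‖u‖ * ballConst n| ≤ ‖u‖ * (η * ballConst n) := by
    intro u
    have hi1 : Integrable (fun z => |inner ℝ u (idApprox (n + 1) N z)|) (ballMeas (n + 1)) :=
      SimpleFunc.integrable_of_isFiniteMeasure
        ((idApprox (n + 1) N).map fun z => |inner ℝ u z|)
    have hi2 : Integrable (fun z => |inner ℝ u z|) (ballMeas (n + 1)) :=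
      Continuous.integrable_ballMeas (by fun_prop)
    have hi3 : Integrable (fun z => ‖idApprox (n + 1) N z - z‖) (ballMeas (n + 1)) := by
      have h1 : Integrable (idApprox (n + 1) N) (ballMeas (n + 1)) :=
        SimpleFunc.integrable_of_isFiniteMeasure _
      have h2 : Integrable (fun z : En (n + 1) => z) (ballMeas (n + 1)) :=
        continuous_id.continuousOn.integrableOn_compact (isCompact_closedBall _ _)
      exact (h1.sub h2).norm
    rw [← integral_abs_inner, ← integral_sub hi1 hi2]
    refine (abs_integral_le_integral_abs).trans ?_
    calc _ ≤ ∫ z, ‖u‖ * ‖idApprox (n + 1) N z - z‖ ∂ballMeas (n + 1) := by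
          refine integral_mono (hi1.sub hi2).abs (hi3.const_mul _) fun z => ?_
          refine (abs_abs_sub_abs_le_abs_sub _ _).trans ?_
          rw [← inner_sub_right]
          exact abs_real_inner_le_norm _ _
      _ ≤ _ := by
          rw [integral_const_mul]
          exact mul_le_mul_of_nonneg_left hN.le (norm_nonneg _)
  refine ⟨x, subset_of_supp_le (IsBody.closedBall 0 (by linarith)) (hX.add hZ) fun u => ?_,
    subset_of_supp_le (hX.add hZ) (IsBody.closedBall 0 (by linarith)) fun u => ?_⟩
  · rw [hs, supp_closedBall u (by linarith), le_inv_mul_iff₀ hc]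
    have := (abs_le.1 (hb u)).1
    nlinarith
  · rw [hs, supp_closedBall u (by linarith), inv_mul_le_iff₀ hc]
    have := (abs_le.1 (hb u)).2
    nlinarith

end BallApprox

section Steiner
open MeasureTheory Set Filter Topology
open scoped Nat

theorem vol_singleton_add {n : ℕ} (x : En n) (A : Set (En n)) : vol ({x} + A) = vol A := by
  rw [vol, singleton_add, image_add_left, measure_preimage_add, vol]

theorem IsBody.singleton {n : ℕ} (x : En n) : IsBody ({x} : Set (En n)) :=
  ⟨isCompact_singleton, convex_singleton _, singleton_nonempty _⟩

theorem IsBody.smul_subset {n : ℕ} {A : Set (En n)} (hA : IsBody A) (h0 : 0 ∈ A) {s t : ℝ}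
    (hs : 0 ≤ s) (hst : s ≤ t) : s • A ⊆ t • A := by
  rintro _ ⟨x, hx, rfl⟩
  rcases hs.eq_or_lt with rfl | hs
  · exact ⟨0, h0, by simp⟩
  refine ⟨(s / t) • x, hA.2.smul_mem_of_zero_mem h0 hx ⟨div_nonneg hs.le (hs.le.trans hst), ?_⟩, ?_⟩
  · rwa [div_le_one (hs.trans_le hst)]
  · have := hs.trans_le hst
    simp only [smul_smul]
    rw [mul_div_cancel₀ _ this.ne']

theorem IsBody.add_smul {n : ℕ} {A : Set (En n)} (hA : IsBody A) {s t : ℝ}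
    (hs : 0 ≤ s) (ht : 0 ≤ t) : (s + t) • A = s • A + t • A := hA.2.add_smul hs ht

/-- The signed sum extracting the coefficient `j` of a binary form from its values. -/
def polar (n j : ℕ) (F : ℕ → ℕ → ℝ) : ℝ :=
  (n ! : ℝ)⁻¹ * ∑ S : Finset (Fin n), (if S.Nonempty then (-1) ^ (n - S.card) *
    F (S.filter fun i : Fin n => (i : ℕ) < n - j).card
      (S.filter fun i : Fin n => ¬ (i : ℕ) < n - j).card else 0)

theorem polar_congr {n j : ℕ} {F G : ℕ → ℕ → ℝ} (h : ∀ s t, 0 < s + t → F s t = G s t) :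
    polar n j F = polar n j G := by
  unfold polar
  congr 1
  refine Finset.sum_congr rfl fun S _ => ?_
  split_ifs with hS
  · rw [h]
    rw [Finset.card_filter_add_card_filter_not]
    exact hS.card_pos
  · rfl

theorem tendsto_polar {n j : ℕ} {ι : Type*} {l : Filter ι} {F : ι → ℕ → ℕ → ℝ} {G : ℕ → ℕ → ℝ}
    (h : ∀ s t, Tendsto (fun i => F i s t) l (𝓝 (G s t))) :
    Tendsto (fun i => polar n j (F i)) l (𝓝 (polar n j G)) := by
  unfold polar
  refine Tendsto.const_mul _ (tendsto_finsetSum _ fun S _ => ?_)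
  split_ifs
  · exact (h _ _).const_mul _
  · exact tendsto_const_nhds

theorem polar_const_mul {n j : ℕ} (c : ℝ) (F : ℕ → ℕ → ℝ) :
    polar n j (fun s t => c * F s t) = c * polar n j F := by
  unfold polar
  rw [mul_left_comm, Finset.mul_sum _ _ c]
  congr 1
  refine Finset.sum_congr rfl fun S _ => ?_
  split_ifs <;> ring

theorem integral_polar {n j : ℕ} {α : Type*} [MeasurableSpace α] {μ : Measure α}
    {F : α → ℕ → ℕ → ℝ} (h : ∀ s t, Integrable (fun x => F x s t) μ) :
    ∫ x, polar n j (F x) ∂μ = polar n j fun s t => ∫ x, F x s t ∂μ := by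
  unfold polar
  rw [integral_const_mul, integral_finsetSum]
  · congr 1
    refine Finset.sum_congr rfl fun S _ => ?_
    split_ifs
    · rw [integral_const_mul]
    · simp
  · intro S _
    split_ifs
    · exact (h _ _).const_mul _
    · simp

theorem polar_eq {n : ℕ} (hn : 1 ≤ n) (a : ℕ → ℝ) {F : ℕ → ℕ → ℝ}
    (hF : ∀ s t : ℕ, F s t =
      ∑ m ∈ Finset.range (n + 1), n.choose m * a m * (s : ℝ) ^ (n - m) * (t : ℝ) ^ m)
    {j : ℕ} (hj : j ≤ n) : polar n j F = a j :=
  polarization_binary hn a F hF j hj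

/-- The quermassintegrals of a set. -/
def setQuer {n : ℕ} (j : ℕ) (L : Set (En n)) : ℝ :=
  polar n j fun s t => vol ((s : ℝ) • L + (t : ℝ) • Metric.closedBall (0 : En n) 1)

theorem setQuer_singleton_add {n : ℕ} (j : ℕ) (x : En n) (L : Set (En n)) :
    setQuer j ({x} + L) = setQuer j L := by
  unfold setQuer
  congr 1
  ext s t
  rw [smul_add, add_assoc, smul_set_singleton, vol_singleton_add]

theorem tendsto_vol_ballZon {n : ℕ} {L : Set (En (n + 1))} (hL : IsBody L) (h0 : 0 ∈ L) (s t : ℝ) :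
    Tendsto (fun N => vol (s • L + t • ballZon n N)) atTop
      (𝓝 (vol (s • L + t • Metric.closedBall 0 1))) := by
  set B : Set (En (n + 1)) := Metric.closedBall 0 1
  set V := vol (s • L + t • B)
  have hball : ∀ r : ℝ, 0 ≤ r → Metric.closedBall (0 : En (n + 1)) r = r • B := by
    intro r hr
    rw [smul_unitClosedBall, Real.norm_of_nonneg hr]
  have key : ∀ η : ℝ, 0 < η → η < 1 → ∀ᶠ N in atTop,
      (1 - η) ^ (n + 1) * V ≤ vol (s • L + t • ballZon n N) ∧
        vol (s • L + t • ballZon n N) ≤ (1 + η) ^ (n + 1) * V := by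
    intro η hη hη1
    filter_upwards [exists_ballZon_bounds n hη hη1] with N ⟨x, h1, h2⟩
    have hZ : IsBody (ballZon n N) := IsBody.sum fun _ _ => IsBody.segment _ _
    have e : vol (s • L + t • ({x} + ballZon n N)) = vol (s • L + t • ballZon n N) := by
      rw [smul_add, add_left_comm, smul_set_singleton, vol_singleton_add]
    rw [← e, ← vol_smul (by linarith), ← vol_smul (by linarith), smul_add (1 - η), smul_add (1 + η),
      smul_comm (1 - η) s, smul_comm (1 - η) t, smul_comm (1 + η) s, smul_comm (1 + η) t,
      ← hball _ (by linarith), ← hball _ (by linarith)]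
    have hL1 : (1 - η) • L ⊆ L := by
      simpa using hL.smul_subset h0 (s := 1 - η) (t := 1) (by linarith) (by linarith)
    have hL2 : L ⊆ (1 + η) • L := by
      simpa using hL.smul_subset h0 (s := 1) (t := 1 + η) (by linarith) (by linarith)
    constructor
    · refine vol_mono (add_subset_add (smul_set_mono hL1) (smul_set_mono h1)) ?_
      exact ((hL.smul s).add (((IsBody.singleton x).add hZ).smul t)).1
    · refine vol_mono (add_subset_add (smul_set_mono hL2) (smul_set_mono h2)) ?_
      exact (((hL.smul _).smul s).add ((IsBody.closedBall 0 (by linarith)).smul t)).1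
  have hp : ∀ᶠ η : ℝ in 𝓝[>] 0, 0 < η ∧ η < 1 := Ioo_mem_nhdsGT one_pos
  rw [tendsto_order]
  constructor
  · intro a ha
    have hc : Tendsto (fun η : ℝ => (1 - η) ^ (n + 1) * V) (𝓝[>] 0) (𝓝 V) := by
      have : Continuous fun η : ℝ => (1 - η) ^ (n + 1) * V := by fun_prop
      simpa using (this.tendsto 0).mono_left nhdsWithin_le_nhds
    obtain ⟨η, hη, h1, h2⟩ := ((hc.eventually_const_lt ha).and hp).exists
    filter_upwards [key η h1 h2] with N hN using hη.trans_le hN.1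
  · intro a ha
    have hc : Tendsto (fun η : ℝ => (1 + η) ^ (n + 1) * V) (𝓝[>] 0) (𝓝 V) := by
      have : Continuous fun η : ℝ => (1 + η) ^ (n + 1) * V := by fun_prop
      simpa using (this.tendsto 0).mono_left nhdsWithin_le_nhds
    obtain ⟨η, hη, h1, h2⟩ := ((hc.eventually_lt_const ha).and hp).exists
    filter_upwards [key η h1 h2] with N hN using hN.2.trans_lt hη

theorem exists_tendsto_setQuer {n : ℕ} {L : Set (En (n + 1))} (hL : IsBody L) (h0 : 0 ∈ L) :
    ∃ a : ℕ → ℕ → ℝ, (∀ j ≤ n + 1, Tendsto (fun N => a N j) atTop (𝓝 (setQuer j L))) ∧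
      (∀ N m, 0 ≤ a N m) ∧
      (∀ N m, 1 ≤ m → m + 1 ≤ n + 1 → a N (m - 1) * a N (m + 1) ≤ a N m ^ 2) ∧
      (∀ N, ∀ s t : ℝ, 0 ≤ s → 0 ≤ t → vol (s • L + t • ballZon n N) =
        ∑ m ∈ Finset.range (n + 1 + 1), (n + 1).choose m * a N m * s ^ (n + 1 - m) * t ^ m) ∧
      ∀ N, ((n + 1 : ℕ) : ℝ) * a N 1 = ∑ y : (idApprox (n + 1) N).range, segVol L
        ((2 / ballConst n * (ballMeas (n + 1)).real (idApprox (n + 1) N ⁻¹' {y.1})) • y.1) := by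
  have h := fun N => volume_expansion hL fun y : (idApprox (n + 1) N).range =>
    (2 / ballConst n * (ballMeas (n + 1)).real (idApprox (n + 1) N ⁻¹' {y.1})) • y.1
  choose a h1 h2 h3 h4 using h
  refine ⟨a, fun j hj => ?_, h1, h2, h3, h4⟩
  have := tendsto_polar (n := n + 1) (j := j) fun s t : ℕ =>
    tendsto_vol_ballZon hL h0 s t
  refine this.congr fun N => ?_
  exact polar_eq (Nat.le_add_left 1 n) (a N)
    (fun s t => h3 N s t s.cast_nonneg t.cast_nonneg) hj

theorem exists_zero_mem_translate {n : ℕ} {L : Set (En n)} (hL : IsBody L) :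
    ∃ x M, IsBody M ∧ 0 ∈ M ∧ L = {x} + M := by
  obtain ⟨x, hx⟩ := hL.3
  refine ⟨x, {-x} + L, (IsBody.singleton _).add hL, ?_, ?_⟩
  · exact ⟨-x, rfl, x, hx, by simp⟩
  · rw [← add_assoc]; simp

theorem setQuer_nonneg {n : ℕ} {L : Set (En (n + 1))} (hL : IsBody L) {j : ℕ} (hj : j ≤ n + 1) :
    0 ≤ setQuer j L := by
  obtain ⟨x, M, hM, h0, rfl⟩ := exists_zero_mem_translate hL
  obtain ⟨a, h1, h2, -⟩ := exists_tendsto_setQuer hM h0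
  rw [setQuer_singleton_add]
  exact ge_of_tendsto' (h1 j hj) fun N => h2 N j

theorem setQuer_logConcave {n : ℕ} {L : Set (En (n + 1))} (hL : IsBody L) {j : ℕ} (hj1 : 1 ≤ j)
    (hj : j ≤ n) : setQuer (j - 1) L * setQuer (j + 1) L ≤ setQuer j L ^ 2 := by
  obtain ⟨x, M, hM, h0, rfl⟩ := exists_zero_mem_translate hL
  obtain ⟨a, h1, h2, h3, -⟩ := exists_tendsto_setQuer hM h0
  simp only [setQuer_singleton_add]
  exact le_of_tendsto_of_tendsto' ((h1 _ (by omega)).mul (h1 _ (by omega)))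
    ((h1 _ (by omega)).pow 2) fun N => h3 N j hj1 (by omega)

theorem steiner {n : ℕ} {L : Set (En (n + 1))} (hL : IsBody L) {s t : ℝ} (hs : 0 ≤ s)
    (ht : 0 ≤ t) : vol (s • L + t • Metric.closedBall 0 1) =
      ∑ m ∈ Finset.range (n + 1 + 1), (n + 1).choose m * setQuer m L * s ^ (n + 1 - m) * t ^ m := by
  obtain ⟨x, M, hM, h0, rfl⟩ := exists_zero_mem_translate hL
  obtain ⟨a, h1, h2, h3, h4, -⟩ := exists_tendsto_setQuer hM h0
  simp only [setQuer_singleton_add]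
  rw [smul_add, add_assoc, smul_set_singleton, vol_singleton_add]
  refine tendsto_nhds_unique ((tendsto_vol_ballZon hM h0 s t).congr fun N => h4 N s t hs ht) ?_
  refine tendsto_finsetSum _ fun m hm => ?_
  have := h1 m (by rw [Finset.mem_range] at hm; omega)
  exact ((this.const_mul _).mul_const _).mul_const _

theorem segVol_smul {n : ℕ} {L : Set (En (n + 1))} (hL : IsBody L) {t : ℝ} (ht : 0 ≤ t)
    (v : En (n + 1)) : segVol L (t • v) = t * segVol L v := by
  rcases ht.eq_or_lt with rfl | h
  · simp [segVol_succ hL]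
  · rw [segVol_succ hL, segVol_succ hL, projE_smul h, norm_smul, Real.norm_of_nonneg ht, mul_assoc]

theorem vol_add_segment_le {n : ℕ} {L : Set (En n)} (hL : IsBody L) {x : En n} {r : ℝ}
    (hr : 0 < r) (hx : Metric.closedBall x r ⊆ L) (v w : En n) :
    vol (L + segment ℝ 0 v) ≤ (1 + ‖v - w‖ / r) ^ n * vol (L + segment ℝ 0 w) := by
  set δ := ‖v - w‖ / r with hδ
  have hδ0 : 0 ≤ δ := by positivity
  rw [← vol_smul (by positivity), ← vol_singleton_add (-(δ • x)) ((1 + δ) • _)]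
  refine vol_mono ?_ ((IsBody.singleton _).add ((hL.add (IsBody.segment 0 w)).smul _)).1
  rintro _ ⟨y, hy, z, hz, rfl⟩
  rw [segment_eq_image] at hz
  obtain ⟨θ, hθ, rfl⟩ := hz
  refine ⟨_, rfl, (y + δ • x + θ • (v - w)) + θ • w, ?_, ?_⟩
  · rw [smul_add, hL.add_smul zero_le_one hδ0, one_smul]
    refine add_mem_add ?_ ((IsBody.segment 0 w).smul_subset (left_mem_segment ℝ _ _)
      zero_le_one (by linarith) ?_)
    · rw [add_assoc]
      refine add_mem_add hy ?_
      rcases hδ0.eq_or_lt with h | h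
      · rw [← h]
        have : v - w = 0 := by
          rw [hδ, eq_comm, div_eq_zero_iff] at h
          exact norm_eq_zero.1 (h.resolve_right hr.ne')
        rw [this]
        exact ⟨x, hx (Metric.mem_closedBall_self hr.le), by simp⟩
      · refine ⟨x + (θ / δ) • (v - w), hx ?_, ?_⟩
        · rw [Metric.mem_closedBall, dist_eq_norm, add_sub_cancel_left, norm_smul,
            Real.norm_of_nonneg (div_nonneg hθ.1 hδ0), div_mul_eq_mul_div, div_le_iff₀ h, hδ,
            mul_div_cancel₀ _ hr.ne']
          nlinarith [hθ.2, norm_nonneg (v - w)]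
        · simp only [smul_add, smul_smul]
          rw [mul_div_cancel₀ _ h.ne']
    · rw [one_smul, segment_eq_image]
      exact ⟨θ, hθ, by simp⟩
  · simp only [smul_zero, zero_add, smul_sub]
    abel

theorem continuous_segVol {n : ℕ} {L : Set (En n)} (hL : IsBody L) (hi : (interior L).Nonempty) :
    Continuous (segVol L) := by
  obtain ⟨x, hx⟩ := hi
  obtain ⟨r, hr, hxr⟩ := Metric.nhds_basis_closedBall.mem_iff.1 (mem_interior_iff_mem_nhds.1 hx)
  unfold segVol
  refine Continuous.sub ?_ continuous_const
  rw [continuous_iff_continuousAt]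
  intro w
  have h1 : Continuous fun v => (1 + ‖v - w‖ / r) ^ n := by fun_prop
  have h1' : ∀ v, 0 < (1 + ‖v - w‖ / r) ^ n := fun v => by positivity
  refine tendsto_of_tendsto_of_tendsto_of_le_of_le
    (g := fun v => vol (L + segment ℝ 0 w) / (1 + ‖v - w‖ / r) ^ n)
    (h := fun v => (1 + ‖v - w‖ / r) ^ n * vol (L + segment ℝ 0 w)) ?_ ?_ ?_ ?_
  · have : Continuous fun v => vol (L + segment ℝ 0 w) / (1 + ‖v - w‖ / r) ^ n :=
      continuous_const.div h1 fun v => (h1' v).ne'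
    simpa using this.tendsto w
  · simpa using (h1.mul_const (vol (L + segment ℝ 0 w))).tendsto w
  · intro v
    simp only
    rw [div_le_iff₀ (h1' v), mul_comm, norm_sub_rev]
    exact vol_add_segment_le hL hr hxr w v
  · intro v
    exact vol_add_segment_le hL hr hxr v w

theorem segVol_singleton_add {n : ℕ} (x : En n) (L : Set (En n)) (v : En n) :
    segVol ({x} + L) v = segVol L v := by
  rw [segVol, add_assoc, vol_singleton_add, vol_singleton_add, segVol]

/-- Cauchy's surface area formula. -/
theorem cauchy_formula {n : ℕ} {L : Set (En (n + 1))} (hL : IsBody L)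
    (hi : (interior L).Nonempty) :
    ((n + 1 : ℕ) : ℝ) * setQuer 1 L = 2 / ballConst n * ∫ x, segVol L x ∂ballMeas (n + 1) := by
  have hc := continuous_segVol hL hi
  obtain ⟨x, M, hM, h0, rfl⟩ := exists_zero_mem_translate hL
  rw [show segVol ({x} + M) = segVol M from funext fun v => segVol_singleton_add x M v] at *
  obtain ⟨a, h1, -, -, -, h5⟩ := exists_tendsto_setQuer hM h0
  rw [setQuer_singleton_add]
  refine tendsto_nhds_unique (((h1 1 (by omega)).const_mul _).congr fun N => h5 N) ?_
  refine ((tendsto_sum_idApprox hc).const_mul _).congr fun N => ?_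
  rw [Finset.mul_sum, ← Finset.sum_coe_sort (idApprox (n + 1) N).range]
  refine Finset.sum_congr rfl fun y _ => ?_
  have := ballConst_pos n
  rw [segVol_smul hM (mul_nonneg (by positivity) measureReal_nonneg), mul_assoc]

end Steiner

section Quer
open MeasureTheory Set Filter Topology

/-- The volume of the unit ball. -/
def ballVol (n : ℕ) : ℝ := vol (Metric.closedBall (0 : En n) 1)

theorem ballVol_pos (n : ℕ) : 0 < ballVol n :=
  ENNReal.toReal_pos (Metric.measure_closedBall_pos _ _ one_pos).ne'
    (isCompact_closedBall _ _).measure_lt_top.ne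

theorem vol_pos {n : ℕ} {L : Set (En n)} (hL : IsBody L) (hi : (interior L).Nonempty) :
    0 < vol L :=
  ENNReal.toReal_pos (Measure.measure_pos_of_nonempty_interior _ hi).ne' hL.1.measure_lt_top.ne

theorem isBody_unitBall (n : ℕ) : IsBody (Metric.closedBall (0 : En n) 1) :=
  IsBody.closedBall 0 zero_le_one

theorem closedBall_eq {n : ℕ} (c : En n) {r : ℝ} (hr : 0 ≤ r) :
    Metric.closedBall c r = {c} + r • Metric.closedBall (0 : En n) 1 := by
  rw [smul_unitClosedBall, Real.norm_of_nonneg hr, singleton_add_closedBall, add_zero]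

theorem setQuer_zero {n : ℕ} {L : Set (En (n + 1))} (hL : IsBody L) : setQuer 0 L = vol L := by
  have := steiner hL zero_le_one le_rfl
  rw [Finset.sum_eq_single 0 (fun m _ hm => by simp [hm]) (by simp), one_smul,
    zero_smul_set (isBody_unitBall _).3, add_zero] at this
  simpa using this.symm

theorem setQuer_top {n : ℕ} {L : Set (En (n + 1))} (hL : IsBody L) :
    setQuer (n + 1) L = ballVol (n + 1) := by
  have := steiner hL le_rfl zero_le_one
  rw [Finset.sum_eq_single (n + 1) (fun m hm hm' => by
    have : n + 1 - m ≠ 0 := by rw [Finset.mem_range] at hm; omega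
    simp [this]) (by simp), one_smul, zero_smul_set hL.3, zero_add] at this
  simpa [ballVol] using this.symm

theorem setQuer_closedBall {n : ℕ} (c : En (n + 1)) {r : ℝ} (hr : 0 ≤ r) {j : ℕ}
    (hj : j ≤ n + 1) :
    setQuer j (Metric.closedBall c r) = r ^ (n + 1 - j) * ballVol (n + 1) := by
  rw [closedBall_eq c hr, setQuer_singleton_add]
  refine polar_eq (Nat.le_add_left 1 n) (fun j => r ^ (n + 1 - j) * ballVol (n + 1))
    (fun s t => ?_) hj
  rw [smul_smul, ← (isBody_unitBall _).add_smul (by positivity) (by positivity),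
    vol_smul (by positivity), add_comm, add_pow, Finset.sum_mul]
  refine Finset.sum_congr rfl fun m _ => ?_
  rw [mul_pow, ballVol]
  ring

theorem setQuer_one_add_ball {n : ℕ} {L : Set (En (n + 1))} (hL : IsBody L) {s t : ℝ} (hs : 0 ≤ s)
    (ht : 0 ≤ t) : setQuer 1 (s • L + t • Metric.closedBall 0 1) =
      ∑ m ∈ Finset.range (n + 1), n.choose m * setQuer (m + 1) L * s ^ (n - m) * t ^ m := by
  set B : Set (En (n + 1)) := Metric.closedBall 0 1 with hB'
  have hB : IsBody B := isBody_unitBall _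
  have hM : IsBody (s • L + t • B) := (hL.smul s).add (hB.smul t)
  have heq : ∀ y ∈ Ici (0 : ℝ), (∑ m ∈ Finset.range (n + 1 + 1),
        (n + 1).choose m * setQuer m (s • L + t • B) * y ^ m) =
      ∑ m ∈ Finset.range (n + 1 + 1), (n + 1).choose m * setQuer m L * s ^ (n + 1 - m) *
        (t + y) ^ m := by
    intro y hy
    rw [← steiner hL hs (add_nonneg ht hy), hB.add_smul ht hy, ← add_assoc]
    have := steiner hM zero_le_one hy
    rw [one_smul] at this
    rw [this]
    simp
  have h1 : HasDerivAt (fun y : ℝ => ∑ m ∈ Finset.range (n + 1 + 1),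
        (n + 1).choose m * setQuer m (s • L + t • B) * y ^ m)
      (∑ m ∈ Finset.range (n + 1 + 1), (n + 1).choose m * setQuer m (s • L + t • B) *
        (m * 0 ^ (m - 1))) 0 :=
    HasDerivAt.fun_sum fun m _ => (hasDerivAt_pow m 0).const_mul _
  have h2 : HasDerivAt (fun y : ℝ => ∑ m ∈ Finset.range (n + 1 + 1),
        (n + 1).choose m * setQuer m L * s ^ (n + 1 - m) * (t + y) ^ m)
      (∑ m ∈ Finset.range (n + 1 + 1), (n + 1).choose m * setQuer m L * s ^ (n + 1 - m) *
        (m * (t + 0) ^ (m - 1) * 1)) 0 :=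
    HasDerivAt.fun_sum fun m _ => (((hasDerivAt_id' (0 : ℝ)).const_add t).fun_pow m).const_mul _
  have h3 := (uniqueDiffWithinAt_Ici (0 : ℝ)).eq_deriv _ (h1.hasDerivWithinAt (s := Ici 0))
    (h2.hasDerivWithinAt.congr heq (heq 0 (mem_Ici.2 le_rfl)))
  rw [Finset.sum_eq_single 1 (fun m _ hm => by
    rcases m with _ | m
    · simp
    · have : m ≠ 0 := fun h => hm (by simp [h])
      simp [this]) (by simp), Finset.sum_range_succ'] at h3
  have hn : ((n + 1 : ℕ) : ℝ) ≠ 0 := by positivity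
  refine mul_left_cancel₀ hn ?_
  rw [Finset.mul_sum]
  simp only [Nat.choose_one_right, Nat.cast_one, tsub_self, pow_zero, mul_one,
    Nat.cast_zero, zero_mul, mul_zero, add_zero] at h3
  rw [h3]
  refine Finset.sum_congr rfl fun m _ => ?_
  have hch : ((n + 1 : ℕ) : ℝ) * n.choose m = (n + 1).choose (m + 1) * ((m + 1 : ℕ) : ℝ) := by
    exact_mod_cast Nat.add_one_mul_choose_eq n m
  rw [Nat.add_sub_cancel, Nat.add_sub_add_right]
  linear_combination (-(setQuer (m + 1) L * s ^ (n - m) * t ^ m)) * hch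

theorem projE_image_add_ball {n : ℕ} (L : Set (En (n + 1))) (v : En (n + 1)) (s t : ℝ) :
    projE v '' (s • L + t • Metric.closedBall 0 1) =
      s • projE v '' L + t • Metric.closedBall 0 1 := by
  rw [image_add, image_smul_set, image_smul_set, projE_image_closedBall]

theorem setQuer_projE {n : ℕ} {L : Set (En (n + 1))} (hL : IsBody L) (v : En (n + 1)) (m : ℕ) :
    ‖v‖ * setQuer m (projE v '' L) = polar n m fun s t =>
      segVol ((s : ℝ) • L + (t : ℝ) • Metric.closedBall 0 1) v := by
  rw [setQuer, ← polar_const_mul]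
  congr 1
  ext s t
  rw [segVol_succ ((hL.smul _).add ((isBody_unitBall _).smul _)), projE_image_add_ball]

theorem interior_smul_add_ball {n : ℕ} {L : Set (En n)} (hL : IsBody L)
    (hi : (interior L).Nonempty) {s t : ℕ} (hst : 0 < s + t) :
    (interior ((s : ℝ) • L + (t : ℝ) • Metric.closedBall (0 : En n) 1)).Nonempty := by
  rcases Nat.eq_zero_or_pos s with rfl | hs
  · have ht : (t : ℝ) ≠ 0 := Nat.cast_ne_zero.2 (by omega)
    have : (interior ((t : ℝ) • Metric.closedBall (0 : En n) 1)).Nonempty := by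
      rw [interior_smul₀ ht]
      exact Nonempty.smul_set ⟨0, Metric.ball_subset_interior_closedBall (by simp)⟩
    exact ((hL.smul _).3.add this).mono subset_interior_add_right
  · have hs : (s : ℝ) ≠ 0 := Nat.cast_ne_zero.2 (by omega)
    have : (interior ((s : ℝ) • L)).Nonempty := by
      rw [interior_smul₀ hs]
      exact hi.smul_set
    exact (this.add ((isBody_unitBall _).smul _).3).mono subset_interior_add_left

theorem continuous_segVol_smul_add_ball {n : ℕ} {L : Set (En (n + 1))} (hL : IsBody L)
    (hi : (interior L).Nonempty) (s t : ℕ) :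
    Continuous (segVol ((s : ℝ) • L + (t : ℝ) • Metric.closedBall (0 : En (n + 1)) 1)) := by
  rcases Nat.eq_zero_or_pos (s + t) with h | h
  · obtain ⟨rfl, rfl⟩ := Nat.add_eq_zero_iff.1 h
    rw [Nat.cast_zero, zero_smul_set hL.3, zero_smul_set (isBody_unitBall _).3, add_zero]
    have : segVol (0 : Set (En (n + 1))) = fun v => ‖v‖ * vol (0 : Set (En n)) := by
      ext v
      rw [segVol_succ IsBody.zero]
      congr 2
      exact (image_singleton).trans (by rw [map_zero]; rfl)
    rw [this]
    fun_prop
  · exact continuous_segVol ((hL.smul _).add ((isBody_unitBall _).smul _))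
      (interior_smul_add_ball hL hi h)

theorem continuous_setQuer_projE {n : ℕ} {L : Set (En (n + 1))} (hL : IsBody L)
    (hi : (interior L).Nonempty) (m : ℕ) :
    Continuous fun v => ‖v‖ * setQuer m (projE v '' L) := by
  simp_rw [setQuer_projE hL]
  exact continuous_iff_continuousAt.2 fun v => tendsto_polar fun s t =>
    (continuous_segVol_smul_add_ball hL hi s t).tendsto v

/-- Kubota's recursion. -/
theorem kubota {n : ℕ} {L : Set (En (n + 2))} (hL : IsBody L) (hi : (interior L).Nonempty)
    {m : ℕ} (hm : m ≤ n + 1) :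
    ((n + 2 : ℕ) : ℝ) * setQuer (m + 1) L = 2 / ballConst (n + 1) *
      ∫ x, ‖x‖ * setQuer m (projE x '' L) ∂ballMeas (n + 2) := by
  simp_rw [setQuer_projE hL]
  rw [integral_polar fun s t => (continuous_segVol_smul_add_ball hL hi s t).integrable_ballMeas,
    ← polar_const_mul]
  rw [← polar_eq (Nat.le_add_left 1 n) (fun m => setQuer (m + 1) L) (fun s t =>
    setQuer_one_add_ball hL (s := s) (t := t) s.cast_nonneg t.cast_nonneg) hm, ← polar_const_mul]
  refine polar_congr fun s t hst => ?_
  exact cauchy_formula ((hL.smul _).add ((isBody_unitBall _).smul _))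
    (interior_smul_add_ball hL hi hst)

theorem setQuer_add_segment {n : ℕ} {L : Set (En (n + 2))} (hL : IsBody L) (v : En (n + 2))
    {ε : ℝ} (hε : 0 ≤ ε) {m : ℕ} (hm : m ≤ n + 2) :
    setQuer m (L + ε • segment ℝ 0 v) = setQuer m L +
      ε * ‖v‖ * ((n + 2 - m : ℕ) / (n + 2 : ℕ)) * setQuer m (projE v '' L) := by
  refine polar_eq (n := n + 2) (by omega) (fun m => setQuer m L +
      ε * ‖v‖ * ((n + 2 - m : ℕ) / (n + 2 : ℕ)) * setQuer m (projE v '' L)) (fun s t => ?_) hm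
  have hs : (0 : ℝ) ≤ s := s.cast_nonneg
  have ht : (0 : ℝ) ≤ t := t.cast_nonneg
  rw [smul_add, add_right_comm, smul_smul,
    vol_add_smul_segment ((hL.smul _).add ((isBody_unitBall _).smul _)) v (mul_nonneg hs hε),
    projE_image_add_ball, steiner hL hs ht, steiner (hL.image (projE v)) hs ht]
  rw [eq_comm, ← sub_eq_iff_eq_add', ← Finset.sum_sub_distrib, Finset.sum_range_succ,
    Finset.mul_sum,
    Finset.mul_sum]
  rw [Nat.sub_self]
  simp only [Nat.cast_zero, zero_div, mul_zero, zero_mul, add_zero, sub_self]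
  refine Finset.sum_congr rfl fun k hk => ?_
  rw [Finset.mem_range] at hk
  have hch : (((n + 1).choose k : ℕ) : ℝ) * ((n + 2 : ℕ) : ℝ) =
      (n + 2).choose k * ((n + 2 - k : ℕ) : ℝ) := by
    exact_mod_cast Nat.choose_mul_succ_eq (n + 1) k
  have hn : ((n + 2 : ℕ) : ℝ) ≠ 0 := by positivity
  have hch' : (((n + 1).choose k : ℕ) : ℝ) =
      (n + 2).choose k * (((n + 2 - k : ℕ) : ℝ) / ((n + 2 : ℕ) : ℝ)) := by
    rw [← mul_div_assoc, eq_div_iff hn, hch]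
  have hp : (s : ℝ) ^ (n + 2 - k) = s ^ (n + 1 - k) * s := by
    rw [← pow_succ]; congr 1; omega
  change _ - (n + 2).choose k * setQuer k L * (s : ℝ) ^ (n + 2 - k) * (t : ℝ) ^ k = _
  rw [hp, hch']
  ring

end Quer

section QuerIneq
open MeasureTheory Set Filter Topology

theorem interior_projE_image {n : ℕ} {L : Set (En (n + 1))} (hi : (interior L).Nonempty)
    (v : En (n + 1)) : (interior (projE v '' L)).Nonempty :=
  (hi.image _).mono (((projE v).isOpenMap (projE_surjective v)).image_interior_subset L)

theorem eq_on_ball_of_integral_eq {n : ℕ} {f g : En n → ℝ} (hf : Continuous f) (hg : Continuous g)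
    (hfg : ∀ x, f x ≤ g x) (h : ∫ x, f x ∂ballMeas n = ∫ x, g x ∂ballMeas n) :
    EqOn f g (Metric.ball 0 1) := by
  have h0 : ∫ x, (g x - f x) ∂ballMeas n = 0 := by
    rw [integral_sub hg.integrable_ballMeas hf.integrable_ballMeas, h, sub_self]
  rw [integral_eq_zero_iff_of_nonneg (fun x => sub_nonneg.2 (hfg x))
    (hg.sub hf).integrable_ballMeas] at h0
  have h1 : ∀ᵐ x ∂volume.restrict (Metric.ball (0 : En n) 1), f x = g x := by
    refine (ae_restrict_of_ae_restrict_of_subset Metric.ball_subset_closedBall h0).mono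
      fun x hx => ?_
    exact (sub_eq_zero.1 hx).symm
  exact Measure.eqOn_open_of_ae_eq h1 Metric.isOpen_ball hf.continuousOn hg.continuousOn

theorem setQuer_pos {n : ℕ} {L : Set (En (n + 1))} (hL : IsBody L) (hi : (interior L).Nonempty)
    {j : ℕ} (hj : j ≤ n + 1) : 0 < setQuer j L := by
  induction n generalizing j with
  | zero =>
    rcases Nat.le_one_iff_eq_zero_or_eq_one.1 hj with rfl | rfl
    · rw [setQuer_zero hL]; exact vol_pos hL hi
    · rw [setQuer_top hL]; exact ballVol_pos _
  | succ n ih =>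
    rcases j with _ | m
    · rw [setQuer_zero hL]; exact vol_pos hL hi
    · have hp : ∀ x, 0 < setQuer m (projE x '' L) := fun x =>
        ih (hL.image _) (interior_projE_image hi x) (by omega)
      have hnn : ∀ x : En (n + 2), 0 ≤ ‖x‖ * setQuer m (projE x '' L) := fun x =>
        mul_nonneg (norm_nonneg _) (hp x).le
      have hc := continuous_setQuer_projE hL hi m
      have hI : 0 < ∫ x, ‖x‖ * setQuer m (projE x '' L) ∂ballMeas (n + 2) := by
        refine lt_of_le_of_ne (integral_nonneg hnn) fun h => ?_
        have := eq_on_ball_of_integral_eq (f := fun _ => 0)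
          continuous_const hc hnn (by simpa using h)
        have h1 : EuclideanSpace.single 0 (1 / 2) ∈ Metric.ball (0 : En (n + 2)) 1 := by
          rw [mem_ball_zero_iff, PiLp.norm_single]; norm_num
        have h2 := this h1
        simp only [PiLp.norm_single] at h2
        have := hp (EuclideanSpace.single 0 (1 / 2))
        rw [eq_comm, mul_eq_zero] at h2
        rcases h2 with h2 | h2
        · norm_num at h2
        · exact this.ne' h2
      have hk := kubota hL hi (m := m) (by omega)
      have hb := ballConst_pos (n + 1)
      have : 0 < ((n + 2 : ℕ) : ℝ) * setQuer (m + 1) L := by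
        rw [hk]; positivity
      exact pos_of_mul_pos_right this (by positivity)

theorem tendsto_setQuer_add_ball {n : ℕ} {L : Set (En (n + 1))} (hL : IsBody L) (j : ℕ) :
    Tendsto (fun ε : ℝ => setQuer j (L + ε • Metric.closedBall 0 1)) (𝓝[>] 0)
      (𝓝 (setQuer j L)) := by
  refine tendsto_polar fun s t => ?_
  have hc : Continuous fun ε : ℝ => ∑ m ∈ Finset.range (n + 1 + 1),
      (n + 1).choose m * setQuer m L * (s : ℝ) ^ (n + 1 - m) * (s * ε + t : ℝ) ^ m := by fun_prop
  have h1 := (hc.tendsto 0).mono_left (nhdsWithin_le_nhds (s := Ioi 0))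
  rw [mul_zero, zero_add, ← steiner hL s.cast_nonneg t.cast_nonneg] at h1
  refine h1.congr' ?_
  filter_upwards [self_mem_nhdsWithin] with ε hε
  have hε' : (0 : ℝ) ≤ s * ε := mul_nonneg s.cast_nonneg (le_of_lt hε)
  rw [← steiner hL s.cast_nonneg (add_nonneg hε' t.cast_nonneg),
    (isBody_unitBall _).add_smul hε' t.cast_nonneg, smul_add, smul_smul, add_assoc]

theorem logConcave_chain {a : ℕ → ℝ} {k : ℕ} (hpos : ∀ j ≤ k + 2, 0 < a j)
    (hlc : ∀ j, 1 ≤ j → j ≤ k + 1 → a (j + 1) * a (j - 1) ≤ a j ^ 2) :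
    a 0 ^ (k + 1) * a (k + 2) ≤ a 2 * a 0 * a 1 ^ k := by
  have h1 : ∀ m ≤ k + 1, a (m + 1) * a 0 ≤ a m * a 1 := by
    intro m hm
    induction m with
    | zero => rw [mul_comm]
    | succ m ih =>
      have h2 := ih (by omega)
      have h3 := hlc (m + 1) (by omega) hm
      rw [Nat.add_sub_cancel] at h3
      refine le_of_mul_le_mul_left ?_ (hpos m (by omega))
      nlinarith [mul_le_mul_of_nonneg_right h3 (hpos 0 (by omega)).le,
        mul_le_mul_of_nonneg_left h2 (hpos (m + 1) (by omega)).le]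
  have h2 : ∀ m ≤ k, a 0 ^ (m + 1) * a (m + 2) ≤ a 2 * a 0 * a 1 ^ m := by
    intro m hm
    induction m with
    | zero => simp [mul_comm]
    | succ m ih =>
      calc a 0 ^ (m + 1 + 1) * a (m + 1 + 2) = a 0 ^ (m + 1) * (a (m + 2 + 1) * a 0) := by ring_nf
        _ ≤ a 0 ^ (m + 1) * (a (m + 2) * a 1) :=
          mul_le_mul_of_nonneg_left (h1 _ (by omega)) (pow_nonneg (hpos 0 (by omega)).le _)
        _ = (a 0 ^ (m + 1) * a (m + 2)) * a 1 := by ring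
        _ ≤ a 2 * a 0 * a 1 ^ m * a 1 :=
          mul_le_mul_of_nonneg_right (ih (by omega)) (hpos 1 (by omega)).le
        _ = _ := by ring
  exact h2 k le_rfl

theorem setQuer_chain {n : ℕ} {L : Set (En (n + 2))} (hL : IsBody L) (hi : (interior L).Nonempty)
    {k : ℕ} (hk : k ≤ n) : ballVol (n + 2) ^ (k + 1) * setQuer (n - k) L ≤
      setQuer n L * ballVol (n + 2) * setQuer (n + 1) L ^ k := by
  have := logConcave_chain (a := fun j => setQuer (n + 2 - j) L) (k := k)
    (fun j _ => setQuer_pos hL hi (by omega)) fun j hj1 hj => by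
      have := setQuer_logConcave hL (j := n + 2 - j) (by omega) (by omega)
      rwa [show n + 2 - j - 1 = n + 2 - (j + 1) by omega,
        show n + 2 - j + 1 = n + 2 - (j - 1) by omega] at this
  rw [← setQuer_top hL, show n - k = n + 2 - (k + 2) by omega]
  exact this

theorem setQuer_sq_le {n : ℕ} {L : Set (En (n + 2))} (hL : IsBody L) :
    setQuer n L * ballVol (n + 2) ≤ setQuer (n + 1) L ^ 2 := by
  have := setQuer_logConcave hL (j := n + 1) (by omega) le_rfl
  rwa [setQuer_top hL] at this

/-- The Aleksandrov–Fenchel type inequality between quermassintegrals. -/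
theorem setQuer_pow_le {n : ℕ} {L : Set (En (n + 2))} (hL : IsBody L) {k : ℕ} (hk : k ≤ n) :
    ballVol (n + 2) ^ (k + 1) * setQuer (n - k) L ≤ setQuer (n + 1) L ^ (k + 2) := by
  refine le_of_tendsto_of_tendsto ((tendsto_setQuer_add_ball hL _).const_mul _)
    ((tendsto_setQuer_add_ball hL _).pow _) ?_
  filter_upwards [self_mem_nhdsWithin] with ε hε
  have hε : 0 < ε := hε
  have hM : IsBody (L + ε • Metric.closedBall 0 1) := hL.add ((isBody_unitBall _).smul _)
  have hB : (interior (ε • Metric.closedBall (0 : En (n + 2)) 1)).Nonempty := by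
    rw [interior_smul₀ hε.ne']
    exact Nonempty.smul_set ⟨0, Metric.ball_subset_interior_closedBall (by simp)⟩
  have hi : (interior (L + ε • Metric.closedBall 0 1)).Nonempty :=
    (hL.3.add hB).mono subset_interior_add_right
  refine (setQuer_chain hM hi hk).trans ?_
  rw [add_comm k 2, pow_add]
  exact mul_le_mul_of_nonneg_right (setQuer_sq_le hM)
    (pow_nonneg (setQuer_nonneg hM (by omega)) _)

theorem setQuer_sq_eq {n : ℕ} {L : Set (En (n + 2))} (hL : IsBody L) (hi : (interior L).Nonempty)
    {k : ℕ} (hk : k ≤ n)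
    (h : ballVol (n + 2) ^ (k + 1) * setQuer (n - k) L = setQuer (n + 1) L ^ (k + 2)) :
    setQuer n L * ballVol (n + 2) = setQuer (n + 1) L ^ 2 := by
  refine (setQuer_sq_le hL).antisymm ?_
  have h1 := setQuer_chain hL hi hk
  rw [h, add_comm k 2, pow_add] at h1
  exact le_of_mul_le_mul_right h1 (pow_pos (setQuer_pos hL hi (by omega)) _)

/-- The projections of a body with extremal quermassintegrals are extremal as well. -/
theorem setQuer_projE_eq {n : ℕ} {L : Set (En (n + 2))} (hL : IsBody L)
    (hi : (interior L).Nonempty) {w : ℝ} (h1 : setQuer (n + 1) L = w * ballVol (n + 2))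
    (h2 : setQuer n L = w ^ 2 * ballVol (n + 2)) {v : En (n + 2)} (hv : v ≠ 0) :
    setQuer n (projE v '' L) = w * ballVol (n + 1) ∧
      ∀ m, n = m + 1 → setQuer m (projE v '' L) = w ^ 2 * ballVol (n + 1) := by
  have hk := ballVol_pos (n + 2)
  have hk' := ballVol_pos (n + 1)
  have hle : ∀ v : En (n + 2), ‖v‖ * setQuer n (projE v '' L) ≤ ‖v‖ * (w * ballVol (n + 1)) := by
    intro v
    rcases eq_or_ne v 0 with rfl | hv
    · simp
    refine mul_le_mul_of_nonneg_left ?_ (norm_nonneg _)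
    have hv' : 0 < ‖v‖ := norm_pos_iff.2 hv
    by_contra! hlt
    set q := setQuer n (projE v '' L)
    set κ := ballVol (n + 2)
    set κ' := ballVol (n + 1)
    have hδ : 0 < κ * (q - w * κ') := mul_pos hk (sub_pos.2 hlt)
    set e := κ * (q - w * κ') / κ' ^ 2 with he
    have he0 : 0 < e := by positivity
    have hN : (0 : ℝ) < (n + 2 : ℕ) := by positivity
    have hε : 0 ≤ e * (n + 2 : ℕ) / ‖v‖ := by positivity
    have hM : IsBody (L + (e * (n + 2 : ℕ) / ‖v‖) • segment ℝ 0 v) :=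
      hL.add ((IsBody.segment _ _).smul _)
    have := setQuer_sq_le hM
    rw [setQuer_add_segment hL v hε (by omega), setQuer_add_segment hL v hε (by omega), h1, h2,
      show n + 2 - n = 2 by omega, show n + 2 - (n + 1) = 1 by omega,
      setQuer_top (hL.image _)] at this
    have e1 : ∀ c : ℝ, e * (n + 2 : ℕ) / ‖v‖ * ‖v‖ * (c / (n + 2 : ℕ)) = e * c := by
      intro c; field_simp
    rw [e1, e1] at this
    push_cast at this
    change (w ^ 2 * κ + e * 2 * q) * κ ≤ (w * κ + e * 1 * κ') ^ 2 at this
    have e2 : e * κ' ^ 2 = κ * (q - w * κ') := by rw [he]; field_simp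
    nlinarith [mul_pos he0 hδ]
  have hcomp : ∀ {m c : _}, m ≤ n + 1 → setQuer (m + 1) L = c * ballVol (n + 2) →
      ∫ x, ‖x‖ * setQuer m (projE x '' L) ∂ballMeas (n + 2) =
        ∫ x, ‖x‖ * (c * ballVol (n + 1)) ∂ballMeas (n + 2) := by
    intro m c hm hc
    have e1 := kubota hL hi hm
    have e2 := kubota hL hi le_rfl
    rw [setQuer_top hL] at e2
    simp_rw [setQuer_top (hL.image (projE _))] at e2
    have hb := ballConst_pos (n + 1)
    have hb' : 2 / ballConst (n + 1) ≠ 0 := by positivity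
    refine mul_left_cancel₀ hb' ?_
    simp_rw [mul_left_comm _ c]
    rw [← e1, hc, integral_const_mul, mul_left_comm (2 / ballConst (n + 1)) c, ← e2]
    ring
  have hcn : ∀ c : ℝ, Continuous fun x : En (n + 2) => ‖x‖ * c := fun c => by fun_prop
  have key : ∀ {m c : _}, m ≤ n + 1 → setQuer (m + 1) L = c * ballVol (n + 2) →
      (∀ v : En (n + 2), ‖v‖ * setQuer m (projE v '' L) ≤ ‖v‖ * (c * ballVol (n + 1))) →
      ∀ v ≠ 0, setQuer m (projE v '' L) = c * ballVol (n + 1) := by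
    intro m c hm hc hle v hv
    have hv0 : 0 < ‖v‖ := norm_pos_iff.2 hv
    set v' : En (n + 2) := (2 * ‖v‖)⁻¹ • v
    have hnv : ‖v'‖ = 1 / 2 := by
      rw [norm_smul, Real.norm_of_nonneg (by positivity)]; field_simp
    have hv'1 : v' ∈ Metric.ball (0 : En (n + 2)) 1 := by
      rw [mem_ball_zero_iff, hnv]; norm_num
    have hp : projE v' = projE v := projE_smul (inv_pos.2 (by positivity)) v
    have := eq_on_ball_of_integral_eq (continuous_setQuer_projE hL hi m) (hcn _) hle (hcomp hm hc)
      hv'1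
    simp only [hnv, hp] at this
    linarith
  have hfst := key (by omega) h1 hle
  refine ⟨hfst v hv, ?_⟩
  rintro m rfl
  refine key (by omega) h2 (fun x => ?_) v hv
  rcases eq_or_ne x 0 with rfl | hx
  · simp
  · refine mul_le_mul_of_nonneg_left ?_ (norm_nonneg _)
    have := setQuer_sq_le (hL.image (projE x))
    rw [hfst x hx] at this
    refine le_of_mul_le_mul_right (this.trans_eq ?_) hk'
    ring

end QuerIneq

section Planar
open MeasureTheory Set Filter Topology

/-- The length of the vertical slice of a planar set. -/
def sliceLen (A : Set (ℝ × ℝ)) (τ : ℝ) : ℝ := volume.real {y : ℝ | (τ, y) ∈ A}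

theorem sliceLen_nonneg (A : Set (ℝ × ℝ)) (τ : ℝ) : 0 ≤ sliceLen A τ := measureReal_nonneg

theorem isCompact_vertSlice {A : Set (ℝ × ℝ)} (hA : IsCompact A) (τ : ℝ) :
    IsCompact {y : ℝ | (τ, y) ∈ A} :=
  (Topology.IsClosedEmbedding.of_continuous_injective_isClosedMap (by fun_prop)
    (fun _ _ h => (Prod.mk.inj h).2) (isClosedMap_prodMk_left τ)).isCompact_preimage hA

theorem sliceLen_eq_zero {A : Set (ℝ × ℝ)} {τ : ℝ} (h : τ ∉ Prod.fst '' A) :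
    sliceLen A τ = 0 := by
  have : {y : ℝ | (τ, y) ∈ A} = ∅ := eq_empty_of_forall_notMem fun y hy => h ⟨_, hy, rfl⟩
  rw [sliceLen, this, measureReal_empty]

theorem volume_real_add_le {A B S : Set ℝ} (hA : IsCompact A) (hB : IsCompact B)
    (hA0 : A.Nonempty) (hB0 : B.Nonempty) (hS : IsCompact S) (h : A + B ⊆ S) :
    volume.real A + volume.real B ≤ volume.real S := by
  have h1 := (Real.volume_add_le_of_isCompact hA hB hA0 hB0).trans (measure_mono h)
  rw [measureReal_def, measureReal_def, measureReal_def,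
    ← ENNReal.toReal_add hA.measure_lt_top.ne hB.measure_lt_top.ne]
  exact ENNReal.toReal_mono hS.measure_lt_top.ne h1

theorem sliceLen_add_le {A B : Set (ℝ × ℝ)} (hA : IsCompact A) (hB : IsCompact B) {p q : ℝ}
    (hp : p ∈ Prod.fst '' A) (hq : q ∈ Prod.fst '' B) :
    sliceLen A p + sliceLen B q ≤ sliceLen (A + B) (p + q) := by
  obtain ⟨⟨_, y⟩, hy, rfl⟩ := hp
  obtain ⟨⟨_, z⟩, hz, rfl⟩ := hq
  refine volume_real_add_le (isCompact_vertSlice hA _) (isCompact_vertSlice hB _) ⟨y, hy⟩ ⟨z, hz⟩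
    (isCompact_vertSlice (hA.add hB) _) ?_
  rintro _ ⟨a, ha, b, hb, rfl⟩
  exact ⟨_, ha, _, hb, rfl⟩

theorem concaveOn_sliceLen {A : Set (ℝ × ℝ)} (hA : IsCompact A) (hc : Convex ℝ A) :
    ConcaveOn ℝ (Prod.fst '' A) (sliceLen A) := by
  rw [concaveOn_iff_forall_pos]
  refine ⟨hc.linear_image (LinearMap.fst ℝ ℝ ℝ), ?_⟩
  rintro _ ⟨⟨p, y⟩, hy, rfl⟩ _ ⟨⟨q, z⟩, hz, rfl⟩ a b ha hb hab
  have hs : ∀ {c : ℝ}, 0 < c → ∀ τ, c • sliceLen A τ = volume.real (c • {y : ℝ | (τ, y) ∈ A}) := by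
    intro c hc τ
    rw [sliceLen, measureReal_def, measureReal_def, Measure.addHaar_smul]
    simp [abs_of_pos hc, hc.le]
  rw [hs ha, hs hb]
  refine volume_real_add_le ((isCompact_vertSlice hA _).smul _) ((isCompact_vertSlice hA _).smul _)
    (Nonempty.smul_set ⟨y, hy⟩) (Nonempty.smul_set ⟨z, hz⟩) (isCompact_vertSlice hA _) ?_
  rintro _ ⟨_, ⟨s, hs, rfl⟩, _, ⟨t, ht, rfl⟩, rfl⟩
  exact hc hs ht ha.le hb.le hab

theorem integral_sliceLen {A : Set (ℝ × ℝ)} (hA : IsCompact A) {φ : ℝ → ℝ} (hφ : Continuous φ) :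
    Integrable (fun τ => φ τ * sliceLen A τ) ∧
      ∫ τ, φ τ * sliceLen A τ = ∫ p in A, φ p.1 := by
  have hi : Integrable (A.indicator fun p : ℝ × ℝ => φ p.1) (volume.prod volume) :=
    (ContinuousOn.integrableOn_compact hA (by fun_prop)).integrable_indicator hA.measurableSet
  have h : ∀ τ, ∫ y, A.indicator (fun p : ℝ × ℝ => φ p.1) (τ, y) = φ τ * sliceLen A τ := by
    intro τ
    have : (fun y => A.indicator (fun p : ℝ × ℝ => φ p.1) (τ, y)) =
        {y : ℝ | (τ, y) ∈ A}.indicator fun _ => φ τ := rfl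
    rw [this, integral_indicator_const _ (isCompact_vertSlice hA τ).measurableSet, smul_eq_mul,
      mul_comm, sliceLen]
  have h1 := hi.integral_prod_left
  have h2 := integral_prod _ hi
  simp only [h] at h1 h2
  refine ⟨h1, h2.symm.trans ?_⟩
  rw [integral_indicator hA.measurableSet]
  rfl

theorem eq_of_forall_sub_le {f h : ℝ → ℝ} {w : ℝ} (hf : ContinuousOn f (Ioo (-w) w))
    (hfh : ∀ τ δ, τ ∈ Ioo (-w) w → τ + δ ∈ Ioo (-w) w → τ - δ ∈ Ioo (-w) w →
      h (τ + δ) + f (τ - δ) ≤ h τ + f τ) {a b : ℝ} (ha : a ∈ Ioo (-w) w) (hb : b ∈ Ioo (-w) w) :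
    h b - f b ≤ h a - f a := by
  have hca : ContinuousAt f a := hf.continuousAt (Ioo_mem_nhds ha.1 ha.2)
  have hcb : ContinuousAt f b := hf.continuousAt (Ioo_mem_nhds hb.1 hb.2)
  set d : ℕ → ℝ := fun N => (b - a) / (N + 1 : ℕ)
  have hd : Tendsto d atTop (𝓝 0) :=
    (tendsto_const_div_atTop_nhds_zero_nat (b - a)).comp (tendsto_add_atTop_nat 1)
  have hda : Tendsto (fun N => a - d N) atTop (𝓝 a) := by simpa using hd.const_sub a
  have hdb : Tendsto (fun N => b - d N) atTop (𝓝 b) := by simpa using hd.const_sub b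
  have hdb' : Tendsto (fun N => b + d N) atTop (𝓝 b) := by simpa using hd.const_add b
  have hlim : Tendsto (fun N => (f a - f (a - d N)) - (f b - f (b - d N))) atTop
      (𝓝 ((f a - f a) - (f b - f b))) :=
    ((hca.tendsto.comp hda).const_sub _).sub ((hcb.tendsto.comp hdb).const_sub _)
  simp only [sub_self] at hlim
  refine sub_nonpos.1 (ge_of_tendsto hlim ?_)
  filter_upwards [hda (Ioo_mem_nhds ha.1 ha.2), hdb' (Ioo_mem_nhds hb.1 hb.2)] with N hN1 hN2
  have hNd : ((N + 1 : ℕ) : ℝ) * d N = b - a := mul_div_cancel₀ _ (by positivity)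
  set δ := d N
  have hmem : ∀ c : ℝ, -1 ≤ c → c ≤ (N + 1 : ℕ) + 1 → a + c * δ ∈ Ioo (-w) w := by
    intro c h1 h2
    have : a + c * δ = ((N + 1 : ℕ) + 1 - c) / ((N + 1 : ℕ) + 2) * (a - δ) +
        (c + 1) / ((N + 1 : ℕ) + 2) * (b + δ) := by
      rw [show b = a + (N + 1 : ℕ) * δ by linarith]
      field_simp
      ring
    rw [this]
    have q1 : 0 ≤ (((N + 1 : ℕ) : ℝ) + 1 - c) / ((N + 1 : ℕ) + 2) :=
      div_nonneg (by linarith) (by positivity)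
    have q2 : 0 ≤ (c + 1) / (((N + 1 : ℕ) : ℝ) + 2) := div_nonneg (by linarith) (by positivity)
    refine convex_Ioo (-w) w hN1 hN2 q1 q2 ?_
    field_simp
    ring
  have hstep : ∀ k ∈ Finset.range (N + 1),
      (h (a + (k + 1 : ℕ) * δ) - f (a + (k + 1 : ℕ) * δ)) - (h (a + k * δ) - f (a + k * δ)) ≤
      (f (a + k * δ - δ) - f (a + k * δ)) * (-1) +
        (f (a + (k + 1 : ℕ) * δ - δ) - f (a + (k + 1 : ℕ) * δ)) := by
    intro k hk
    have hk : (k : ℝ) + 1 ≤ (N + 1 : ℕ) := by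
      exact_mod_cast Nat.succ_le_of_lt (Finset.mem_range.1 hk)
    have hk0 : (0 : ℝ) ≤ k := k.cast_nonneg
    have e1 : a + (k + 1 : ℕ) * δ = a + k * δ + δ := by push_cast; ring
    have h1 := hmem k (by linarith) (by linarith)
    have h2 := hmem (k + 1) (by linarith) (by linarith)
    have h3 := hmem (k - 1) (by linarith) (by linarith)
    have := hfh (a + k * δ) δ h1 (by convert h2 using 1; ring) (by convert h3 using 1; ring)
    rw [e1, add_sub_cancel_right]
    linarith
  have hsum := Finset.sum_le_sum hstep
  rw [Finset.sum_range_sub (fun k : ℕ => h (a + k * δ) - f (a + k * δ))] at hsum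
  have e2 := Finset.sum_range_sub (fun k : ℕ => f (a + k * δ - δ) - f (a + k * δ)) (N + 1)
  have e3 : ∀ k ∈ Finset.range (N + 1), (f (a + k * δ - δ) - f (a + k * δ)) * (-1) +
        (f (a + (k + 1 : ℕ) * δ - δ) - f (a + (k + 1 : ℕ) * δ)) =
      (f (a + (k + 1 : ℕ) * δ - δ) - f (a + (k + 1 : ℕ) * δ)) -
        (f (a + k * δ - δ) - f (a + k * δ)) := fun _ _ => by ring
  rw [Finset.sum_congr rfl e3, e2, hNd] at hsum
  simp only [Nat.cast_zero, zero_mul, add_zero, add_sub_cancel] at hsum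
  linarith

/-- A planar body with extremal sum with a symmetric body of the same width has its centroid in
the middle. -/
theorem integral_fst_eq {C D : Set (ℝ × ℝ)} (hC : IsCompact C) (hD : IsCompact D)
    (hCc : Convex ℝ C) (hDc : Convex ℝ D) {w m : ℝ} (hw : 0 ≤ w)
    (hCw : Prod.fst '' C = Icc (m - w) (m + w)) (hDw : Prod.fst '' D = Icc (-w) w)
    (hDs : ∀ p ∈ D, (-p.1, p.2) ∈ D)
    (hvol : volume.real (C + D) = 2 * (volume.real C + volume.real D)) :
    ∫ p in C, p.1 = m * volume.real C := by
  have hE := hC.add hD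
  have hEc := hCc.add hDc
  have hEw : Prod.fst '' (C + D) = Icc (m - 2 * w) (m + 2 * w) := by
    have := image_add (AddMonoidHom.fst ℝ ℝ) (s := C) (t := D)
    rw [AddMonoidHom.coe_fst, hCw, hDw, Icc_add_Icc (by linarith) (by linarith)] at this
    rw [this]
    congr 1 <;> ring
  have hI : ∀ {A : Set (ℝ × ℝ)}, IsCompact A →
      Integrable (sliceLen A) ∧ ∫ τ, sliceLen A τ = volume.real A := by
    intro A hA
    have := integral_sliceLen hA (φ := fun _ => 1) continuous_const
    simpa using this
  have hCi := (hI hC).1.comp_add_right m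
  have hEi := ((hI hE).1.comp_add_right m).comp_mul_left' two_ne_zero
  have hmC : ∀ τ, τ ∈ Icc (-w) w ↔ τ + m ∈ Prod.fst '' C := by
    intro τ
    rw [hCw, mem_Icc, mem_Icc]
    constructor <;> rintro ⟨h1, h2⟩ <;> constructor <;> linarith
  have hle : ∀ {s t}, s ∈ Icc (-w) w → t ∈ Icc (-w) w →
      sliceLen C (s + m) + sliceLen D t ≤ sliceLen (C + D) (s + t + m) := by
    intro s t hs ht
    rw [add_right_comm]
    exact sliceLen_add_le hC hD ((hmC s).1 hs) (by rwa [hDw])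
  have hF : ∀ τ, 0 ≤ sliceLen (C + D) (2 * τ + m) - (sliceLen C (τ + m) + sliceLen D τ) := by
    intro τ
    by_cases hτ : τ ∈ Icc (-w) w
    · have := hle hτ hτ
      rw [two_mul]
      linarith
    · rw [sliceLen_eq_zero fun h => hτ ((hmC τ).2 h), sliceLen_eq_zero (A := D) (by rwa [hDw])]
      linarith [sliceLen_nonneg (C + D) (2 * τ + m)]
  have hCD : Integrable fun τ => sliceLen C (τ + m) + sliceLen D τ := hCi.add (hI hD).1
  have hF0 : ∫ τ, (sliceLen (C + D) (2 * τ + m) - (sliceLen C (τ + m) + sliceLen D τ)) = 0 := by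
    rw [integral_sub hEi hCD, integral_add hCi (hI hD).1,
      integral_add_right_eq_self (sliceLen C),
      Measure.integral_comp_mul_left (fun τ => sliceLen (C + D) (τ + m)),
      integral_add_right_eq_self (sliceLen (C + D)), (hI hC).2, (hI hD).2, (hI hE).2, hvol]
    simp
  rw [integral_eq_zero_iff_of_nonneg hF (hEi.sub hCD)] at hF0
  have hcont : ∀ {A : Set (ℝ × ℝ)}, IsCompact A → Convex ℝ A →
      ContinuousOn (sliceLen A) (interior (Prod.fst '' A)) := fun hA hc =>
    ((concaveOn_sliceLen hA hc).subset interior_subset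
      (hc.linear_image (LinearMap.fst ℝ ℝ ℝ)).interior).continuousOn isOpen_interior
  have hcC : ContinuousOn (fun τ => sliceLen C (τ + m)) (Ioo (-w) w) := by
    refine (hcont hC hCc).comp (by fun_prop) fun τ hτ => ?_
    rw [hCw, interior_Icc]
    constructor <;> linarith [hτ.1, hτ.2]
  have hcD : ContinuousOn (sliceLen D) (Ioo (-w) w) := by
    have := hcont hD hDc
    rwa [hDw, interior_Icc] at this
  have hcE : ContinuousOn (fun τ => sliceLen (C + D) (2 * τ + m)) (Ioo (-w) w) := by
    refine (hcont hE hEc).comp (by fun_prop) fun τ hτ => ?_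
    rw [hEw, interior_Icc]
    constructor <;> linarith [hτ.1, hτ.2]
  have heq : EqOn (fun τ => sliceLen (C + D) (2 * τ + m))
      (fun τ => sliceLen C (τ + m) + sliceLen D τ) (Ioo (-w) w) :=
    Measure.eqOn_open_of_ae_eq (ae_restrict_of_ae (hF0.mono fun τ h => sub_eq_zero.1 h)) isOpen_Ioo
      hcE (hcC.add hcD)
  have hsub : ∀ τ δ, τ ∈ Ioo (-w) w → τ + δ ∈ Ioo (-w) w → τ - δ ∈ Ioo (-w) w →
      sliceLen C (τ + δ + m) + sliceLen D (τ - δ) ≤ sliceLen C (τ + m) + sliceLen D τ := by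
    intro τ δ h1 h2 h3
    refine (hle (Ioo_subset_Icc_self h2) (Ioo_subset_Icc_self h3)).trans ?_
    rw [show τ + δ + (τ - δ) + m = 2 * τ + m by ring]
    exact (heq h1).le
  have hconst : ∀ {a b}, a ∈ Ioo (-w) w → b ∈ Ioo (-w) w →
      sliceLen C (b + m) - sliceLen D b = sliceLen C (a + m) - sliceLen D a := fun ha hb =>
    (eq_of_forall_sub_le (h := fun τ => sliceLen C (τ + m)) hcD hsub ha hb).antisymm
      (eq_of_forall_sub_le (h := fun τ => sliceLen C (τ + m)) hcD hsub hb ha)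
  have hDe : ∀ τ, sliceLen D (-τ) = sliceLen D τ := by
    intro τ
    unfold sliceLen
    congr 1
    ext y
    exact ⟨fun h => by simpa using hDs _ h, fun h => hDs _ h⟩
  have hodd : ∀ᵐ τ : ℝ, -τ * sliceLen C (-τ + m) = -(τ * sliceLen C (τ + m)) := by
    have h0 : ∀ᵐ τ : ℝ, τ ∉ ({-w, w} : Set ℝ) :=
      (measure_eq_zero_iff_ae_notMem).1 ((toFinite _).measure_zero _)
    filter_upwards [h0] with τ hτ
    by_cases h : τ ∈ Ioo (-w) w
    · have h' : -τ ∈ Ioo (-w) w := ⟨by linarith [h.2], by linarith [h.1]⟩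
      have := hconst h h'
      rw [hDe] at this
      rw [show sliceLen C (-τ + m) = sliceLen C (τ + m) by linarith]
      ring
    · have h1 : τ ∉ Icc (-w) w := fun h2 => h ⟨lt_of_le_of_ne h2.1 fun e => hτ (by simp [← e]),
        lt_of_le_of_ne h2.2 fun e => hτ (by simp [e])⟩
      have h1' : -τ ∉ Icc (-w) w := fun h2 => h1 ⟨by linarith [h2.2], by linarith [h2.1]⟩
      rw [sliceLen_eq_zero fun h => h1 ((hmC τ).2 h), sliceLen_eq_zero fun h => h1' ((hmC _).2 h)]
      simp
  have hid := integral_sliceLen hC (φ := fun τ => τ) continuous_id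
  have hi2 : Integrable fun τ => τ * sliceLen C (τ + m) := by
    have := (hid.1.comp_add_right m).sub (hCi.const_mul m)
    refine this.congr (ae_of_all _ fun τ => ?_)
    simp only [Pi.sub_apply]
    ring
  have hz : ∫ τ, τ * sliceLen C (τ + m) = 0 := by
    have h1 := integral_neg_eq_self (fun τ => τ * sliceLen C (τ + m)) volume
    rw [integral_congr_ae hodd, integral_neg] at h1
    linarith
  have hs : ∫ τ, (τ + m) * sliceLen C (τ + m) =
      (∫ τ, m * sliceLen C (τ + m)) + ∫ τ, τ * sliceLen C (τ + m) := by
    rw [← integral_add (hCi.const_mul m) hi2]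
    exact integral_congr_ae (ae_of_all _ fun τ => by ring)
  rw [hz, add_zero, integral_const_mul, integral_add_right_eq_self (sliceLen C),
    integral_add_right_eq_self (fun τ => τ * sliceLen C τ), hid.2, (hI hC).2] at hs
  exact hs

end Planar

section PlanarBall
open MeasureTheory Set Filter Topology Metric

theorem supp_smul_right {n : ℕ} {A : Set (En n)} (hA : IsBody A) {t : ℝ} (ht : 0 ≤ t) (u : En n) :
    supp A (t • u) = t * supp A u := by
  refine le_antisymm (supp_le hA fun x hx => ?_) ?_
  · rw [real_inner_smul_left]
    exact mul_le_mul_of_nonneg_left (le_supp hA u hx) ht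
  · obtain ⟨x, hx, h⟩ := exists_eq_supp hA u
    rw [← h, ← real_inner_smul_left]
    exact le_supp hA _ hx

theorem supp_closedBall_center {n : ℕ} (c u : En n) {r : ℝ} (hr : 0 ≤ r) :
    supp (closedBall c r) u = inner ℝ u c + r * ‖u‖ := by
  rw [show closedBall c r = {c} + closedBall 0 r by simp,
    supp_add (IsBody.singleton c) (IsBody.closedBall 0 hr), supp_singleton, supp_closedBall u hr]

theorem neg_supp_neg_le {n : ℕ} {A : Set (En n)} (hA : IsBody A) (u : En n) :
    -supp A (-u) ≤ supp A u := by
  obtain ⟨x, hx⟩ := hA.nonempty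
  have h1 := le_supp hA u hx
  have h2 := le_supp hA (-u) hx
  rw [inner_neg_left] at h2
  linarith

theorem eq_inner_smul_of_dim_one {y : En 1} (hy : ‖y‖ = 1) (x : En 1) :
    x = (inner ℝ y x : ℝ) • y := by
  have h : y 0 * y 0 = 1 := by
    have := real_inner_self_eq_norm_sq y
    rw [hy, PiLp.inner_apply] at this
    have h : y 0 = 1 ∨ y 0 = -1 := by simpa using this
    rcases h with h | h <;> simp [h]
  ext i
  fin_cases i
  simp only [PiLp.inner_apply, PiLp.smul_apply, Finset.univ_unique, Finset.sum_singleton,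
    smul_eq_mul, RCLike.inner_apply, conj_trivial, Fin.default_eq_zero]
  simp only [Fin.zero_eta]
  linear_combination (-x 0) * h

theorem supp_add_supp_neg_of_dim_one {A : Set (En 1)} (hA : IsBody A) {y : En 1} (hy : ‖y‖ = 1) :
    (supp A y + supp A (-y)) / 2 * ballVol 1 = vol A := by
  have hr : 0 ≤ (supp A y + supp A (-y)) / 2 := by linarith [neg_supp_neg_le hA y]
  have h : A = closedBall (((supp A y - supp A (-y)) / 2) • y) ((supp A y + supp A (-y)) / 2) := by
    refine eq_of_supp_eq hA (IsBody.closedBall _ hr) fun u => ?_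
    rw [supp_closedBall_center _ _ hr, inner_smul_right]
    obtain ⟨a, rfl⟩ : ∃ a : ℝ, u = a • y := ⟨_, eq_inner_smul_of_dim_one hy u⟩
    rw [norm_smul, hy, real_inner_smul_left, real_inner_self_eq_norm_sq, hy, Real.norm_eq_abs]
    rcases le_total 0 a with ha | ha
    · rw [supp_smul_right hA ha, abs_of_nonneg ha]
      ring
    · rw [← neg_smul_neg, supp_smul_right hA (neg_nonneg.2 ha), abs_of_nonpos ha]
      ring
  have h2 := setQuer_closedBall (((supp A y - supp A (-y)) / 2) • y) hr (Nat.zero_le (0 + 1))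
  rw [← h, setQuer_zero hA] at h2
  rw [h2]
  simp

theorem IsBody.projE_image {n : ℕ} {L : Set (En (n + 1))} (hL : IsBody L) (v : En (n + 1)) :
    IsBody (projE v '' L) :=
  ⟨hL.isCompact.image (projE v).continuous, hL.convex.linear_image (projE v).toLinearMap,
    hL.nonempty.image _⟩

theorem supp_add_supp_neg_of_planar {L : Set (En 2)} (hL : IsBody L) (hi : (interior L).Nonempty)
    {w : ℝ} (h1 : setQuer 1 L = w * ballVol 2) (h2 : setQuer 0 L = w ^ 2 * ballVol 2)
    {u : En 2} (hu : ‖u‖ = 1) : supp L u + supp L (-u) = 2 * w := by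
  obtain ⟨v, hv, huv⟩ : ∃ v : En 2, v ≠ 0 ∧ inner ℝ u v = (0 : ℝ) := by
    refine ⟨!₂[-u 1, u 0], fun h => ?_, ?_⟩
    · have h0 : u 1 = 0 := by simpa using congrArg (fun x : En 2 => x 0) h
      have h1 : u 0 = 0 := by simpa using congrArg (fun x : En 2 => x 1) h
      have : u = 0 := by ext i; fin_cases i <;> simp [h0, h1]
      simp [this] at hu
    · simp [PiLp.inner_apply, Fin.sum_univ_two]
      ring
  have h := (setQuer_projE_eq hL hi h1 h2 hv).1
  have hb := hL.projE_image v
  rw [setQuer_zero hb] at h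
  have hy : ‖projE v u‖ = 1 := by
    have := inner_projE hv huv u
    rw [real_inner_self_eq_norm_sq, real_inner_self_eq_norm_sq, hu] at this
    nlinarith [norm_nonneg (projE v u)]
  rw [← supp_add_supp_neg_of_dim_one hb hy, ← map_neg, supp_projE hv huv,
    supp_projE hv (by rw [inner_neg_left, huv, neg_zero])] at h
  linarith [mul_right_cancel₀ (ballVol_pos 1).ne' h]

/-- Orthonormal coordinates in the plane whose first axis is spanned by `u`. -/
def planarMap (u : En 2) : En 2 →L[ℝ] ℝ × ℝ :=
  ((EuclideanSpace.proj 0).prod (EuclideanSpace.proj 1)).comp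
    (alignE u).toContinuousLinearEquiv.toContinuousLinearMap

theorem planarMap_apply (u x : En 2) : planarMap u x = (alignE u x 0, alignE u x 1) := rfl

theorem planarMap_fst {u : En 2} (hu : ‖u‖ = 1) (x : En 2) :
    (planarMap u x).1 = inner ℝ u x := by
  rw [planarMap_apply, ← (alignE u).inner_map_map, alignE_self,
    EuclideanSpace.inner_single_left, hu]
  simp

theorem exists_planarMap_eq (u : En 2) (p : ℝ × ℝ) :
    ∃ x, planarMap u x = p ∧ ‖x‖ ^ 2 = p.1 ^ 2 + p.2 ^ 2 := by
  refine ⟨(alignE u).symm !₂[p.1, p.2], ?_, ?_⟩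
  · rw [planarMap_apply, LinearIsometryEquiv.apply_symm_apply]
    rfl
  · rw [LinearIsometryEquiv.norm_map, EuclideanSpace.norm_sq_eq, Fin.sum_univ_two]
    simp

theorem planarMap_injective (u : En 2) : Function.Injective (planarMap u) := by
  intro x y h
  rw [planarMap_apply, planarMap_apply, Prod.mk.injEq] at h
  refine (alignE u).injective ?_
  ext i
  fin_cases i
  exacts [h.1, h.2]

theorem norm_sq_eq_planarMap (u x : En 2) :
    ‖x‖ ^ 2 = (planarMap u x).1 ^ 2 + (planarMap u x).2 ^ 2 := by
  obtain ⟨y, hy, h⟩ := exists_planarMap_eq u (planarMap u x)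
  rw [← planarMap_injective u hy, h, hy]

theorem measurePreserving_planarMap (u : En 2) : MeasurePreserving (planarMap u) :=
  ((volume_preserving_finTwoArrow ℝ).comp (PiLp.volume_preserving_ofLp (Fin 2))).comp
    (alignE u).measurePreserving

theorem measurableEmbedding_planarMap (u : En 2) : MeasurableEmbedding (planarMap u) :=
  (planarMap u).continuous.measurableEmbedding (planarMap_injective u)

theorem volume_planarMap_image (u : En 2) (A : Set (En 2)) :
    volume.real (planarMap u '' A) = vol A := by
  rw [measureReal_def, ← (measurePreserving_planarMap u).measure_preimage_emb
    (measurableEmbedding_planarMap u), preimage_image_eq _ (planarMap_injective u)]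
  rfl

theorem fst_image_planarMap {L : Set (En 2)} (hL : IsBody L) {u : En 2} (hu : ‖u‖ = 1) :
    Prod.fst '' (planarMap u '' L) = Icc (-supp L (-u)) (supp L u) := by
  have hc : Convex ℝ (Prod.fst '' (planarMap u '' L)) :=
    (hL.convex.linear_image (planarMap u).toLinearMap).linear_image (LinearMap.fst ℝ ℝ ℝ)
  have hm : ∀ x ∈ L, inner ℝ u x ∈ Prod.fst '' (planarMap u '' L) := fun x hx =>
    ⟨_, ⟨x, hx, rfl⟩, planarMap_fst hu x⟩
  refine Subset.antisymm ?_ ?_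
  · rintro _ ⟨_, ⟨x, hx, rfl⟩, rfl⟩
    rw [planarMap_fst hu]
    have h1 := le_supp hL u hx
    have h2 := le_supp hL (-u) hx
    rw [inner_neg_left] at h2
    exact ⟨by linarith, h1⟩
  · obtain ⟨x, hx, h1⟩ := exists_eq_supp hL u
    obtain ⟨y, hy, h2⟩ := exists_eq_supp hL (-u)
    rw [inner_neg_left] at h2
    rw [← h1, ← h2, neg_neg]
    exact hc.ordConnected.out (hm y hy) (hm x hx)

theorem planar_supp_eq {L : Set (En 2)} (hL : IsBody L) (hi : (interior L).Nonempty)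
    {w : ℝ} (hw : 0 ≤ w) (h1 : setQuer 1 L = w * ballVol 2)
    (h2 : setQuer 0 L = w ^ 2 * ballVol 2) :
    ∃ c : En 2, ∀ u, supp L u = w * ‖u‖ + inner ℝ c u := by
  have hB : IsBody (closedBall (0 : En 2) w) := IsBody.closedBall 0 hw
  have hBw : closedBall (0 : En 2) w = w • closedBall 0 1 := by
    simpa using closedBall_eq (0 : En 2) hw
  have hvB : vol (closedBall (0 : En 2) w) = w ^ 2 * ballVol 2 := by
    rw [hBw, vol_smul hw, ballVol]
  have hvL : vol L = w ^ 2 * ballVol 2 := by rw [← setQuer_zero hL, h2]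
  have hvs : vol (L + closedBall (0 : En 2) w) = 4 * (w ^ 2 * ballVol 2) := by
    have := steiner hL zero_le_one hw
    rw [one_smul, ← hBw] at this
    rw [this]
    simp only [Finset.sum_range_succ, Finset.sum_range_zero]
    rw [h1, h2, show setQuer (1 + 1) L = ballVol 2 from setQuer_top hL]
    norm_num [Nat.choose]
    ring
  refine ⟨(vol L)⁻¹ • ∫ x in L, x, ?_⟩
  have hunit : ∀ u : En 2, ‖u‖ = 1 →
      supp L u = w + inner ℝ ((vol L)⁻¹ • ∫ x in L, x) u := by
    intro u hu
    have hwid := supp_add_supp_neg_of_planar hL hi h1 h2 hu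
    have key := integral_fst_eq (C := planarMap u '' L) (D := planarMap u '' closedBall 0 w)
      (hL.isCompact.image (planarMap u).continuous) (hB.isCompact.image (planarMap u).continuous)
      (hL.convex.linear_image (planarMap u).toLinearMap)
      (hB.convex.linear_image (planarMap u).toLinearMap) (m := supp L u - w) hw
      (by rw [fst_image_planarMap hL hu]; congr 1 <;> linarith)
      (by rw [fst_image_planarMap hB hu, supp_closedBall _ hw, supp_closedBall _ hw, norm_neg, hu,
            mul_one])
      (by
        rintro _ ⟨x, hx, rfl⟩
        obtain ⟨y, hy, hn⟩ := exists_planarMap_eq u (-(planarMap u x).1, (planarMap u x).2)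
        refine ⟨y, ?_, hy⟩
        rw [mem_closedBall_zero_iff] at hx ⊢
        have hxy : ‖y‖ ^ 2 = ‖x‖ ^ 2 := by rw [hn, norm_sq_eq_planarMap u x]; ring
        rwa [(sq_eq_sq₀ (norm_nonneg _) (norm_nonneg _)).1 hxy])
      (by
        rw [← image_add, volume_planarMap_image, volume_planarMap_image, volume_planarMap_image,
          hvs, hvL, hvB]
        ring)
    rw [volume_planarMap_image, (measurePreserving_planarMap u).setIntegral_image_emb
      (measurableEmbedding_planarMap u)] at key
    simp only [planarMap_fst hu] at key
    have hid : IntegrableOn (fun x : En 2 => x) L :=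
      continuous_id.continuousOn.integrableOn_compact hL.isCompact
    rw [integral_inner hid] at key
    rw [real_inner_smul_left, real_inner_comm, key]
    rw [mul_comm (supp L u - w), inv_mul_cancel_left₀ (vol_pos hL hi).ne']
    ring
  intro u
  by_cases hu : u = 0
  · obtain ⟨x, -, hx⟩ := exists_eq_supp hL (0 : En 2)
    rw [hu, ← hx]
    simp
  · have hn : ‖u‖ ≠ 0 := norm_ne_zero_iff.2 hu
    have hs : u = ‖u‖ • (‖u‖⁻¹ • u) := by rw [smul_inv_smul₀ hn]
    have h := hunit (‖u‖⁻¹ • u) (by rw [norm_smul, norm_inv, norm_norm, inv_mul_cancel₀ hn])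
    conv_lhs => rw [hs]
    rw [supp_smul_right hL (norm_nonneg u), h, inner_smul_right]
    field_simp

end PlanarBall

section BallCharacterization
open Metric

theorem exists_orthogonal_pair {n : ℕ} (a b : En (n + 3)) :
    ∃ v : En (n + 3), v ≠ 0 ∧ inner ℝ a v = (0 : ℝ) ∧ inner ℝ b v = (0 : ℝ) := by
  have h : (Submodule.span ℝ {a, b})ᗮ ≠ ⊥ := by
    intro h
    have h1 := (finrank_span_finset_le_card (R := ℝ) ({a, b} : Finset (En (n + 3)))).trans
      Finset.card_le_two
    rw [Set.finrank, Finset.coe_pair, Submodule.orthogonal_eq_bot_iff.1 h, finrank_top,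
      finrank_euclideanSpace_fin] at h1
    omega
  obtain ⟨v, hv, hv0⟩ := Submodule.exists_mem_ne_zero_of_ne_bot h
  rw [Submodule.mem_orthogonal] at hv
  exact ⟨v, hv0, hv a (Submodule.subset_span (by simp)), hv b (Submodule.subset_span (by simp))⟩

theorem exists_supp_eq_of_setQuer_eq {n : ℕ} : ∀ {L : Set (En (n + 2))}, IsBody L →
    (interior L).Nonempty → ∀ {w : ℝ}, 0 ≤ w → setQuer (n + 1) L = w * ballVol (n + 2) →
    setQuer n L = w ^ 2 * ballVol (n + 2) →
    ∃ c : En (n + 2), ∀ u, supp L u = w * ‖u‖ + inner ℝ c u := by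
  induction n with
  | zero => exact fun hL hi _ hw h1 h2 => planar_supp_eq hL hi hw h1 h2
  | succ n ih =>
    intro L hL hi w hw h1 h2
    have hproj : ∀ v : En (n + 3), v ≠ 0 → ∃ c : En (n + 2), ∀ x, inner ℝ x v = (0 : ℝ) →
        supp L x - w * ‖x‖ = inner ℝ c (projE v x) := by
      intro v hv
      obtain ⟨e1, e2⟩ := setQuer_projE_eq hL hi h1 h2 hv
      obtain ⟨c, hc⟩ := ih (hL.projE_image v) (interior_projE_image hi v) hw e1 (e2 n rfl)
      refine ⟨c, fun x hx => ?_⟩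
      have hn : ‖projE v x‖ = ‖x‖ := by
        rw [← sq_eq_sq₀ (norm_nonneg _) (norm_nonneg _), ← real_inner_self_eq_norm_sq,
          ← real_inner_self_eq_norm_sq, inner_projE hv hx]
      rw [← supp_projE hv hx, hc, hn]
      ring
    let φ : En (n + 3) →ₗ[ℝ] ℝ :=
      { toFun := fun x => supp L x - w * ‖x‖
        map_add' := fun a b => by
          obtain ⟨v, hv, ha, hb⟩ := exists_orthogonal_pair a b
          obtain ⟨c, hc⟩ := hproj v hv
          rw [hc a ha, hc b hb, hc (a + b) (by rw [inner_add_left, ha, hb, add_zero]), map_add,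
            inner_add_right]
        map_smul' := fun t a => by
          obtain ⟨v, hv, ha, -⟩ := exists_orthogonal_pair a a
          obtain ⟨c, hc⟩ := hproj v hv
          rw [hc a ha, hc (t • a) (by rw [real_inner_smul_left, ha, mul_zero]), map_smul,
            inner_smul_right, RingHom.id_apply, smul_eq_mul] }
    refine ⟨(InnerProductSpace.toDual ℝ _).symm φ.toContinuousLinearMap, fun u => ?_⟩
    rw [InnerProductSpace.toDual_symm_apply]
    change _ = _ + (supp L u - w * ‖u‖)
    ring

theorem eq_closedBall_of_setQuer_sq_eq {n : ℕ} {L : Set (En (n + 2))} (hL : IsBody L)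
    (hi : (interior L).Nonempty)
    (h : setQuer n L * ballVol (n + 2) = setQuer (n + 1) L ^ 2) :
    ∃ (c : En (n + 2)) (ρ : ℝ), 0 < ρ ∧ L = closedBall c ρ := by
  have hκ := ballVol_pos (n + 2)
  have hw : 0 < setQuer (n + 1) L / ballVol (n + 2) :=
    div_pos (setQuer_pos hL hi (by omega)) hκ
  obtain ⟨c, hc⟩ := exists_supp_eq_of_setQuer_eq hL hi hw.le (div_mul_cancel₀ _ hκ.ne').symm (by
    field_simp
    exact h)
  refine ⟨c, _, hw, eq_of_supp_eq hL (IsBody.closedBall _ hw.le) fun u => ?_⟩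
  rw [supp_closedBall_center _ _ hw.le, hc, real_inner_comm]
  ring

end BallCharacterization

section QuermassintegralBridge
open Metric

theorem ConvexBody.isBody {n : ℕ} (K : Body n) : IsBody (K : Set (En n)) :=
  ⟨K.isCompact, K.convex, K.nonempty⟩

theorem ConvexBody.coe_sum_ite {n : ℕ} (K L : Body n) (S : Finset (Fin n)) (p : Fin n → Prop)
    [DecidablePred p] :
    ((∑ l ∈ S, if p l then K else L : Body n) : Set (En n)) =
      ((S.filter p).card : ℝ) • (K : Set (En n)) +
        ((S.filter fun l => ¬ p l).card : ℝ) • (L : Set (En n)) := by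
  have h : ∀ (M : Body n) (m : ℕ),
      ((m • M : Body n) : Set (En n)) = (m : ℝ) • (M : Set (En n)) := by
    intro M m
    induction m with
    | zero =>
      rw [zero_nsmul, Nat.cast_zero, Set.zero_smul_set M.nonempty]
      rfl
    | succ m ih =>
      rw [succ_nsmul, ConvexBody.coe_add, ih, Nat.cast_succ,
        M.convex.add_smul (Nat.cast_nonneg m) zero_le_one, one_smul]
  rw [Finset.sum_ite, Finset.sum_const, Finset.sum_const, ConvexBody.coe_add, h, h]

theorem quer_eq_setQuer {n : ℕ} (j : ℕ) (K : Body n) : quer j K = setQuer j (K : Set (En n)) := by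
  unfold quer mixedVol setQuer polar
  simp only [bvol, ConvexBody.coe_sum_ite]
  rfl

end QuermassintegralBridge

/-- **Lemma 7.4 (b).** For a non-trivial `SO(n)` equivariant `Φ_i ∈ MVal_i` with constant
`r(Φ_i)`, every body with non-empty interior satisfies
`W_{n-i}(K)^{i+1} ≥ (κ_n^i / r(Φ_i)^{i+1}) W_{n-1-i}(Φ_i K)`, with equality (when `Φ_i`
preserves non-empty interiors) if and only if `Φ_i K` is a ball. -/
theorem quermassintegral_upper_bound (n i : ℕ) (hn : 3 ≤ n)
    (hi1 : 1 ≤ i) (hi2 : i ≤ n - 1)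
    (Φ : Body n → Body n) (hΦ : IsMinkValHom i Φ) (hSO : IsSOEquivariant Φ)
    (hnt : ∃ K : Body n, Φ K ≠ 0)
    (r : ℝ) (hr : 0 < r) (hrel : ∀ K : Body n, quer (n - 1) (Φ K) = r * quer (n - i) K) :
    ∀ K : Body n, HasInterior K →
      (kappa n ^ i / r ^ (i + 1)) * quer (n - 1 - i) (Φ K) ≤ quer (n - i) K ^ (i + 1) ∧
      ((∀ L : Body n, HasInterior L → HasInterior (Φ L)) →
        ((kappa n ^ i / r ^ (i + 1)) * quer (n - 1 - i) (Φ K) = quer (n - i) K ^ (i + 1) ↔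
          ∃ (c : En n) (ρ : ℝ), 0 < ρ ∧ (Φ K : Set (En n)) = Metric.closedBall c ρ)) := by
  obtain ⟨n, rfl⟩ := Nat.exists_eq_add_of_le' (show 2 ≤ n by omega)
  obtain ⟨k, rfl⟩ := Nat.exists_eq_add_of_le' hi1
  intro K hK
  have hk : k ≤ n := by omega
  set L : Set (En (n + 2)) := (Φ K : Set (En (n + 2)))
  have hL : IsBody L := (Φ K).isBody
  have hrel' : setQuer (n + 1) L = r * quer (n + 2 - (k + 1)) K := by
    rw [← hrel K, quer_eq_setQuer]
    rfl
  have hκ : kappa (n + 2) = ballVol (n + 2) := rfl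
  have hidx : n + 2 - 1 - (k + 1) = n - k := by omega
  rw [hidx, quer_eq_setQuer, hκ]
  have hdiv : ballVol (n + 2) ^ (k + 1) / r ^ (k + 1 + 1) * setQuer (n - k) L =
      ballVol (n + 2) ^ (k + 1) * setQuer (n - k) L / r ^ (k + 2) := by ring
  have hpow : quer (n + 2 - (k + 1)) K ^ (k + 1 + 1) =
      setQuer (n + 1) L ^ (k + 2) / r ^ (k + 2) := by
    rw [hrel', mul_pow]
    field_simp
  rw [hdiv, hpow]
  have hrp : 0 < r ^ (k + 2) := by positivity
  refine ⟨div_le_div_of_nonneg_right (setQuer_pow_le hL hk) hrp.le, fun hpres => ?_⟩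
  rw [div_left_inj' hrp.ne']
  constructor
  · intro h
    have hi : (interior L).Nonempty := hpres K hK
    exact eq_closedBall_of_setQuer_sq_eq hL hi (setQuer_sq_eq hL hi hk h)
  · rintro ⟨c, ρ, hρ, h⟩
    rw [h, setQuer_closedBall c hρ.le (by omega), setQuer_closedBall c hρ.le (by omega),
      show n + 1 + 1 - (n - k) = k + 2 by omega, show n + 1 + 1 - (n + 1) = 1 by omega]
    ring
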